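/- arXiv:1706.03447 — 2 statements merged into one kernel-verified Lean document; each statement's English description precedes it below -/
import Mathlib

section
/- Let d ≥ 3 and let P be a centrally symmetric simplicial d-polytope in ℝ^d. Then g_2(P) ≥ C(d,2) − d. -/
open Finset
open scoped Classical

noncomputable section

/-- A finite graph: a finite vertex set together with a finite set of edges,
where each edge is (intended to be) a 2-element subset of the vertex set. -/
structure FinGraph (ι : Type) where
  verts : Finset ι
  edges : Finset (Finset ι)

/-- Every edge is a 2-element subset of the vertex set. -/
def FinGraph.Good {ι : Type} (G : FinGraph ι) : Prop :=
  ∀ e ∈ G.edges, e ⊆ G.verts ∧ e.card = 2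

/-- The standard inner (dot) product on `ℝ^d`. -/
def dotR {d : ℕ} (x y : Fin d → ℝ) : ℝ := ∑ i, x i * y i

/-- An infinitesimal motion of the framework `(G, p)`. -/
def IsMotion {ι : Type} {d : ℕ} (G : FinGraph ι) (p m : ι → Fin d → ℝ) : Prop :=
  ∀ e ∈ G.edges, ∀ u ∈ e, ∀ v ∈ e, dotR (p u - p v) (m u - m v) = 0

/-- The framework `(G, p)` is infinitesimally rigid in `ℝ^d`: every infinitesimal
motion is the restriction of a motion `x ↦ A x + b` of `ℝ^d` with `A` skew-symmetric. -/
def IsInfRigid {ι : Type} (d : ℕ) (G : FinGraph ι) (p : ι → Fin d → ℝ) : Prop :=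
  ∀ m : ι → Fin d → ℝ, IsMotion G p m →
    ∃ (A : Matrix (Fin d) (Fin d) ℝ) (b : Fin d → ℝ),
      A.transpose = -A ∧ ∀ v ∈ G.verts, m v = A.mulVec (p v) + b

/-- A stress on the framework `(G, p)`. -/
def IsStress {ι : Type} {d : ℕ} (G : FinGraph ι) (p : ι → Fin d → ℝ)
    (ω : Finset ι → ℝ) : Prop :=
  ∀ v ∈ G.verts,
    (∑ e ∈ G.edges.filter (fun e => v ∈ e), ∑ u ∈ e.erase v, ω e • (p v - p u)) = 0

/-- A centrally symmetric framework with free involution `ν` satisfying `p (ν v) = -(p v)`. -/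
def IsCSFramework {ι : Type} {d : ℕ} (G : FinGraph ι) (p : ι → Fin d → ℝ) (ν : ι → ι) : Prop :=
  (∀ v ∈ G.verts, ν (ν v) = v) ∧
  (∀ v ∈ G.verts, ν v ∈ G.verts) ∧
  (∀ v ∈ G.verts, ν v ≠ v) ∧
  (∀ e ∈ G.edges, e.image ν ∈ G.edges) ∧
  (∀ e ∈ G.edges, e.image ν ≠ e) ∧
  (∀ v ∈ G.verts, p (ν v) = -(p v))

/-- The convex body spanned by a finite point set. -/
def polyBody {d : ℕ} (V : Finset (Fin d → ℝ)) : Set (Fin d → ℝ) :=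
  convexHull ℝ (V : Set (Fin d → ℝ))

/-- `(f, c)` is a supporting functional for `conv V` exposing the face `F`. -/
def IsSupport {d : ℕ} (V : Finset (Fin d → ℝ)) (f : (Fin d → ℝ) →ₗ[ℝ] ℝ) (c : ℝ)
    (F : Set (Fin d → ℝ)) : Prop :=
  (∀ y ∈ polyBody V, f y ≤ c) ∧ F = {y ∈ polyBody V | f y = c}

/-- A proper face of the polytope `conv V`. -/
def IsProperFace {d : ℕ} (V : Finset (Fin d → ℝ)) (F : Set (Fin d → ℝ)) : Prop :=
  (∃ f c, IsSupport V f c F) ∧ F ≠ polyBody V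

/-- A simplicial `d`-polytope in `ℝ^d`, recorded by its vertex set `V`: the polytope is
`conv V`, it is `d`-dimensional, every element of `V` is a vertex, and every proper face
is a simplex (the convex hull of its affinely independent vertex set). -/
structure SPolytope (d : ℕ) where
  V : Finset (Fin d → ℝ)
  span_top : affineSpan ℝ (V : Set (Fin d → ℝ)) = ⊤
  extreme : ∀ v ∈ V, v ∉ convexHull ℝ ((V.erase v : Finset (Fin d → ℝ)) : Set (Fin d → ℝ))
  simplicial : ∀ F : Set (Fin d → ℝ), IsProperFace V F →
    AffineIndependent ℝ
      (fun x : {y : Fin d → ℝ // y ∈ (V : Set (Fin d → ℝ)) ∩ F} => (x : Fin d → ℝ)) ∧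
    F = convexHull ℝ ((V : Set (Fin d → ℝ)) ∩ F)

/-- `s` is a face of the boundary complex `∂P`. -/
def BFace {d : ℕ} (P : SPolytope d) (s : Finset (Fin d → ℝ)) : Prop :=
  s ⊆ P.V ∧ ∃ F : Set (Fin d → ℝ), IsProperFace P.V F ∧ (s : Set (Fin d → ℝ)) ⊆ F

/-- The number of vertices of `∂P`. -/
def f0 {d : ℕ} (P : SPolytope d) : ℕ := P.V.card

/-- The edges of `∂P`. -/
def edgeFinset {d : ℕ} (P : SPolytope d) : Finset (Finset (Fin d → ℝ)) :=
  P.V.powerset.filter fun e => e.card = 2 ∧ BFace P e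

/-- The number of edges of `∂P`. -/
def f1 {d : ℕ} (P : SPolytope d) : ℕ := (edgeFinset P).card

/-- `g₂(P) = f₁ - d f₀ + C(d+1, 2)`. -/
def g2 {d : ℕ} (P : SPolytope d) : ℤ :=
  (f1 P : ℤ) - (d : ℤ) * (f0 P : ℤ) + ((d + 1).choose 2 : ℤ)

/-- `P` is centrally symmetric. -/
def IsCS {d : ℕ} (P : SPolytope d) : Prop := ∀ v ∈ P.V, -v ∈ P.V

/-- A missing face of `∂P`. -/
def IsMissingFace {d : ℕ} (P : SPolytope d) (σ : Finset (Fin d → ℝ)) : Prop :=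
  σ ⊆ P.V ∧ ¬ BFace P σ ∧ ∀ τ ⊂ σ, BFace P τ

/-- `P` is prime: `∂P` has no missing facet, i.e. no missing face of cardinality `d`. -/
def IsPrimePoly {d : ℕ} (P : SPolytope d) : Prop :=
  ¬ ∃ σ : Finset (Fin d → ℝ), IsMissingFace P σ ∧ σ.card = d

/-- The graph (1-skeleton) of `∂P` as a framework graph. -/
def fullGraph {d : ℕ} (P : SPolytope d) : FinGraph (Fin d → ℝ) :=
  ⟨P.V, edgeFinset P⟩

/-- The graph (1-skeleton) of the star of the face `τ` in `∂P`. -/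
def starGraph {d : ℕ} (P : SPolytope d) (τ : Finset (Fin d → ℝ)) : FinGraph (Fin d → ℝ) :=
  ⟨P.V.filter fun v => BFace P (insert v τ),
   P.V.powerset.filter fun e => e.card = 2 ∧ BFace P (e ∪ τ)⟩

/-- Adjacency in the graph of `∂P`. -/
def Adj {d : ℕ} (P : SPolytope d) (u v : Fin d → ℝ) : Prop :=
  u ≠ v ∧ BFace P {u, v}

/-- `σ` is a face of the link of the face `τ` in `∂P`. -/
def LinkFace {d : ℕ} (P : SPolytope d) (τ σ : Finset (Fin d → ℝ)) : Prop :=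
  Disjoint σ τ ∧ BFace P (σ ∪ τ)

/-- `P` is a `d`-dimensional cross-polytope: its vertex set is `{±b₁, …, ±b_d}`
for some basis `b₁, …, b_d` of `ℝ^d`. -/
def IsCrossPolytope {d : ℕ} (P : SPolytope d) : Prop :=
  ∃ b : Fin d → (Fin d → ℝ), LinearIndependent ℝ b ∧
    (P.V : Set (Fin d → ℝ)) = Set.range b ∪ Set.range (fun i => -(b i))

/-- A facet of `P`: a proper face with `d` vertices. -/
def IsFacet {d : ℕ} (P : SPolytope d) (F : Set (Fin d → ℝ)) : Prop :=
  IsProperFace P.V F ∧ ((P.V : Set (Fin d → ℝ)) ∩ F).ncard = d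

/-- `x` lies beyond exactly one facet of `P`: it is strictly separated from `P` by the
affine hull of one facet `F`, and not separated from `P` by the affine hull of any
other facet. -/
def BeyondExactlyOne {d : ℕ} (P : SPolytope d) (x : Fin d → ℝ) : Prop :=
  ∃ F : Set (Fin d → ℝ), IsFacet P F ∧
    (∀ f c, IsSupport P.V f c F → c < f x) ∧
    (∀ F' : Set (Fin d → ℝ), IsFacet P F' → F' ≠ F →
      ∀ f c, IsSupport P.V f c F' → f x < c)

/-- `P` is obtained from a `d`-dimensional cross-polytope by symmetric stacking: there is
a sequence of cs simplicial `d`-polytopes starting at a cross-polytope and ending at `P`,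
each obtained from the previous one as `conv (P_k ∪ {v, -v})` for a point `v` lying
beyond exactly one facet of `P_k`. -/
def SymmetricStackingFrom {d : ℕ} (P : SPolytope d) : Prop :=
  ∃ (m : ℕ) (Q : Fin (m + 1) → SPolytope d),
    (∀ k, IsCS (Q k)) ∧
    IsCrossPolytope (Q 0) ∧
    Q (Fin.last m) = P ∧
    ∀ k : Fin m, ∃ v : Fin d → ℝ,
      BeyondExactlyOne (Q (Fin.castSucc k)) v ∧
      polyBody (Q (Fin.succ k)).V =
        convexHull ℝ (polyBody (Q (Fin.castSucc k)).V ∪ {v, -v})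

/-- `P` is a stacked `d`-polytope: obtained from a `d`-simplex by repeatedly adding a
point beyond exactly one facet. -/
def IsStacked {d : ℕ} (P : SPolytope d) : Prop :=
  ∃ (m : ℕ) (R : Fin (m + 1) → SPolytope d),
    (R 0).V.card = d + 1 ∧
    R (Fin.last m) = P ∧
    ∀ k : Fin m, ∃ v : Fin d → ℝ,
      BeyondExactlyOne (R (Fin.castSucc k)) v ∧
      polyBody (R (Fin.succ k)).V =
        convexHull ℝ (polyBody (R (Fin.castSucc k)).V ∪ {v})

/-- Every `d` vertices of `P`, no two of which are antipodal, are affinely independent. -/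
def GenPos {d : ℕ} (P : SPolytope d) : Prop :=
  ∀ S : Finset (Fin d → ℝ), S ⊆ P.V → S.card = d →
    (∀ x ∈ S, ∀ y ∈ S, x ≠ -y) →
    AffineIndependent ℝ (fun s : {x : Fin d → ℝ // x ∈ S} => (s : Fin d → ℝ))

/-- The graph of the cone `v₀ * S` over a simplicial complex `S` (a set of finsets):
the vertices of `S` together with `v₀`, and the edges of `S` together with all edges
from `v₀` to vertices of `S`. -/
def coneGraph {d : ℕ} (P : SPolytope d) (v0 : Fin d → ℝ)
    (S : Set (Finset (Fin d → ℝ))) : FinGraph (Fin d → ℝ) :=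
  ⟨insert v0 (P.V.filter fun u => ({u} : Finset (Fin d → ℝ)) ∈ S),
   (P.V.powerset.filter fun e => e.card = 2 ∧ e ∈ S) ∪
     (P.V.filter fun u => ({u} : Finset (Fin d → ℝ)) ∈ S).image
       fun u => ({v0, u} : Finset (Fin d → ℝ))⟩


structure Fan (d : ℕ) where
  V : Finset (Fin d → ℝ)
  F : Finset (Finset (Fin d → ℝ))
  q : Finset (Fin d → ℝ) → Module.Dual ℝ (Fin d → ℝ)
  b : Finset (Fin d → ℝ) → (Fin d → ℝ) → Module.Dual ℝ (Fin d → ℝ)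
  D : Finset (Fin d → ℝ) → ℝ
  y : Fin d → ℝ
  sub : ∀ τ ∈ F, τ ⊆ V
  card : ∀ τ ∈ F, τ.card = d
  qle : ∀ τ ∈ F, ∀ v ∈ V, q τ v ≤ 1
  qeq : ∀ τ ∈ F, ∀ v ∈ V, q τ v = 1 ↔ v ∈ τ
  bdual : ∀ τ ∈ F, ∀ i ∈ τ, ∀ j ∈ τ, b τ i j = if i = j then 1 else 0
  brep : ∀ τ ∈ F, ∀ x, ∑ i ∈ τ, b τ i x • i = x
  adj : ∀ τ ∈ F, ∀ i ∈ τ, ∃ τ' ∈ F, τ' ≠ τ ∧ τ.erase i ⊆ τ'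
  Dpos : ∀ τ ∈ F, 0 < D τ
  Drel : ∀ S j j', j ∉ S → j' ∉ S → insert j S ∈ F → insert j' S ∈ F →
    D (insert j S) = |b (insert j' S) j' j| * D (insert j' S)
  gen : ∀ τ ∈ F, ∀ i ∈ τ, b τ i y ≠ 0

namespace Fan
variable {d : ℕ} (X : Fan d)

lemma lin_rep {τ} (hτ : τ ∈ X.F) (l : Module.Dual ℝ (Fin d → ℝ)) (x : Fin d → ℝ) :
    l x = ∑ i ∈ τ, X.b τ i x * l i := by
  conv_lhs => rw [← X.brep τ hτ x]
  simp

lemma qdiff {τ τ'} (hτ : τ ∈ X.F) (x : Fin d → ℝ) :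
    X.q τ x - X.q τ' x = ∑ i ∈ τ, X.b τ i x * (1 - X.q τ' i) := by
  rw [X.lin_rep hτ (X.q τ) x, X.lin_rep hτ (X.q τ') x, ← Finset.sum_sub_distrib]
  refine Finset.sum_congr rfl fun i hi => ?_
  rw [(X.qeq τ hτ i (X.sub τ hτ hi)).2 hi]; ring

/-- evaluation at `y` of the linear extension on the cone `τ` of the vertex function `h`. -/
def pl (h : (Fin d → ℝ) → ℝ) (τ : Finset (Fin d → ℝ)) : ℝ := ∑ i ∈ τ, X.b τ i X.y * h i

def DD (S : Finset (Fin d → ℝ)) (G : Finset (Fin d → ℝ) → ℝ) : ℝ :=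
  ∑ τ ∈ X.F with S ⊆ τ, G τ / (X.D τ * ∏ i ∈ τ \ S, X.b τ i X.y)

lemma pl_lin {τ} (hτ : τ ∈ X.F) (l : Module.Dual ℝ (Fin d → ℝ)) :
    X.pl (fun v => l v) τ = l X.y := (X.lin_rep hτ l X.y).symm

lemma pl_one {τ} (hτ : τ ∈ X.F) : X.pl (fun _ => 1) τ = X.q τ X.y := by
  rw [X.lin_rep hτ (X.q τ) X.y]
  refine Finset.sum_congr rfl fun i hi => ?_
  rw [(X.qeq τ hτ i (X.sub τ hτ hi)).2 hi]

lemma pl_sub (h h' : (Fin d → ℝ) → ℝ) (τ) :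
    X.pl (fun v => h v - h' v) τ = X.pl h τ - X.pl h' τ := by
  simp [pl, mul_sub]

lemma DD_congr {S G G'} (h : ∀ τ ∈ X.F, S ⊆ τ → G τ = G' τ) : X.DD S G = X.DD S G' := by
  refine Finset.sum_congr rfl fun τ hτ => ?_
  rw [Finset.mem_filter] at hτ
  rw [h τ hτ.1 hτ.2]

lemma DD_add (S G G') : X.DD S (fun τ => G τ + G' τ) = X.DD S G + X.DD S G' := by
  simp [DD, add_div, Finset.sum_add_distrib]

lemma DD_mul (S G) (a : ℝ) : X.DD S (fun τ => a * G τ) = a * X.DD S G := by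
  simp [DD, Finset.mul_sum, mul_div_assoc]

lemma DD_sum {ι : Type*} (s : Finset ι) (S) (G : ι → Finset (Fin d → ℝ) → ℝ) :
    X.DD S (fun τ => ∑ k ∈ s, G k τ) = ∑ k ∈ s, X.DD S (G k) := by
  simp only [DD, Finset.sum_div]
  rw [Finset.sum_comm]

lemma DD_empty {S} (G) (h : ¬ ∃ τ ∈ X.F, S ⊆ τ) : X.DD S G = 0 := by
  apply Finset.sum_eq_zero
  intro τ hτ
  rw [Finset.mem_filter] at hτ
  exact absurd ⟨τ, hτ.1, hτ.2⟩ h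

/-- recursion -/
lemma recur {S : Finset (Fin d → ℝ)} (h : (Fin d → ℝ) → ℝ) (hS : ∀ v ∈ S, h v = 0) (G) :
    X.DD S (fun τ => X.pl h τ * G τ) = ∑ v ∈ X.V \ S, h v * X.DD (insert v S) G := by
  have e1 : ∀ v ∈ X.V \ S, h v * X.DD (insert v S) G =
      ∑ τ ∈ X.F with S ⊆ τ, if v ∈ τ then
        h v * (G τ / (X.D τ * ∏ i ∈ τ \ insert v S, X.b τ i X.y)) else 0 := by
    intro v _
    rw [DD, Finset.mul_sum, ← Finset.sum_filter, Finset.filter_filter]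
    refine Finset.sum_congr ?_ fun _ _ => rfl
    ext τ; simp [Finset.insert_subset_iff, and_comm]
  rw [Finset.sum_congr rfl e1, Finset.sum_comm, DD]
  refine Finset.sum_congr rfl fun τ hτ => ?_
  rw [Finset.mem_filter] at hτ
  obtain ⟨hτ, hSτ⟩ := hτ
  have e2 : X.pl h τ = ∑ i ∈ τ \ S, X.b τ i X.y * h i := by
    rw [pl]
    symm
    apply Finset.sum_subset Finset.sdiff_subset
    intro i hi hi'
    have : i ∈ S := by
      by_contra hc; exact hi' (Finset.mem_sdiff.2 ⟨hi, hc⟩)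
    rw [hS i this, mul_zero]
  rw [e2, ← Finset.sum_filter]
  have e3 : (X.V \ S).filter (fun v => v ∈ τ) = τ \ S := by
    ext v
    simp only [Finset.mem_filter, Finset.mem_sdiff]
    constructor
    · rintro ⟨⟨_, h1⟩, h2⟩; exact ⟨h2, h1⟩
    · rintro ⟨h1, h2⟩; exact ⟨⟨X.sub τ hτ h1, h2⟩, h1⟩
  rw [e3, Finset.sum_mul, Finset.sum_div]
  refine Finset.sum_congr rfl fun i hi => ?_
  have hb : X.b τ i X.y ≠ 0 := X.gen τ hτ i (Finset.mem_sdiff.1 hi).1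
  have e4 : ∏ k ∈ τ \ S, X.b τ k X.y = X.b τ i X.y * ∏ k ∈ τ \ insert i S, X.b τ k X.y := by
    rw [← Finset.mul_prod_erase _ _ hi]
    congr 1
    refine Finset.prod_congr ?_ fun _ _ => rfl
    ext k; simp; tauto
  rw [e4]
  have hD := (X.Dpos τ hτ).ne'
  have hP : ∏ k ∈ τ \ insert i S, X.b τ k X.y ≠ 0 := by
    rw [Finset.prod_ne_zero_iff]
    intro k hk; exact X.gen τ hτ k (Finset.mem_sdiff.1 hk).1
  field_simp

lemma stepG {S : Finset (Fin d → ℝ)} (h : (Fin d → ℝ) → ℝ) (G)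
    (h1 : ∀ v ∈ X.V \ S, X.DD (insert v S) G = 0) (h2 : X.DD S G = 0) :
    X.DD S (fun τ => X.pl h τ * G τ) = 0 := by
  by_cases hex : ∃ τ ∈ X.F, S ⊆ τ
  · obtain ⟨τ0, hτ0, hS⟩ := hex
    let l : Module.Dual ℝ (Fin d → ℝ) := ∑ i ∈ S, h i • X.b τ0 i
    have hl : ∀ v ∈ S, h v - l v = 0 := by
      intro v hv
      have : l v = ∑ i ∈ S, if i = v then h i else 0 := by
        simp only [l, LinearMap.sum_apply, LinearMap.smul_apply, smul_eq_mul]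
        refine Finset.sum_congr rfl fun i hi => ?_
        rw [X.bdual τ0 hτ0 i (hS hi) v (hS hv)]; simp
      rw [this]; simp [hv]
    have := X.recur (fun v => h v - l v) hl G
    have hz : ∑ v ∈ X.V \ S, (h v - l v) * X.DD (insert v S) G = 0 :=
      Finset.sum_eq_zero fun v hv => by rw [h1 v hv, mul_zero]
    rw [hz] at this
    have e : X.DD S (fun τ => X.pl h τ * G τ) =
        X.DD S (fun τ => X.pl (fun v => h v - l v) τ * G τ + l X.y * G τ) := by
      refine X.DD_congr fun τ hτ _ => ?_
      rw [pl_sub, X.pl_lin hτ l]; ring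
    rw [e, DD_add, this, DD_mul, h2]; simp
  · exact X.DD_empty _ hex

lemma step0 {S : Finset (Fin d → ℝ)} (hc : S.card < d)
    (h1 : ∀ v ∈ X.V \ S, X.DD (insert v S) (fun _ => 1) = 0) : X.DD S (fun _ => 1) = 0 := by
  by_cases hex : ∃ τ ∈ X.F, S ⊆ τ
  · obtain ⟨τ0, hτ0, hS⟩ := hex
    obtain ⟨j, hj, hjS⟩ : ∃ j ∈ τ0, j ∉ S := by
      by_contra! hcon
      have := Finset.card_le_card (show τ0 ⊆ S from hcon)
      rw [X.card τ0 hτ0] at this; omega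
    have := X.recur (fun v => X.b τ0 j v) (S := S) (fun v hv => by
      rw [X.bdual τ0 hτ0 j hj v (hS hv), if_neg]; rintro rfl; exact hjS hv) (fun _ => 1)
    rw [Finset.sum_eq_zero fun v hv => by rw [h1 v hv, mul_zero]] at this
    rw [X.DD_congr (G' := fun τ => X.b τ0 j X.y * 1) (fun τ hτ _ => by
      rw [X.pl_lin hτ])] at this
    rw [X.DD_mul S (fun _ => 1)] at this
    exact (mul_eq_zero.1 this).resolve_left (X.gen τ0 hτ0 j hj)
  · exact X.DD_empty _ hex

/-- crossing a ridge -/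
lemma qlt {τ} (hτ : τ ∈ X.F) {v} (hv : v ∈ X.V) (h : v ∉ τ) : X.q τ v < 1 :=
  lt_of_le_of_ne (X.qle τ hτ v hv) (fun e => h ((X.qeq τ hτ v hv).1 e))

lemma eq_of_sub {τ τ'} (hτ : τ ∈ X.F) (hτ' : τ' ∈ X.F) (h : τ ⊆ τ') : τ = τ' :=
  Finset.eq_of_subset_of_card_le h (by rw [X.card τ hτ, X.card τ' hτ'])

lemma qdiff_ridge {τ τ' S j} (hτ : τ ∈ X.F) (hτ' : τ' ∈ X.F) (hj : j ∉ S)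
    (e : τ = insert j S) (hS : S ⊆ τ') (x : Fin d → ℝ) :
    X.q τ x - X.q τ' x = X.b τ j x * (1 - X.q τ' j) := by
  rw [X.qdiff hτ]
  subst e
  rw [Finset.sum_insert hj, Finset.sum_eq_zero, add_zero]
  intro i hi
  rw [(X.qeq τ' hτ' i (X.sub τ' hτ' (hS hi))).2 (hS hi)]; ring

lemma opp {S j j'} (hj : j ∉ S) (hj' : j' ∉ S) (hτ : insert j S ∈ X.F)
    (hτ' : insert j' S ∈ X.F) (hne : j ≠ j') : X.b (insert j' S) j' j < 0 := by
  have h := X.qdiff_ridge hτ' hτ hj' rfl (Finset.subset_insert _ _) j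
  have h1 : X.q (insert j S) j' < 1 := X.qlt hτ (X.sub _ hτ' (by simp)) (by
    simp [hj', hne.symm])
  have h2 : X.q (insert j' S) j < 1 := X.qlt hτ' (X.sub _ hτ (by simp)) (by
    simp [hj, hne])
  have h3 : X.q (insert j S) j = 1 := (X.qeq _ hτ j (X.sub _ hτ (by simp))).2 (by simp)
  nlinarith

lemma wrel {S j j'} (hj : j ∉ S) (hj' : j' ∉ S) (hτ : insert j S ∈ X.F)
    (hτ' : insert j' S ∈ X.F) (hne : j ≠ j') :
    X.D (insert j' S) * X.b (insert j' S) j' X.y =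
      - (X.D (insert j S) * X.b (insert j S) j X.y) := by
  rw [X.Drel S j j' hj hj' hτ hτ', abs_of_neg (X.opp hj hj' hτ hτ' hne)]
  have : X.b (insert j' S) j' X.y = X.b (insert j S) j X.y * X.b (insert j' S) j' j := by
    rw [X.lin_rep hτ (X.b (insert j' S) j') X.y, Finset.sum_insert hj, Finset.sum_eq_zero, add_zero]
    intro i hi
    rw [X.bdual _ hτ' j' (by simp) i (by simp [hi]), if_neg, mul_zero]
    rintro rfl; exact hj' hi
  rw [this]; ring

lemma exists_insert {S τ} (hS : S.card + 1 = d) (hτ : τ ∈ X.F) (h : S ⊆ τ) :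
    ∃ j, j ∉ S ∧ τ = insert j S := by
  have hc : (τ \ S).card = 1 := by
    rw [Finset.card_sdiff_of_subset h, X.card τ hτ]; omega
  obtain ⟨j, hj⟩ := Finset.card_eq_one.1 hc
  have hj1 : j ∈ τ \ S := by rw [hj]; simp
  refine ⟨j, (Finset.mem_sdiff.1 hj1).2, ?_⟩
  rw [← Finset.sdiff_union_of_subset h, hj]; rfl

lemma ridge {S j} (hS : S.card + 1 = d) (hj : j ∉ S) (hτ : insert j S ∈ X.F) :
    ∃ j', j' ∉ S ∧ j' ≠ j ∧ insert j' S ∈ X.F ∧ ∀ G, X.DD S G =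
      (G (insert j S) - G (insert j' S)) / (X.D (insert j S) * X.b (insert j S) j X.y) := by
  obtain ⟨τ', hτ', hne, hsub⟩ := X.adj _ hτ j (by simp)
  rw [Finset.erase_insert hj] at hsub
  obtain ⟨j', hj', rfl⟩ := X.exists_insert hS hτ' hsub
  have hjj : j ≠ j' := by rintro rfl; exact hne rfl
  refine ⟨j', hj', hjj.symm, hτ', fun G => ?_⟩
  have hf : X.F.filter (fun τ => S ⊆ τ) = {insert j S, insert j' S} := by
    ext τ
    simp only [Finset.mem_filter, Finset.mem_insert, Finset.mem_singleton]
    constructor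
    · rintro ⟨h, hs⟩
      obtain ⟨k, hk, rfl⟩ := X.exists_insert hS h hs
      by_contra! hcon
      have hkj : k ≠ j := by rintro rfl; exact hcon.1 rfl
      have hkj' : k ≠ j' := by rintro rfl; exact hcon.2 rfl
      have a1 := X.opp hk hj h hτ hkj
      have a2 := X.opp hj hj' hτ hτ' hjj
      have a3 := X.opp hk hj' h hτ' hkj'
      have : X.b (insert j' S) j' k = X.b (insert j S) j k * X.b (insert j' S) j' j := by
        rw [X.lin_rep hτ (X.b (insert j' S) j') k, Finset.sum_insert hj, Finset.sum_eq_zero,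
          add_zero]
        intro i hi
        rw [X.bdual _ hτ' j' (by simp) i (by simp [hi]), if_neg, mul_zero]
        rintro rfl; exact hj' hi
      nlinarith
    · rintro (rfl | rfl)
      · exact ⟨hτ, Finset.subset_insert _ _⟩
      · exact ⟨hτ', Finset.subset_insert _ _⟩
  rw [DD, hf, Finset.sum_pair hne.symm]
  have s1 : ∀ k, k ∉ S → insert k S \ S = {k} := by
    intro k hk; ext i; simp only [Finset.mem_sdiff, Finset.mem_insert, Finset.mem_singleton]
    exact ⟨fun h => h.1.resolve_right h.2, fun h => ⟨Or.inl h, h ▸ hk⟩⟩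
  rw [s1 j hj, s1 j' hj', Finset.prod_singleton, Finset.prod_singleton,
    X.wrel hj hj' hτ hτ' hjj, div_neg]
  ring

lemma A1 {S} (hS : S.card + 1 = d) : X.DD S (fun _ => 1) = 0 := by
  by_cases hex : ∃ τ ∈ X.F, S ⊆ τ
  · obtain ⟨τ0, hτ0, h⟩ := hex
    obtain ⟨j, hj, rfl⟩ := X.exists_insert hS hτ0 h
    obtain ⟨j', _, _, _, h⟩ := X.ridge hS hj hτ0
    rw [h]; simp
  · exact X.DD_empty _ hex

lemma A1' {S} (hS : S.card + 1 = d) (hex : ∃ τ ∈ X.F, S ⊆ τ) :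
    0 < X.DD S (X.pl fun _ => 1) := by
  obtain ⟨τ0, hτ0, h⟩ := hex
  obtain ⟨j, hj, rfl⟩ := X.exists_insert hS hτ0 h
  obtain ⟨j', hj', hne, hτ', h⟩ := X.ridge hS hj hτ0
  rw [h, X.pl_one hτ0, X.pl_one hτ', X.qdiff_ridge hτ0 hτ' hj rfl (Finset.subset_insert _ _)]
  have h1 : X.q (insert j' S) j < 1 := X.qlt hτ' (X.sub _ hτ0 (by simp)) (by
    simp [hj, hne.symm])
  have hb := X.gen _ hτ0 j (by simp)
  have hD := X.Dpos _ hτ0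
  rw [mul_comm (X.D _), mul_div_mul_left _ _ hb]
  exact div_pos (by linarith) hD

lemma A20 {S} (hS : S.card + 2 = d) : X.DD S (fun _ => 1) = 0 :=
  X.step0 (by omega) fun v hv => X.A1 (by
    rw [Finset.card_insert_of_notMem (Finset.mem_sdiff.1 hv).2]; omega)

lemma A21 {S} (hS : S.card + 2 = d) (h) : X.DD S (X.pl h) = 0 := by
  have := X.stepG (S := S) h (fun _ => 1) (fun v hv => X.A1 (by
    rw [Finset.card_insert_of_notMem (Finset.mem_sdiff.1 hv).2]; omega)) (X.A20 hS)
  simpa using this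

lemma A30 {S} (hS : S.card + 3 = d) : X.DD S (fun _ => 1) = 0 :=
  X.step0 (by omega) fun v hv => X.A20 (by
    rw [Finset.card_insert_of_notMem (Finset.mem_sdiff.1 hv).2]; omega)

lemma A31 {S} (hS : S.card + 3 = d) (h) : X.DD S (X.pl h) = 0 := by
  have := X.stepG (S := S) h (fun _ => 1) (fun v hv => X.A20 (by
    rw [Finset.card_insert_of_notMem (Finset.mem_sdiff.1 hv).2]; omega)) (X.A30 hS)
  simpa using this

lemma A32 {S} (hS : S.card + 3 = d) (h h') : X.DD S (fun τ => X.pl h τ * X.pl h' τ) = 0 :=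
  X.stepG (S := S) h (X.pl h') (fun v hv => X.A21 (by
    rw [Finset.card_insert_of_notMem (Finset.mem_sdiff.1 hv).2]; omega) h') (X.A31 hS h')


lemma O2 {S} (hS : S.card + 2 = d) (hex : ∃ τ ∈ X.F, S ⊆ τ) :
    0 < X.DD S (fun τ => X.pl (fun _ => 1) τ * X.pl (fun _ => 1) τ) := by
  obtain ⟨τ0, hτ0, h0⟩ := hex
  have hr := X.recur (S := S) (fun v => 1 - X.q τ0 v) (fun v hv => by
    rw [(X.qeq τ0 hτ0 v (X.sub _ hτ0 (h0 hv))).2 (h0 hv)]; ring) (X.pl fun _ => 1)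
  have e : X.DD S (fun τ => X.pl (fun _ => 1) τ * X.pl (fun _ => 1) τ) =
      X.DD S (fun τ => X.pl (fun v => 1 - X.q τ0 v) τ * X.pl (fun _ => 1) τ
        + X.q τ0 X.y * X.pl (fun _ => 1) τ) := by
    refine X.DD_congr fun τ hτ _ => ?_
    rw [X.pl_sub (fun _ => 1) (fun v => X.q τ0 v), X.pl_lin hτ]; ring
  rw [e, DD_add, DD_mul, X.A21 hS, hr, mul_zero, add_zero]
  have hge : ∀ v ∈ X.V \ S, 0 ≤ X.DD (insert v S) (X.pl fun _ => 1) := by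
    intro v hv
    by_cases hex : ∃ τ ∈ X.F, insert v S ⊆ τ
    · exact (X.A1' (by
        rw [Finset.card_insert_of_notMem (Finset.mem_sdiff.1 hv).2]; omega) hex).le
    · rw [X.DD_empty _ hex]
  obtain ⟨j, hj, hjS⟩ : ∃ j ∈ τ0, j ∉ S := by
    by_contra! hcon
    have := Finset.card_le_card (show τ0 ⊆ S from hcon)
    rw [X.card τ0 hτ0] at this; omega
  obtain ⟨τ', hτ', hne, hsub⟩ := X.adj τ0 hτ0 j hj
  obtain ⟨v, hv, hv0⟩ : ∃ v ∈ τ', v ∉ τ0 := by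
    by_contra! hcon
    exact hne (X.eq_of_sub hτ' hτ0 hcon)
  have hSτ' : S ⊆ τ' := fun i hi => hsub (Finset.mem_erase.2 ⟨fun h => hjS (h ▸ hi), h0 hi⟩)
  have hvS : v ∉ S := fun h => hv0 (h0 h)
  refine Finset.sum_pos' (fun w hw => mul_nonneg ?_ (hge w hw)) ⟨v, ?_, mul_pos ?_ ?_⟩
  · have := X.qle τ0 hτ0 w (Finset.mem_sdiff.1 hw).1
    linarith
  · exact Finset.mem_sdiff.2 ⟨X.sub _ hτ' hv, hvS⟩
  · have := X.qlt hτ0 (X.sub _ hτ' hv) hv0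
    linarith
  · exact X.A1' (by rw [Finset.card_insert_of_notMem hvS]; omega)
      ⟨τ', hτ', Finset.insert_subset hv hSτ'⟩

lemma qdiff_S {τ τ' S} (hτ : τ ∈ X.F) (hτ' : τ' ∈ X.F) (hS : S ⊆ τ) (hS' : S ⊆ τ')
    (x : Fin d → ℝ) :
    X.q τ x - X.q τ' x = ∑ i ∈ τ \ S, X.b τ i x * (1 - X.q τ' i) := by
  rw [X.qdiff hτ]
  symm
  apply Finset.sum_subset Finset.sdiff_subset
  intro i hi hi'
  have : i ∈ S := by
    by_contra hc; exact hi' (Finset.mem_sdiff.2 ⟨hi, hc⟩)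
  rw [(X.qeq τ' hτ' i (X.sub τ' hτ' (hS' this))).2 (hS' this)]; ring

/-- the cone over `τ` modulo `S` containing `ε y` -/
lemma cone_le {τ τ' S} (ε : ℝ) (hτ : τ ∈ X.F) (hτ' : τ' ∈ X.F) (hS : S ⊆ τ) (hS' : S ⊆ τ')
    (hp : ∀ i ∈ τ \ S, 0 < ε * X.b τ i X.y) (hne : τ ≠ τ') :
    0 < ε * (X.q τ X.y - X.q τ' X.y) := by
  rw [X.qdiff_S hτ hτ' hS hS', Finset.mul_sum]
  obtain ⟨v, hv, hv0⟩ : ∃ v ∈ τ, v ∉ τ' := by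
    by_contra! hcon
    exact hne (X.eq_of_sub hτ hτ' hcon)
  refine Finset.sum_pos' (fun w hw => ?_) ⟨v, ?_, ?_⟩
  · have := X.qle τ' hτ' w (X.sub _ hτ (Finset.mem_sdiff.1 hw).1)
    rw [← mul_assoc]
    exact mul_nonneg (hp w hw).le (by linarith)
  · exact Finset.mem_sdiff.2 ⟨hv, fun h => hv0 (hS' h)⟩
  · have := X.qlt hτ' (X.sub _ hτ hv) hv0
    rw [← mul_assoc]
    exact mul_pos (hp v (Finset.mem_sdiff.2 ⟨hv, fun h => hv0 (hS' h)⟩)) (by linarith)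

lemma cone_unique {τ τ' S} (ε : ℝ) (hτ : τ ∈ X.F) (hτ' : τ' ∈ X.F) (hS : S ⊆ τ) (hS' : S ⊆ τ')
    (hp : ∀ i ∈ τ \ S, 0 < ε * X.b τ i X.y) (hp' : ∀ i ∈ τ' \ S, 0 < ε * X.b τ' i X.y) :
    τ = τ' := by
  by_contra hne
  have h1 := X.cone_le ε hτ hτ' hS hS' hp hne
  have h2 := X.cone_le ε hτ' hτ hS' hS hp' (Ne.symm hne)
  linarith

lemma pos_cases {τ S} (hS : S.card + 2 = d) (hτ : τ ∈ X.F) (hSτ : S ⊆ τ)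
    (hp : 0 < ∏ i ∈ τ \ S, X.b τ i X.y) :
    (∀ i ∈ τ \ S, 0 < (1 : ℝ) * X.b τ i X.y) ∨ (∀ i ∈ τ \ S, 0 < (-1 : ℝ) * X.b τ i X.y) := by
  have hc : (τ \ S).card = 2 := by
    rw [Finset.card_sdiff_of_subset hSτ, X.card τ hτ]; omega
  obtain ⟨i, j, hij, e⟩ := Finset.card_eq_two.1 hc
  rw [e] at hp ⊢
  rw [Finset.prod_pair hij] at hp
  rcases mul_pos_iff.1 hp with h | h
  · left; simp; exact h
  · right; simp; exact h

lemma sdiff_ne {τ S} (hS : S.card + 2 = d) (hτ : τ ∈ X.F) (hSτ : S ⊆ τ) :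
    ∃ i, i ∈ τ \ S := by
  have hc : (τ \ S).card = 2 := by
    rw [Finset.card_sdiff_of_subset hSτ, X.card τ hτ]; omega
  exact Finset.card_pos.1 (by omega)

lemma choose_sa {S} (hS : S.card + 2 = d) (f : (Fin d → ℝ) → ℝ) :
    ∃ s a : ℝ, ∀ τ ∈ X.F, S ⊆ τ → 0 < ∏ i ∈ τ \ S, X.b τ i X.y →
      X.pl f τ + s * X.pl (fun _ => 1) τ - a = 0 := by
  by_cases hP : ∃ τ ∈ X.F, S ⊆ τ ∧ ∀ i ∈ τ \ S, 0 < (1 : ℝ) * X.b τ i X.y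
  · obtain ⟨τ₁, h1, h1S, h1p⟩ := hP
    by_cases hN : ∃ τ ∈ X.F, S ⊆ τ ∧ ∀ i ∈ τ \ S, 0 < (-1 : ℝ) * X.b τ i X.y
    · obtain ⟨τ₂, h2, h2S, h2p⟩ := hN
      have hne : τ₁ ≠ τ₂ := by
        rintro rfl
        obtain ⟨i, hi⟩ := X.sdiff_ne hS h1 h1S
        have := h1p i hi; have := h2p i hi; linarith
      have hlt := X.cone_le 1 h1 h2 h1S h2S h1p hne
      rw [one_mul] at hlt
      set s := -(X.pl f τ₁ - X.pl f τ₂) / (X.q τ₁ X.y - X.q τ₂ X.y) with hs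
      have hs' : s * (X.q τ₁ X.y - X.q τ₂ X.y) = -(X.pl f τ₁ - X.pl f τ₂) := by
        rw [hs]; field_simp
      refine ⟨s, X.pl f τ₁ + s * X.q τ₁ X.y, fun τ hτ hSτ hp => ?_⟩
      rw [X.pl_one hτ]
      rcases X.pos_cases hS hτ hSτ hp with h | h
      · rw [X.cone_unique 1 hτ h1 hSτ h1S h h1p]; ring
      · rw [X.cone_unique (-1) hτ h2 hSτ h2S h h2p]; linarith
    · refine ⟨0, X.pl f τ₁, fun τ hτ hSτ hp => ?_⟩
      rcases X.pos_cases hS hτ hSτ hp with h | h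
      · rw [X.cone_unique 1 hτ h1 hSτ h1S h h1p]; ring
      · exact absurd ⟨τ, hτ, hSτ, h⟩ hN
  · by_cases hN : ∃ τ ∈ X.F, S ⊆ τ ∧ ∀ i ∈ τ \ S, 0 < (-1 : ℝ) * X.b τ i X.y
    · obtain ⟨τ₂, h2, h2S, h2p⟩ := hN
      refine ⟨0, X.pl f τ₂, fun τ hτ hSτ hp => ?_⟩
      rcases X.pos_cases hS hτ hSτ hp with h | h
      · exact absurd ⟨τ, hτ, hSτ, h⟩ hP
      · rw [X.cone_unique (-1) hτ h2 hSτ h2S h h2p]; ring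
    · refine ⟨0, 0, fun τ hτ hSτ hp => ?_⟩
      rcases X.pos_cases hS hτ hSτ hp with h | h
      · exact absurd ⟨τ, hτ, hSτ, h⟩ hP
      · exact absurd ⟨τ, hτ, hSτ, h⟩ hN

lemma neg {S} (hS : S.card + 2 = d) (f : (Fin d → ℝ) → ℝ)
    (h0 : X.DD S (fun τ => X.pl f τ * X.pl (fun _ => 1) τ) = 0) :
    X.DD S (fun τ => X.pl f τ * X.pl f τ) ≤ 0 ∧
    (X.DD S (fun τ => X.pl f τ * X.pl f τ) = 0 → ∀ τ ∈ X.F, ∀ τ' ∈ X.F, S ⊆ τ → S ⊆ τ' →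
      X.pl f τ = X.pl f τ') := by
  by_cases hex : ∃ τ ∈ X.F, S ⊆ τ
  swap
  · refine ⟨(X.DD_empty _ hex).le, fun _ τ hτ _ _ h => absurd ⟨τ, hτ, h⟩ hex⟩
  obtain ⟨s, a, hsa⟩ := X.choose_sa hS f
  set g : Finset (Fin d → ℝ) → ℝ := fun τ => X.pl f τ + s * X.pl (fun _ => 1) τ - a with hg
  have hO := X.O2 hS hex
  set O := X.DD S (fun τ => X.pl (fun _ => 1) τ * X.pl (fun _ => 1) τ) with hOdef
  have e : X.DD S (fun τ => g τ * g τ) = X.DD S (fun τ => X.pl f τ * X.pl f τ) + s ^ 2 * O := by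
    have : X.DD S (fun τ => g τ * g τ) = X.DD S (fun τ => X.pl f τ * X.pl f τ
        + (s ^ 2 * (X.pl (fun _ => 1) τ * X.pl (fun _ => 1) τ)
        + ((2 * s) * (X.pl f τ * X.pl (fun _ => 1) τ)
        + ((-2 * a) * X.pl f τ + ((-2 * a * s) * X.pl (fun _ => 1) τ + a ^ 2 * 1))))) := by
      refine X.DD_congr fun τ _ _ => ?_
      simp only [hg]; ring
    rw [this, DD_add, DD_add, DD_add, DD_add, DD_add, DD_mul, DD_mul, DD_mul, DD_mul,
      X.DD_mul S (fun _ => 1), h0, X.A21 hS, X.A21 hS, X.A20 hS]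
    ring
  have hterm : ∀ τ ∈ X.F.filter (fun τ => S ⊆ τ),
      g τ * g τ / (X.D τ * ∏ i ∈ τ \ S, X.b τ i X.y) ≤ 0 := by
    intro τ hτ
    rw [Finset.mem_filter] at hτ
    by_cases hp : 0 < ∏ i ∈ τ \ S, X.b τ i X.y
    · have : g τ = 0 := hsa τ hτ.1 hτ.2 hp
      rw [this]; simp
    · apply div_nonpos_of_nonneg_of_nonpos (mul_self_nonneg _)
      exact mul_nonpos_of_nonneg_of_nonpos (X.Dpos τ hτ.1).le (not_lt.1 hp)
  have hle : X.DD S (fun τ => g τ * g τ) ≤ 0 := Finset.sum_nonpos hterm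
  have hs2 : 0 ≤ s ^ 2 * O := mul_nonneg (sq_nonneg s) hO.le
  refine ⟨by linarith, fun hz => ?_⟩
  have hz1 : X.DD S (fun τ => g τ * g τ) = 0 := by linarith
  have hz2 : s ^ 2 * O = 0 := by linarith
  have hs0 : s = 0 := by
    rcases mul_eq_zero.1 hz2 with h | h
    · exact pow_eq_zero_iff (two_ne_zero) |>.1 h
    · exact absurd h hO.ne'
  have hall := (Finset.sum_eq_zero_iff_of_nonpos hterm).1 hz1
  have key : ∀ τ ∈ X.F, S ⊆ τ → X.pl f τ = a := by
    intro τ hτ hSτ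
    have := hall τ (Finset.mem_filter.2 ⟨hτ, hSτ⟩)
    have hP : ∏ k ∈ τ \ S, X.b τ k X.y ≠ 0 := by
      rw [Finset.prod_ne_zero_iff]
      intro k hk; exact X.gen τ hτ k (Finset.mem_sdiff.1 hk).1
    have hD := (X.Dpos τ hτ).ne'
    have hg0 : g τ = 0 := by
      rcases div_eq_zero_iff.1 this with h | h
      · exact mul_self_eq_zero.1 h
      · exact absurd h (mul_ne_zero hD hP)
    simp only [hg, hs0] at hg0
    linarith
  intro τ hτ τ' hτ' h h'
  rw [key τ hτ h, key τ' hτ' h']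

lemma propagate {α : Type*} (Φ : Finset (Fin d → ℝ) → α)
    (h : ∀ τ ∈ X.F, ∀ τ' ∈ X.F, ∀ j ∈ τ, τ' ≠ τ → τ.erase j ⊆ τ' → Φ τ = Φ τ') :
    ∀ τ ∈ X.F, ∀ τ' ∈ X.F, Φ τ = Φ τ' := by
  by_cases hne : X.F.Nonempty
  swap
  · intro τ hτ; exact absurd ⟨τ, hτ⟩ hne
  obtain ⟨τs, hs, hmax⟩ := Finset.exists_max_image X.F (fun τ => X.q τ X.y) hne
  have main : ∀ τ ∈ X.F, Φ τ = Φ τs := by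
    by_contra! hcon
    obtain ⟨τb, hb, hbad⟩ := hcon
    obtain ⟨τ, hτ, hm⟩ := Finset.exists_max_image (X.F.filter fun τ => Φ τ ≠ Φ τs)
      (fun τ => X.q τ X.y) ⟨τb, Finset.mem_filter.2 ⟨hb, hbad⟩⟩
    rw [Finset.mem_filter] at hτ
    by_cases hpos : ∀ i ∈ τ \ ∅, 0 < (1 : ℝ) * X.b τ i X.y
    · have hne : τ ≠ τs := by rintro rfl; exact hτ.2 rfl
      have := X.cone_le 1 hτ.1 hs (by simp) (by simp) hpos hne
      have := hmax τ hτ.1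
      linarith
    · push Not at hpos
      obtain ⟨j, hj, hjn⟩ := hpos
      rw [Finset.sdiff_empty] at hj
      rw [one_mul] at hjn
      have hjn : X.b τ j X.y < 0 := lt_of_le_of_ne hjn (X.gen τ hτ.1 j hj)
      obtain ⟨τ', hτ', hne', hsub⟩ := X.adj τ hτ.1 j hj
      have hq := X.qdiff_ridge hτ.1 hτ' (Finset.notMem_erase j τ) (Finset.insert_erase hj).symm hsub X.y
      have hjτ' : j ∉ τ' := by
        intro hc
        apply hne'
        refine (X.eq_of_sub hτ.1 hτ' ?_).symm
        rw [← Finset.insert_erase hj]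
        exact Finset.insert_subset hc hsub
      have h1 := X.qlt hτ' (X.sub _ hτ.1 hj) hjτ'
      have h2 : X.b τ j X.y * (1 - X.q τ' j) < 0 := mul_neg_of_neg_of_pos hjn (by linarith)
      have h3 : Φ τ' = Φ τs := by
        by_contra hc
        have := hm τ' (Finset.mem_filter.2 ⟨hτ', hc⟩)
        linarith
      exact hτ.2 ((h τ hτ.1 τ' hτ' j hj hne' hsub).trans h3)
  intro τ hτ τ' hτ'
  rw [main τ hτ, main τ' hτ']

lemma notMem_adj {τ τ' j} (hτ : τ ∈ X.F) (hτ' : τ' ∈ X.F) (hj : j ∈ τ) (hne : τ' ≠ τ)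
    (hsub : τ.erase j ⊆ τ') : j ∉ τ' := by
  intro hc
  apply hne
  refine (X.eq_of_sub hτ hτ' ?_).symm
  rw [← Finset.insert_erase hj]
  exact Finset.insert_subset hc hsub

/-- infinitesimal motions, in terms of `f v = ⟨v, c v⟩` -/
lemma key (hd : 3 ≤ d) (f : (Fin d → ℝ) → ℝ) (c : (Fin d → ℝ) → (Fin d → ℝ))
    (hc : ∀ τ ∈ X.F, ∀ v ∈ τ, ∀ w ∈ τ, v ⬝ᵥ c w + w ⬝ᵥ c v = f v + f w) :
    ∀ τ ∈ X.F, ∀ τ' ∈ X.F, ∀ j ∈ τ, τ' ≠ τ → τ.erase j ⊆ τ' → X.pl f τ = X.pl f τ' := by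
  have hprod : ∀ τ ∈ X.F, X.pl (fun _ => 1) τ * X.pl f τ =
      ∑ k, X.y k * X.pl (fun v => c v k) τ := by
    intro τ hτ
    have hy : ∀ k, X.y k = ∑ i ∈ τ, X.b τ i X.y * i k := by
      intro k
      conv_lhs => rw [← X.brep τ hτ X.y]
      simp
    have e1 : ∑ k, X.y k * X.pl (fun v => c v k) τ =
        ∑ i ∈ τ, ∑ j ∈ τ, X.b τ i X.y * X.b τ j X.y * (i ⬝ᵥ c j) := by
      calc _ = ∑ k, ∑ i ∈ τ, ∑ j ∈ τ, X.b τ i X.y * X.b τ j X.y * (i k * c j k) := by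
            refine Finset.sum_congr rfl fun k _ => ?_
            rw [hy k, pl, Finset.sum_mul_sum]
            refine Finset.sum_congr rfl fun i _ => Finset.sum_congr rfl fun j _ => ?_
            ring
        _ = _ := by
            rw [Finset.sum_comm]
            refine Finset.sum_congr rfl fun i _ => ?_
            rw [Finset.sum_comm]
            refine Finset.sum_congr rfl fun j _ => ?_
            rw [dotProduct, Finset.mul_sum]
    have e2 : ∑ i ∈ τ, ∑ j ∈ τ, X.b τ i X.y * X.b τ j X.y * (i ⬝ᵥ c j) =
        ∑ i ∈ τ, ∑ j ∈ τ, X.b τ i X.y * X.b τ j X.y * (j ⬝ᵥ c i) := by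
      rw [Finset.sum_comm]
      refine Finset.sum_congr rfl fun i _ => Finset.sum_congr rfl fun j _ => ?_
      ring
    have e3 : X.pl (fun _ => 1) τ * X.pl f τ =
        ∑ i ∈ τ, ∑ j ∈ τ, X.b τ i X.y * X.b τ j X.y * f j := by
      rw [pl, pl, Finset.sum_mul_sum]
      refine Finset.sum_congr rfl fun i _ => Finset.sum_congr rfl fun j _ => ?_
      ring
    have e4 : ∑ i ∈ τ, ∑ j ∈ τ, X.b τ i X.y * X.b τ j X.y * f j =
        ∑ i ∈ τ, ∑ j ∈ τ, X.b τ i X.y * X.b τ j X.y * f i := by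
      rw [Finset.sum_comm]
      refine Finset.sum_congr rfl fun i _ => Finset.sum_congr rfl fun j _ => ?_
      ring
    have e5 : (∑ i ∈ τ, ∑ j ∈ τ, X.b τ i X.y * X.b τ j X.y * (i ⬝ᵥ c j)) +
        ∑ i ∈ τ, ∑ j ∈ τ, X.b τ i X.y * X.b τ j X.y * (j ⬝ᵥ c i) =
        (∑ i ∈ τ, ∑ j ∈ τ, X.b τ i X.y * X.b τ j X.y * f i) +
        ∑ i ∈ τ, ∑ j ∈ τ, X.b τ i X.y * X.b τ j X.y * f j := by
      simp only [← Finset.sum_add_distrib]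
      refine Finset.sum_congr rfl fun i hi => Finset.sum_congr rfl fun j hj => ?_
      rw [← mul_add, ← mul_add, hc τ hτ i hi j hj]
    linarith
  have M1 : ∀ S : Finset (Fin d → ℝ), S.card + 2 = d →
      X.DD S (fun τ => X.pl f τ * X.pl (fun _ => 1) τ) = 0 := by
    intro S hS
    rw [X.DD_congr (G' := fun τ => ∑ k, X.y k * X.pl (fun v => c v k) τ)
      (fun τ hτ _ => by rw [← hprod τ hτ]; ring), DD_sum]
    refine Finset.sum_eq_zero fun k _ => ?_
    rw [DD_mul, X.A21 hS, mul_zero]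
  have M2 : ∀ S : Finset (Fin d → ℝ), S.card + 3 = d → ∀ τ0 ∈ X.F, S ⊆ τ0 →
      ∑ v ∈ X.V \ S, (1 - X.q τ0 v) * X.DD (insert v S) (fun τ => X.pl f τ * X.pl f τ) = 0 := by
    intro S hS τ0 hτ0 h0
    rw [← X.recur (S := S) (fun v => 1 - X.q τ0 v) (fun v hv => by
      rw [(X.qeq τ0 hτ0 v (X.sub _ hτ0 (h0 hv))).2 (h0 hv)]; ring)]
    rw [X.DD_congr (G' := fun τ => (∑ k, X.y k * (X.pl (fun v => c v k) τ * X.pl f τ)) +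
        (- X.q τ0 X.y) * (X.pl f τ * X.pl f τ))
      (fun τ hτ _ => by
        rw [X.pl_sub (fun _ => 1) (fun v => X.q τ0 v), X.pl_lin hτ]
        have : ∑ k, X.y k * (X.pl (fun v => c v k) τ * X.pl f τ) =
            (∑ k, X.y k * X.pl (fun v => c v k) τ) * X.pl f τ := by
          rw [Finset.sum_mul]
          exact Finset.sum_congr rfl fun k _ => by ring
        rw [this, ← hprod τ hτ]; ring), DD_add, DD_mul, X.A32 hS, DD_sum]
    rw [Finset.sum_eq_zero fun k _ => ?_, mul_zero, add_zero]
    rw [DD_mul, X.A32 hS, mul_zero]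
  intro τ hτ τ' hτ' j hj hne hsub
  have hcard : (τ.erase j).card + 1 = d := by
    rw [Finset.card_erase_of_mem hj, X.card τ hτ]; omega
  obtain ⟨i, hi⟩ : (τ.erase j).Nonempty := Finset.card_pos.1 (by omega)
  obtain ⟨v, hv⟩ : ((τ.erase j).erase i).Nonempty := Finset.card_pos.1 (by
    rw [Finset.card_erase_of_mem hi]; omega)
  set ρ := (τ.erase j).erase i with hρ
  have hρc : ρ.card + 2 = d := by rw [hρ, Finset.card_erase_of_mem hi]; omega
  have hρτ : ρ ⊆ τ := (Finset.erase_subset _ _).trans (Finset.erase_subset _ _)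
  have hρτ' : ρ ⊆ τ' := (Finset.erase_subset _ _).trans hsub
  have hσc : (ρ.erase v).card + 3 = d := by rw [Finset.card_erase_of_mem hv]; omega
  obtain ⟨τ0, h0, hne0, hsub0⟩ := X.adj τ hτ v (hρτ hv)
  have hv0 := X.notMem_adj hτ h0 (hρτ hv) hne0 hsub0
  have hσ0 : ρ.erase v ⊆ τ0 := (Finset.erase_subset_erase v hρτ).trans hsub0
  have hsum := M2 (ρ.erase v) hσc τ0 h0 hσ0
  have hterm : ∀ w ∈ X.V \ ρ.erase v, (1 - X.q τ0 w) *
      X.DD (insert w (ρ.erase v)) (fun τ => X.pl f τ * X.pl f τ) ≤ 0 := by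
    intro w hw
    have hcw : (insert w (ρ.erase v)).card + 2 = d := by
      rw [Finset.card_insert_of_notMem (Finset.mem_sdiff.1 hw).2]; omega
    have := X.qle τ0 h0 w (Finset.mem_sdiff.1 hw).1
    exact mul_nonpos_of_nonneg_of_nonpos (by linarith) (X.neg hcw f (M1 _ hcw)).1
  have hvV : v ∈ X.V := X.sub τ hτ (hρτ hv)
  have hz := (Finset.sum_eq_zero_iff_of_nonpos hterm).1 hsum v
    (Finset.mem_sdiff.2 ⟨hvV, Finset.notMem_erase _ _⟩)
  rw [Finset.insert_erase hv] at hz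
  have hlt := X.qlt h0 hvV hv0
  have hz' := (mul_eq_zero.1 hz).resolve_left (by linarith)
  exact (X.neg hρc f (M1 _ hρc)).2 hz' τ hτ τ' hτ' hρτ hρτ'


lemma dual_ext {τ} (hτ : τ ∈ X.F) (l : Module.Dual ℝ (Fin d → ℝ)) (h : ∀ i ∈ τ, l i = 0) :
    l = 0 := by
  apply LinearMap.ext; intro x
  rw [X.lin_rep hτ l x]
  exact Finset.sum_eq_zero fun i hi => by rw [h i hi, mul_zero]

def ext (f : (Fin d → ℝ) → ℝ) (τ : Finset (Fin d → ℝ)) : Module.Dual ℝ (Fin d → ℝ) :=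
  ∑ i ∈ τ, f i • X.b τ i

lemma ext_y (f τ) : X.ext f τ X.y = X.pl f τ := by
  simp [ext, pl, mul_comm]

lemma ext_mem (f) {τ} (hτ : τ ∈ X.F) {v} (hv : v ∈ τ) : X.ext f τ v = f v := by
  have : X.ext f τ v = ∑ i ∈ τ, if i = v then f i else 0 := by
    simp only [ext, LinearMap.sum_apply, LinearMap.smul_apply, smul_eq_mul]
    refine Finset.sum_congr rfl fun i hi => ?_
    rw [X.bdual τ hτ i hi v hv]; simp
  rw [this]; simp [hv]

def extV (c : (Fin d → ℝ) → (Fin d → ℝ)) (τ : Finset (Fin d → ℝ)) :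
    (Fin d → ℝ) →ₗ[ℝ] (Fin d → ℝ) :=
  ∑ i ∈ τ, (X.b τ i).smulRight (c i)

lemma extV_apply (c τ x) : X.extV c τ x = ∑ i ∈ τ, X.b τ i x • c i := by
  simp [extV]

lemma extV_mem (c) {τ} (hτ : τ ∈ X.F) {v} (hv : v ∈ τ) : X.extV c τ v = c v := by
  rw [extV_apply]
  have : ∀ i ∈ τ, X.b τ i v • c i = if i = v then c i else 0 := by
    intro i hi
    rw [X.bdual τ hτ i hi v hv]; split_ifs <;> simp
  rw [Finset.sum_congr rfl this]; simp [hv]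

lemma ext_const (hd : 3 ≤ d) (f : (Fin d → ℝ) → ℝ) (c : (Fin d → ℝ) → (Fin d → ℝ))
    (hc : ∀ τ ∈ X.F, ∀ v ∈ τ, ∀ w ∈ τ, v ⬝ᵥ c w + w ⬝ᵥ c v = f v + f w) :
    ∀ τ ∈ X.F, ∀ τ' ∈ X.F, X.ext f τ = X.ext f τ' := by
  apply X.propagate
  intro τ hτ τ' hτ' j hj hne hsub
  have hk := X.key hd f c hc τ hτ τ' hτ' j hj hne hsub
  rw [← sub_eq_zero]
  have hz : ∀ i ∈ τ.erase j, (X.ext f τ - X.ext f τ') i = 0 := by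
    intro i hi
    rw [LinearMap.sub_apply, X.ext_mem f hτ (Finset.mem_of_mem_erase hi),
      X.ext_mem f hτ' (hsub hi), sub_self]
  have hy : (X.ext f τ - X.ext f τ') X.y = 0 := by
    rw [LinearMap.sub_apply, ext_y, ext_y, hk, sub_self]
  rw [X.lin_rep hτ, ← Finset.add_sum_erase _ _ hj,
    Finset.sum_eq_zero fun i hi => by rw [hz i hi, mul_zero], add_zero] at hy
  have hzj := (mul_eq_zero.1 hy).resolve_left (X.gen τ hτ j hj)
  apply X.dual_ext hτ
  intro i hi
  by_cases h : i = j
  · rw [h]; exact hzj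
  · exact hz i (Finset.mem_erase.2 ⟨h, hi⟩)

lemma extV_const (c : (Fin d → ℝ) → (Fin d → ℝ))
    (hc : ∀ τ ∈ X.F, ∀ v ∈ τ, ∀ w ∈ τ, v ⬝ᵥ c w + w ⬝ᵥ c v = 0) :
    ∀ τ ∈ X.F, ∀ τ' ∈ X.F, X.extV c τ = X.extV c τ' := by
  apply X.propagate
  intro τ hτ τ' hτ' j hj hne hsub
  have hperp : ∀ i ∈ τ, i ⬝ᵥ (c j - X.extV c τ' j) = 0 := by
    intro i hi
    rw [dotProduct_sub]
    by_cases h : i = j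
    · subst h
      have h1 : i ⬝ᵥ c i = 0 := by have := hc τ hτ i hi i hi; linarith
      have h2 : i ⬝ᵥ X.extV c τ' i =
          ∑ k ∈ τ', ∑ l ∈ τ', X.b τ' k i * X.b τ' l i * (l ⬝ᵥ c k) := by
        rw [extV_apply, dotProduct_sum]
        refine Finset.sum_congr rfl fun k _ => ?_
        rw [dotProduct_smul]
        have hik : i ⬝ᵥ c k = ∑ l ∈ τ', X.b τ' l i * (l ⬝ᵥ c k) := by
          conv_lhs => rw [← X.brep τ' hτ' i, sum_dotProduct]
          simp only [smul_dotProduct, smul_eq_mul]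
        rw [hik, smul_eq_mul, Finset.mul_sum]
        refine Finset.sum_congr rfl fun l _ => ?_
        ring
      have h3 : ∑ k ∈ τ', ∑ l ∈ τ', X.b τ' k i * X.b τ' l i * (l ⬝ᵥ c k) =
          ∑ k ∈ τ', ∑ l ∈ τ', X.b τ' k i * X.b τ' l i * (k ⬝ᵥ c l) := by
        rw [Finset.sum_comm]
        refine Finset.sum_congr rfl fun k _ => Finset.sum_congr rfl fun l _ => ?_
        ring
      have h4 : (∑ k ∈ τ', ∑ l ∈ τ', X.b τ' k i * X.b τ' l i * (l ⬝ᵥ c k)) +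
          ∑ k ∈ τ', ∑ l ∈ τ', X.b τ' k i * X.b τ' l i * (k ⬝ᵥ c l) = 0 := by
        simp only [← Finset.sum_add_distrib]
        refine Finset.sum_eq_zero fun k hk => Finset.sum_eq_zero fun l hl => ?_
        rw [← mul_add, hc τ' hτ' l hl k hk, mul_zero]
      linarith
    · have hi' : i ∈ τ' := hsub (Finset.mem_erase.2 ⟨h, hi⟩)
      have h2 : i ⬝ᵥ X.extV c τ' j = - (j ⬝ᵥ c i) := by
        rw [extV_apply, dotProduct_sum]
        conv_rhs => rw [← X.brep τ' hτ' j, sum_dotProduct]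
        rw [← Finset.sum_neg_distrib]
        refine Finset.sum_congr rfl fun k hk => ?_
        rw [dotProduct_smul, smul_dotProduct, smul_eq_mul, smul_eq_mul,
          ← mul_neg]
        congr 1
        have := hc τ' hτ' i hi' k hk
        linarith
      have := hc τ hτ i hi j hj
      linarith
  have hu : c j - X.extV c τ' j = 0 := by
    apply dotProduct_self_eq_zero.1
    set u := c j - X.extV c τ' j with hu
    conv_lhs => enter [1]; rw [← X.brep τ hτ u]
    rw [sum_dotProduct]
    refine Finset.sum_eq_zero fun i hi => ?_
    rw [smul_dotProduct, hperp i hi, smul_zero]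
  apply LinearMap.ext
  intro x
  conv_lhs => rw [← X.brep τ hτ x]
  conv_rhs => rw [← X.brep τ hτ x]
  rw [map_sum, map_sum]
  refine Finset.sum_congr rfl fun i hi => ?_
  rw [map_smul, map_smul, X.extV_mem c hτ hi]
  by_cases h : i = j
  · subst h; rw [sub_eq_zero.1 hu]
  · rw [X.extV_mem c hτ' (hsub (Finset.mem_erase.2 ⟨h, hi⟩))]

/-- even infinitesimal motions are translations -/
lemma rigid_even (hd : 3 ≤ d) (hcov : ∀ v ∈ X.V, ∃ τ ∈ X.F, v ∈ τ) (hneg : ∀ v ∈ X.V, -v ∈ X.V)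
    (c : (Fin d → ℝ) → (Fin d → ℝ)) (heven : ∀ v ∈ X.V, c (-v) = c v)
    (hc : ∀ τ ∈ X.F, ∀ v ∈ τ, ∀ w ∈ τ, (v - w) ⬝ᵥ (c v - c w) = 0) :
    ∃ t, ∀ v ∈ X.V, c v = t := by
  by_cases hne : X.F.Nonempty
  swap
  · refine ⟨0, fun v hv => ?_⟩
    obtain ⟨τ, hτ, _⟩ := hcov v hv
    exact absurd ⟨τ, hτ⟩ hne
  obtain ⟨τ0, h0⟩ := hne
  have h1 := X.ext_const hd (fun v => v ⬝ᵥ c v) c (fun τ hτ v hv w hw => by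
    have := hc τ hτ v hv w hw
    simp only [sub_dotProduct, dotProduct_sub] at this
    linarith)
  set l := X.ext (fun v => v ⬝ᵥ c v) τ0 with hl
  have hlv : ∀ v ∈ X.V, l v = v ⬝ᵥ c v := by
    intro v hv
    obtain ⟨τ, hτ, hvτ⟩ := hcov v hv
    rw [hl, h1 τ0 h0 τ hτ, X.ext_mem _ hτ hvτ]
  set t : Fin d → ℝ := fun k => l (fun j => if k = j then 1 else 0) with ht
  have hlt : ∀ x, l x = x ⬝ᵥ t := by
    intro x
    rw [LinearMap.pi_apply_eq_sum_univ l x]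
    simp [dotProduct, ht]
  have hct : ∀ v ∈ X.V, v ⬝ᵥ t = v ⬝ᵥ c v := fun v hv => by rw [← hlt, hlv v hv]
  have h2 := X.extV_const (fun v => c v - t) (fun τ hτ v hv w hw => by
    have := hc τ hτ v hv w hw
    have a1 := hct v (X.sub τ hτ hv)
    have a2 := hct w (X.sub τ hτ hw)
    simp only [sub_dotProduct, dotProduct_sub] at this ⊢
    linarith)
  set A := X.extV (fun v => c v - t) τ0 with hA
  have hAv : ∀ v ∈ X.V, A v = c v - t := by
    intro v hv
    obtain ⟨τ, hτ, hvτ⟩ := hcov v hv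
    rw [hA, h2 τ0 h0 τ hτ, X.extV_mem _ hτ hvτ]
  refine ⟨t, fun v hv => ?_⟩
  have e1 := hAv v hv
  have e2 := hAv (-v) (hneg v hv)
  rw [map_neg, heven v hv, e1] at e2
  have : c v - t = 0 := by
    have h : (2:ℝ) • (c v - t) = 0 := by
      rw [two_smul]
      nth_rewrite 1 [← e2]
      simp
    exact (smul_eq_zero.1 h).resolve_left two_ne_zero
  exact sub_eq_zero.1 this

end Fan

section PolyToFan
variable {d : ℕ}

lemma hull_le {V : Finset (Fin d → ℝ)} {q : Module.Dual ℝ (Fin d → ℝ)} {c : ℝ}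
    (hq : ∀ v ∈ V, q v ≤ c) : ∀ y ∈ polyBody V, q y ≤ c := by
  intro y hy
  have : polyBody V ⊆ {x | q x ≤ c} :=
    convexHull_min (fun v hv => hq v hv) (convex_halfSpace_le q.isLinear c)
  exact this hy

lemma zero_mem_hull {s : Set (Fin d → ℝ)} {u : Fin d → ℝ} (hu : u ∈ s) (hu' : -u ∈ s) :
    (0 : Fin d → ℝ) ∈ convexHull ℝ s := by
  have h := (convex_convexHull ℝ s) (subset_convexHull ℝ s hu) (subset_convexHull ℝ s hu')
    (show (0:ℝ) ≤ 1/2 by norm_num) (show (0:ℝ) ≤ 1/2 by norm_num) (by norm_num)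
  simpa using h

lemma poly_nonempty (P : SPolytope d) : P.V.Nonempty := by
  by_contra h
  rw [Finset.not_nonempty_iff_eq_empty] at h
  have := P.span_top
  rw [h] at this
  simp at this

lemma poly_span (P : SPolytope d) (n : Module.Dual ℝ (Fin d → ℝ)) (hn : ∀ v ∈ P.V, n v = 0) :
    n = 0 := by
  have h1 : affineSpan ℝ (P.V : Set (Fin d → ℝ)) ≤ (LinearMap.ker n).toAffineSubspace := by
    rw [affineSpan_le]
    intro v hv
    exact hn v hv
  rw [P.span_top] at h1
  ext x
  have := h1 (AffineSubspace.mem_top ℝ _ (Pi.single x 1 : Fin d → ℝ))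
  simpa using this

lemma properFace (P : SPolytope d) (hcs : IsCS P) {q : Module.Dual ℝ (Fin d → ℝ)}
    (hq : ∀ v ∈ P.V, q v ≤ 1) : IsProperFace P.V {y ∈ polyBody P.V | q y = 1} := by
  refine ⟨⟨q, 1, hull_le hq, rfl⟩, fun h => ?_⟩
  obtain ⟨u, hu⟩ := poly_nonempty P
  have h0 : (0 : Fin d → ℝ) ∈ polyBody P.V := zero_mem_hull hu (hcs u hu)
  rw [← h] at h0
  simpa using h0.2

def FacQ (P : SPolytope d) (τ : Finset (Fin d → ℝ)) (q : Module.Dual ℝ (Fin d → ℝ)) : Prop :=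
  τ ⊆ P.V ∧ (∀ v ∈ P.V, q v ≤ 1) ∧ (∀ v ∈ P.V, q v = 1 ↔ v ∈ τ) ∧
    Submodule.span ℝ (τ : Set (Fin d → ℝ)) = ⊤

lemma facq_indep (P : SPolytope d) (hcs : IsCS P) {τ q} (h : FacQ P τ q) :
    LinearIndependent ℝ (fun x : τ => (x : Fin d → ℝ)) := by
  obtain ⟨hs, hq, he, -⟩ := h
  have ha := (P.simplicial _ (properFace P hcs hq)).1
  have hset : (P.V : Set (Fin d → ℝ)) ∩ {y ∈ polyBody P.V | q y = 1} = (τ : Set (Fin d → ℝ)) := by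
    ext v
    constructor
    · rintro ⟨h1, h2⟩
      exact (he v h1).1 h2.2
    · intro hv
      have hv' : v ∈ P.V := hs hv
      exact ⟨hv', subset_convexHull ℝ _ hv', (he v hv').2 hv⟩
  rw [hset] at ha
  rw [Fintype.linearIndependent_iff]
  intro g hg i
  rw [affineIndependent_iff] at ha
  refine ha Finset.univ g ?_ hg i (Finset.mem_univ _)
  have := congrArg q hg
  simp only [map_sum, map_smul, smul_eq_mul, map_zero] at this
  rw [← this]
  refine Finset.sum_congr rfl fun x _ => ?_
  rw [(he x (hs x.2)).2 x.2, mul_one]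

lemma facq_card (P : SPolytope d) (hcs : IsCS P) {τ q} (h : FacQ P τ q) : τ.card = d := by
  have h1 := facq_indep P hcs h
  have h2 := finrank_span_finset_eq_card (s := τ) h1
  rw [h.2.2.2] at h2
  simpa using h2.symm

lemma facq_basis (P : SPolytope d) (hcs : IsCS P) {τ q} (h : FacQ P τ q) :
    ∃ b : (Fin d → ℝ) → Module.Dual ℝ (Fin d → ℝ),
      (∀ i ∈ τ, ∀ j ∈ τ, b i j = if i = j then 1 else 0) ∧
      (∀ x, ∑ i ∈ τ, b i x • i = x) := by
  let B := Module.Basis.mk (facq_indep P hcs h) (by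
    rw [Subtype.range_coe_subtype]; exact h.2.2.2.ge)
  refine ⟨fun i => if hi : i ∈ τ then B.coord ⟨i, hi⟩ else 0, ?_, ?_⟩
  · intro i hi j hj
    have : B ⟨j, hj⟩ = j := by simp [B]
    simp only [dif_pos hi]
    conv_lhs => rw [← this]
    rw [B.coord_apply, B.repr_self, Finsupp.single_apply]
    simp [eq_comm]
  · intro x
    rw [← Finset.sum_coe_sort τ]
    conv_rhs => rw [← B.sum_repr x]
    refine Finset.sum_congr rfl fun i _ => ?_
    simp [B]

lemma rotate {V : Finset (Fin d → ℝ)} {q n : Module.Dual ℝ (Fin d → ℝ)}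
    (hq : ∀ v ∈ V, q v ≤ 1) (hn : ∀ v ∈ V, q v = 1 → n v ≤ 0) (hw : ∃ w ∈ V, 0 < n w) :
    ∃ s : ℝ, (∀ v ∈ V, (q + s • n) v ≤ 1) ∧ 0 < s ∧ ∃ w ∈ V, 0 < n w ∧ (q + s • n) w = 1 := by
  obtain ⟨w0, hw0, hw0'⟩ := hw
  obtain ⟨w, hw, hmin⟩ := Finset.exists_min_image (V.filter fun v => 0 < n v)
    (fun v => (1 - q v) / n v) ⟨w0, by simp [hw0, hw0']⟩
  rw [Finset.mem_filter] at hw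
  have hqw : q w < 1 := lt_of_le_of_ne (hq w hw.1) fun h => absurd (hn w hw.1 h) (not_le.2 hw.2)
  have hs : 0 < (1 - q w) / n w := div_pos (by linarith) hw.2
  refine ⟨(1 - q w) / n w, fun v hv => ?_, hs, w, hw.1, hw.2, ?_⟩
  · simp only [LinearMap.add_apply, LinearMap.smul_apply, smul_eq_mul]
    by_cases hnv : 0 < n v
    · have := hmin v (by simp [hv, hnv])
      rw [le_div_iff₀ hnv] at this
      linarith
    · have := mul_nonpos_of_nonneg_of_nonpos hs.le (not_lt.1 hnv)
      linarith [hq v hv]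
  · simp only [LinearMap.add_apply, LinearMap.smul_apply, smul_eq_mul]
    rw [div_mul_cancel₀ _ hw.2.ne']
    ring

lemma exists_facet (P : SPolytope d) (hcs : IsCS P) : ∃ τ q, FacQ P τ q := by
  let T : Set (Finset (Fin d → ℝ)) := {τ | τ ⊆ P.V ∧ ∃ q : Module.Dual ℝ (Fin d → ℝ),
    (∀ v ∈ P.V, q v ≤ 1) ∧ (∀ v ∈ P.V, q v = 1 ↔ v ∈ τ)}
  have hne : (P.V.powerset.filter (fun τ => τ ∈ T)).Nonempty :=
    ⟨∅, by
      rw [Finset.mem_filter]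
      exact ⟨by simp, by simp, 0, by simp, by simp⟩⟩
  obtain ⟨τ, hτ, hmax⟩ := Finset.exists_max_image _ Finset.card hne
  obtain ⟨-, hτs, q, hq, he⟩ := Finset.mem_filter.1 hτ
  refine ⟨τ, q, hτs, hq, he, ?_⟩
  by_contra hsp
  obtain ⟨n, hn0, hker⟩ := Submodule.exists_le_ker_of_lt_top _ (lt_top_iff_ne_top.2 hsp)
  have hnτ : ∀ v ∈ τ, n v = 0 := fun v hv => hker (Submodule.subset_span hv)
  obtain ⟨w, hw, hnw⟩ : ∃ w ∈ P.V, 0 < n w := by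
    by_contra hcon
    push Not at hcon
    refine hn0 (poly_span P n fun v hv => le_antisymm (hcon v hv) ?_)
    have := hcon (-v) (hcs v hv)
    rw [map_neg] at this
    linarith
  obtain ⟨s, hle, -, w, hw, hnw, hw1⟩ := rotate hq
    (fun v hv h => (hnτ v ((he v hv).1 h)).le) ⟨w, hw, hnw⟩
  have h1 := hmax (P.V.filter fun v => (q + s • n) v = 1) (by
    simp only [Finset.mem_filter, Finset.mem_powerset]
    exact ⟨Finset.filter_subset _ _, Finset.filter_subset _ _, q + s • n, hle, by simp +contextual⟩)
  have h2 : insert w τ ⊆ P.V.filter fun v => (q + s • n) v = 1 := by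
    intro v hv
    rw [Finset.mem_filter]
    rcases Finset.mem_insert.1 hv with rfl | hv
    · exact ⟨hw, hw1⟩
    · exact ⟨hτs hv, by simp [hnτ v hv, (he v (hτs hv)).2 hv]⟩
  have h3 := Finset.card_le_card h2
  rw [Finset.card_insert_of_notMem (fun h => hnw.ne' (hnτ w h))] at h3
  omega

lemma exists_adj (P : SPolytope d) (hcs : IsCS P) {τ q} (h : FacQ P τ q) {i} (hi : i ∈ τ) :
    ∃ τ' q', FacQ P τ' q' ∧ τ' ≠ τ ∧ τ.erase i ⊆ τ' := by
  obtain ⟨b, hb, hr⟩ := facq_basis P hcs h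
  obtain ⟨hτs, hq, he, hsp⟩ := h
  have hbn : ∀ v ∈ τ, v ≠ i → b i v = 0 := fun v hv hne => by
    rw [hb i hi v hv, if_neg hne.symm]
  have hbi : b i i = 1 := by rw [hb i hi i hi, if_pos rfl]
  obtain ⟨s, hle, hs, w, hw, hnw, hw1⟩ := rotate (n := - b i) hq (fun v hv h => by
      have hv' := (he v hv).1 h
      by_cases hvi : v = i
      · subst hvi; simp [hbi]
      · simp [hbn v hv' hvi]) ⟨-i, hcs i (hτs hi), by simp [hbi]⟩
  have hsub : τ.erase i ⊆ P.V.filter fun v => (q + s • -b i) v = 1 := by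
    intro v hv
    rw [Finset.mem_erase] at hv
    rw [Finset.mem_filter]
    exact ⟨hτs hv.2, by simp [hbn v hv.2 hv.1, (he v (hτs hv.2)).2 hv.2]⟩
  refine ⟨P.V.filter fun v => (q + s • -b i) v = 1, q + s • -b i,
    ⟨Finset.filter_subset _ _, hle, by simp +contextual, ?_⟩, ?_, hsub⟩
  · set S := Submodule.span ℝ ((P.V.filter fun v => (q + s • -b i) v = 1 : Finset _) :
      Set (Fin d → ℝ)) with hS
    have hwS : w ∈ S := Submodule.subset_span (by simp only [Finset.coe_filter]; exact ⟨hw, hw1⟩)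
    have heS : ∀ v ∈ τ, v ≠ i → v ∈ S := fun v hv hne =>
      Submodule.subset_span (hsub (Finset.mem_erase.2 ⟨hne, hv⟩))
    have hiS : i ∈ S := by
      have h1 := hr w
      rw [← Finset.add_sum_erase τ _ hi] at h1
      have h2 : b i w • i ∈ S := by
        rw [eq_sub_of_add_eq h1]
        refine S.sub_mem hwS (S.sum_mem fun v hv => S.smul_mem _ ?_)
        rw [Finset.mem_erase] at hv
        exact heS v hv.2 hv.1
      refine (S.smul_mem_iff ?_).1 h2
      rw [LinearMap.neg_apply] at hnw
      linarith
    rw [eq_top_iff, ← hsp, Submodule.span_le]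
    intro v hv
    by_cases hvi : v = i
    · rw [hvi]; exact hiS
    · exact heS v hv hvi
  · intro heq
    rw [← heq, Finset.mem_filter] at hi
    have := hi.2
    simp only [LinearMap.add_apply, LinearMap.smul_apply, LinearMap.neg_apply, hbi,
      smul_eq_mul] at this
    linarith [hq i hi.1]

lemma facq_neg (P : SPolytope d) (hcs : IsCS P) {τ q} (h : FacQ P τ q) :
    FacQ P (τ.image (fun v => -v)) (-q) := by
  obtain ⟨hτs, hq, he, hsp⟩ := h
  refine ⟨?_, ?_, ?_, ?_⟩
  · intro v hv
    obtain ⟨u, hu, rfl⟩ := Finset.mem_image.1 hv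
    exact hcs u (hτs hu)
  · intro v hv
    have := hq (-v) (hcs v hv)
    simpa using this
  · intro v hv
    have := he (-v) (hcs v hv)
    rw [LinearMap.neg_apply, ← map_neg, this, Finset.mem_image]
    constructor
    · intro h; exact ⟨-v, h, neg_neg v⟩
    · rintro ⟨u, hu, rfl⟩; rwa [neg_neg]
  · rw [eq_top_iff, ← hsp, Submodule.span_le]
    intro v hv
    have : -v ∈ Submodule.span ℝ ((τ.image (fun v => -v) : Finset _) : Set (Fin d → ℝ)) :=
      Submodule.subset_span (Finset.mem_coe.2 (Finset.mem_image_of_mem _ hv))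
    simpa using Submodule.neg_mem _ this

def detD (τ : Finset (Fin d → ℝ)) : ℝ :=
  if h : τ.card = d then
    |(Pi.basisFun ℝ (Fin d)).det (fun k => ((τ.equivFinOfCardEq h).symm k : Fin d → ℝ))|
  else 1

lemma detD_eq {τ : Finset (Fin d → ℝ)} (hc : τ.card = d) (f : Fin d → (Fin d → ℝ))
    (hf : Function.Injective f) (hm : ∀ k, f k ∈ τ) :
    detD τ = |(Pi.basisFun ℝ (Fin d)).det f| := by
  rw [detD, dif_pos hc]
  let g : Fin d → τ := fun k => ⟨f k, hm k⟩
  have hg : Function.Bijective g := by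
    rw [Fintype.bijective_iff_injective_and_card]
    refine ⟨fun a b h => hf (congrArg Subtype.val h), by simp [hc]⟩
  let e := Equiv.ofBijective g hg
  let σ : Equiv.Perm (Fin d) := e.trans (τ.equivFinOfCardEq hc)
  have h1 : f = (fun k => ((τ.equivFinOfCardEq hc).symm k : Fin d → ℝ)) ∘ σ := by
    funext k
    simp [σ, e, g]
  conv_rhs => rw [h1]
  rw [AlternatingMap.map_perm]
  rcases Int.units_eq_one_or (Equiv.Perm.sign σ) with h | h <;> simp [h]

lemma detD_pos (P : SPolytope d) (hcs : IsCS P) {τ q} (h : FacQ P τ q) : 0 < detD τ := by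
  have hc := facq_card P hcs h
  let e := (τ.equivFinOfCardEq hc).symm
  rw [detD_eq hc (fun k => (e k : Fin d → ℝ))
    (fun a b hab => e.injective (Subtype.ext hab)) (fun k => (e k).2)]
  rw [abs_pos]
  refine IsUnit.ne_zero (((Pi.basisFun ℝ (Fin d)).is_basis_iff_det).1 ⟨?_, ?_⟩)
  · exact (facq_indep P hcs h).comp e e.injective
  · have : Set.range (fun k => (e k : Fin d → ℝ)) = (τ : Set (Fin d → ℝ)) := by
      ext v
      constructor
      · rintro ⟨k, rfl⟩; exact (e k).2
      · intro hv; exact ⟨e.symm ⟨v, hv⟩, by simp⟩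
    rw [this, h.2.2.2]

lemma detD_rel {S : Finset (Fin d → ℝ)} {j j' : Fin d → ℝ} (hj : j ∉ S)
    (h1 : (insert j S).card = d) (h2 : (insert j' S).card = d)
    (l : Module.Dual ℝ (Fin d → ℝ)) (hl1 : l j' = 1) (hl0 : ∀ s ∈ S, l s = 0) :
    detD (insert j S) = |l j| * detD (insert j' S) := by
  let e := ((insert j' S).equivFinOfCardEq h2).symm
  let T := LinearMap.transvection l (j - j')
  have hT : ∀ x, T x = x + l x • (j - j') := fun x => by simp [T, LinearMap.transvection.apply]
  have hTj : T j' = j := by rw [hT, hl1]; simp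
  have hTs : ∀ s ∈ S, T s = s := fun s hs => by rw [hT, hl0 s hs]; simp
  have he : ∀ k, (e k : Fin d → ℝ) = j' ∨ (e k : Fin d → ℝ) ∈ S := fun k =>
    Finset.mem_insert.1 (e k).2
  rw [detD_eq h2 (fun k => (e k : Fin d → ℝ))
    (fun a b hab => e.injective (Subtype.ext hab)) (fun k => (e k).2)]
  rw [detD_eq h1 (T ∘ fun k => (e k : Fin d → ℝ)) ?_ ?_, Module.Basis.det_comp, abs_mul,
    LinearMap.transvection.det]
  · congr 2
    rw [map_sub, hl1]; ring
  · intro a b hab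
    apply e.injective
    apply Subtype.ext
    simp only [Function.comp] at hab
    rcases he a with ha | ha <;> rcases he b with hb | hb
    · rw [ha, hb]
    · rw [ha, hTj, hTs _ hb] at hab
      rw [← hab] at hb
      exact absurd hb hj
    · rw [hb, hTj, hTs _ ha] at hab
      rw [hab] at ha
      exact absurd ha hj
    · rwa [hTs _ ha, hTs _ hb] at hab
  · intro k
    simp only [Function.comp]
    rcases he k with ha | ha
    · rw [ha, hTj]; exact Finset.mem_insert_self _ _
    · rw [hTs _ ha]; exact Finset.mem_insert_of_mem ha

lemma exists_fan (P : SPolytope d) (hcs : IsCS P) :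
    ∃ X : Fan d, X.V = P.V ∧ ∀ τ, τ ∈ X.F ↔ ∃ q, FacQ P τ q := by
  have hF : ∀ τ, τ ∈ P.V.powerset.filter (fun τ => ∃ q, FacQ P τ q) ↔ ∃ q, FacQ P τ q := by
    intro τ
    rw [Finset.mem_filter, Finset.mem_powerset]
    exact ⟨fun h => h.2, fun h => ⟨by obtain ⟨q, hq⟩ := h; exact hq.1, h⟩⟩
  generalize P.V.powerset.filter (fun τ => ∃ q, FacQ P τ q) = F at hF
  have hq' : ∀ τ, ∃ q, τ ∈ F → FacQ P τ q := fun τ => by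
    by_cases h : τ ∈ F
    · obtain ⟨q, hq⟩ := (hF τ).1 h
      exact ⟨q, fun _ => hq⟩
    · exact ⟨0, fun h' => absurd h' h⟩
  choose q hq using hq'
  have hb' : ∀ τ, ∃ b : (Fin d → ℝ) → Module.Dual ℝ (Fin d → ℝ), τ ∈ F →
      (∀ i ∈ τ, ∀ j ∈ τ, b i j = if i = j then 1 else 0) ∧
      (∀ x, ∑ i ∈ τ, b i x • i = x) := fun τ => by
    by_cases h : τ ∈ F
    · obtain ⟨b, hb⟩ := facq_basis P hcs (hq τ h)
      exact ⟨b, fun _ => hb⟩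
    · exact ⟨0, fun h' => absurd h' h⟩
  choose b hb using hb'
  obtain ⟨y, hy⟩ := Module.Dual.exists_forall_ne_zero_of_forall_exists
    (ι := {p : F × P.V // (p.2 : Fin d → ℝ) ∈ (p.1 : Finset (Fin d → ℝ))})
    (fun p => b p.1.1 p.1.2) (fun p => ⟨p.1.2, by
      rw [(hb p.1.1 p.1.1.2).1 _ p.2 _ p.2]; simp⟩)
  refine ⟨⟨P.V, F, q, b, detD, y, fun τ h => (hq τ h).1, fun τ h => facq_card P hcs (hq τ h),
    fun τ h => (hq τ h).2.1, fun τ h => (hq τ h).2.2.1, fun τ h => (hb τ h).1,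
    fun τ h => (hb τ h).2, ?_, fun τ h => detD_pos P hcs (hq τ h), ?_, ?_⟩, rfl, hF⟩
  · intro τ h i hi
    obtain ⟨τ', q', h1, h2, h3⟩ := exists_adj P hcs (hq τ h) hi
    exact ⟨τ', (hF τ').2 ⟨q', h1⟩, h2, h3⟩
  · intro S j j' hj hj' h1 h2
    refine detD_rel hj (facq_card P hcs (hq _ h1)) (facq_card P hcs (hq _ h2)) _ ?_ ?_
    · rw [(hb _ h2).1 _ (Finset.mem_insert_self _ _) _ (Finset.mem_insert_self _ _), if_pos rfl]
    · intro s hs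
      rw [(hb _ h2).1 _ (Finset.mem_insert_self _ _) _ (Finset.mem_insert_of_mem hs), if_neg]
      rintro rfl
      exact hj' hs
  · intro τ h i hi
    exact hy ⟨(⟨τ, h⟩, ⟨i, (hq τ h).1 hi⟩), hi⟩

lemma fan_cover (hd : 3 ≤ d) (P : SPolytope d) (hcs : IsCS P) (X : Fan d) (hV : X.V = P.V)
    (hF : ∀ τ, τ ∈ X.F ↔ ∃ q, FacQ P τ q) : ∀ v ∈ X.V, ∃ τ ∈ X.F, v ∈ τ := by
  intro v hv
  obtain ⟨τ0, q0, h0⟩ := exists_facet P hcs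
  obtain ⟨τ, hτ, hmax⟩ := Finset.exists_max_image X.F (fun τ => X.q τ v)
    ⟨τ0, (hF τ0).2 ⟨q0, h0⟩⟩
  refine ⟨τ, hτ, ?_⟩
  by_contra hvτ
  have hbn : ∀ i ∈ τ, 0 ≤ X.b τ i v := by
    intro i hi
    by_contra hneg
    push Not at hneg
    obtain ⟨τ', hτ', hne, hsub⟩ := X.adj τ hτ i hi
    have h1 := X.qdiff_ridge hτ hτ' (Finset.notMem_erase i τ) (Finset.insert_erase hi).symm hsub v
    have h2 := X.qlt hτ' (X.sub τ hτ hi) (X.notMem_adj hτ hτ' hi hne hsub)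
    have h3 := mul_neg_of_neg_of_pos hneg (sub_pos.2 h2)
    have h4 := hmax τ' hτ'
    linarith
  have hs : ∑ i ∈ τ, X.b τ i v < 1 := by
    have h1 := X.qlt hτ hv hvτ
    rw [X.lin_rep hτ (X.q τ) v] at h1
    refine lt_of_eq_of_lt (Finset.sum_congr rfl fun i hi => ?_) h1
    rw [(X.qeq τ hτ i (X.sub τ hτ hi)).2 hi, mul_one]
  have hmem : ∀ i ∈ τ, i ∈ ((P.V.erase v : Finset (Fin d → ℝ)) : Set (Fin d → ℝ)) := by
    intro i hi
    rw [Finset.mem_coe, Finset.mem_erase, ← hV]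
    exact ⟨fun h => hvτ (h ▸ hi), X.sub τ hτ hi⟩
  have hz : (0 : Fin d → ℝ) ∈
      convexHull ℝ ((P.V.erase v : Finset (Fin d → ℝ)) : Set (Fin d → ℝ)) := by
    obtain ⟨u, hu⟩ : (τ.erase (-v)).Nonempty := by
      rw [← Finset.card_pos]
      have := Finset.pred_card_le_card_erase (s := τ) (a := -v)
      rw [X.card τ hτ] at this
      omega
    rw [Finset.mem_erase] at hu
    refine zero_mem_hull (hmem u hu.2) ?_
    rw [Finset.mem_coe, Finset.mem_erase]
    refine ⟨fun h => hu.1 (by rw [← h, neg_neg]), hcs u ?_⟩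
    rw [← hV]
    exact X.sub τ hτ hu.2
  rw [hV] at hv
  refine P.extreme v hv ?_
  have hcv := convex_convexHull ℝ ((P.V.erase v : Finset (Fin d → ℝ)) : Set (Fin d → ℝ))
  have hs0 : 0 ≤ ∑ i ∈ τ, X.b τ i v := Finset.sum_nonneg hbn
  rcases hs0.eq_or_lt with h | h
  · have hall := (Finset.sum_eq_zero_iff_of_nonneg hbn).1 h.symm
    have : v = 0 := by
      rw [← X.brep τ hτ v]
      exact Finset.sum_eq_zero fun i hi => by rw [hall i hi, zero_smul]
    rw [this] at hz ⊢
    exact hz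
  · have h1 : ∑ i ∈ τ, (X.b τ i v / ∑ i ∈ τ, X.b τ i v) • i ∈
        convexHull ℝ ((P.V.erase v : Finset (Fin d → ℝ)) : Set (Fin d → ℝ)) := by
      refine hcv.sum_mem (fun i hi => div_nonneg (hbn i hi) hs0) ?_
        (fun i hi => subset_convexHull ℝ _ (hmem i hi))
      rw [← Finset.sum_div, div_self h.ne']
    have h2 := hcv.smul_mem_of_zero_mem hz h1 (t := ∑ i ∈ τ, X.b τ i v) ⟨hs0, hs.le⟩
    have h3 : (∑ i ∈ τ, X.b τ i v) • ∑ i ∈ τ, (X.b τ i v / ∑ i ∈ τ, X.b τ i v) • i = v := by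
      rw [Finset.smul_sum]
      conv_rhs => rw [← X.brep τ hτ v]
      refine Finset.sum_congr rfl fun i hi => ?_
      rw [smul_smul, mul_div_cancel₀ _ h.ne']
    rwa [h3] at h2

/-- dot product with a fixed vector, as a linear functional -/
def dotL (u : Fin d → ℝ) : Module.Dual ℝ (Fin d → ℝ) where
  toFun x := u ⬝ᵥ x
  map_add' := dotProduct_add u
  map_smul' r x := dotProduct_smul r u x

/-- evaluation at `v` of the even extension of a vertex function defined on half of the vertices -/
def evenExt (Vp : Finset (Fin d → ℝ)) (v : Fin d → ℝ) :
    (Vp → (Fin d → ℝ)) →ₗ[ℝ] (Fin d → ℝ) :=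
  if h : v ∈ Vp then LinearMap.proj (⟨v, h⟩ : Vp)
  else if h' : -v ∈ Vp then LinearMap.proj (⟨-v, h'⟩ : Vp) else 0

/-- the symmetric rigidity map -/
def rigMap (Vp : Finset (Fin d → ℝ)) (Ep : Finset (Finset (Fin d → ℝ))) :
    (Vp → (Fin d → ℝ)) →ₗ[ℝ] (Ep → ℝ) :=
  LinearMap.pi fun e => ∑ v ∈ (e : Finset (Fin d → ℝ)), ∑ w ∈ (e : Finset (Fin d → ℝ)),
    (dotL (v - w)).comp (evenExt Vp v - evenExt Vp w)

lemma rank_bound (Vp : Finset (Fin d → ℝ)) (Ep : Finset (Finset (Fin d → ℝ)))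
    (h : ∀ c, rigMap Vp Ep c = 0 → ∃ t, ∀ v, c v = t) :
    d * Vp.card ≤ Ep.card + d := by
  have h1 := LinearMap.finrank_range_add_finrank_ker (rigMap Vp Ep)
  have h2 : Module.finrank ℝ (LinearMap.range (rigMap Vp Ep)) ≤ Ep.card := by
    refine (Submodule.finrank_le _).trans ?_
    simp
  let K : (Fin d → ℝ) →ₗ[ℝ] (Vp → (Fin d → ℝ)) := LinearMap.pi fun _ => LinearMap.id
  have h3 : LinearMap.ker (rigMap Vp Ep) ≤ LinearMap.range K := by
    intro c hc
    obtain ⟨t, ht⟩ := h c hc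
    exact ⟨t, funext fun v => (ht v).symm⟩
  have h4 := Submodule.finrank_mono h3
  have h5 := LinearMap.finrank_range_le K
  have h6 : Module.finrank ℝ (Vp → (Fin d → ℝ)) = Vp.card * d := by
    rw [Module.finrank_pi_fintype]; simp
  rw [Module.finrank_fin_fun] at h5
  rw [h6] at h1
  rw [mul_comm]
  omega

end PolyToFan

/-- For `d ≥ 3` and a centrally symmetric simplicial `d`-polytope `P`,
`g₂(P) ≥ C(d,2) - d`. -/
theorem stmt1 {d : ℕ} (hd : 3 ≤ d) (P : SPolytope d) (hcs : IsCS P) :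
    (d.choose 2 : ℤ) - (d : ℤ) ≤ g2 P := by
  obtain ⟨X, hV, hF⟩ := exists_fan P hcs
  have hcov := fan_cover hd P hcs X hV hF
  have hneg : ∀ v ∈ X.V, -v ∈ X.V := by rw [hV]; exact hcs
  have hFneg : ∀ τ ∈ X.F, τ.image (fun v => -v) ∈ X.F := by
    intro τ hτ
    obtain ⟨q, hq⟩ := (hF τ).1 hτ
    exact (hF _).2 ⟨-q, facq_neg P hcs hq⟩
  have hVne : ∀ v ∈ X.V, v ≠ 0 := by
    rintro v hv rfl
    obtain ⟨τ, hτ, hvτ⟩ := hcov 0 hv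
    simpa using (X.qeq τ hτ 0 hv).2 hvτ
  set Ed := X.V.powerset.filter (fun e => e.card = 2 ∧ ∃ τ ∈ X.F, e ⊆ τ) with hEd
  have hEdm : ∀ e, e ∈ Ed ↔ e.card = 2 ∧ ∃ τ ∈ X.F, e ⊆ τ := by
    intro e
    rw [hEd, Finset.mem_filter, Finset.mem_powerset]
    refine ⟨fun h => h.2, fun h => ⟨?_, h⟩⟩
    obtain ⟨-, τ, hτ, he⟩ := h
    exact he.trans (X.sub τ hτ)
  have hEdne : ∀ e ∈ Ed, ∑ x ∈ e, x ≠ 0 := by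
    intro e he h0
    obtain ⟨hc, τ, hτ, hs⟩ := (hEdm e).1 he
    have h1 := congrArg (X.q τ) h0
    rw [map_sum, map_zero, Finset.sum_congr rfl (fun x hx =>
      (X.qeq τ hτ x (X.sub τ hτ (hs hx))).2 (hs hx))] at h1
    simp [hc] at h1
  have hinj : Function.Injective (fun e : Finset (Fin d → ℝ) => e.image (fun v => -v)) :=
    Finset.image_injective neg_injective
  have hEdneg : ∀ e ∈ Ed, e.image (fun v => -v) ∈ Ed := by
    intro e he
    obtain ⟨hc, τ, hτ, hs⟩ := (hEdm e).1 he
    refine (hEdm _).2 ⟨?_, _, hFneg τ hτ, Finset.image_subset_image hs⟩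
    rw [Finset.card_image_of_injective _ neg_injective, hc]
  have hsumneg : ∀ e : Finset (Fin d → ℝ), ∑ x ∈ e.image (fun v => -v), x = -∑ x ∈ e, x := by
    intro e
    rw [Finset.sum_image (fun a _ b _ h => neg_injective h), Finset.sum_neg_distrib]
  obtain ⟨φ, hφ⟩ := Module.exists_dual_forall_apply_ne_zero (K := ℝ)
    (fun i : X.V ⊕ Ed => Sum.elim (fun v : X.V => (v : Fin d → ℝ))
      (fun e : Ed => ∑ x ∈ (e : Finset (Fin d → ℝ)), x) i)
    (by
      rintro (v | e)
      · exact hVne v v.2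
      · exact hEdne e e.2)
  have hφV : ∀ v ∈ X.V, φ v ≠ 0 := fun v hv => hφ (Sum.inl ⟨v, hv⟩)
  have hφE : ∀ e ∈ Ed, φ (∑ x ∈ e, x) ≠ 0 := fun e he => hφ (Sum.inr ⟨e, he⟩)
  set Vp := X.V.filter (fun v => 0 < φ v) with hVp
  set Ep := Ed.filter (fun e => 0 < φ (∑ x ∈ e, x)) with hEp
  have hVcard : X.V.card ≤ 2 * Vp.card := by
    have hsplit : Vp.card + (X.V.filter (fun v => ¬ 0 < φ v)).card = X.V.card := by
      rw [hVp]
      convert Finset.card_filter_add_card_filter_not (s := X.V) (fun v => 0 < φ v)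
    have : (X.V.filter (fun v => ¬ 0 < φ v)).card ≤ Vp.card := by
      refine Finset.card_le_card_of_injOn (fun v => -v) ?_ (fun a _ b _ h => neg_injective h)
      intro v hv
      simp only [Finset.coe_filter, Set.mem_ofPred_eq] at hv
      simp only [hVp, Finset.coe_filter, Set.mem_ofPred_eq, map_neg]
      refine ⟨hneg v hv.1, ?_⟩
      have := lt_of_le_of_ne (not_lt.1 hv.2) (hφV v hv.1)
      linarith
    omega
  have hEcard : 2 * Ep.card ≤ Ed.card := by
    have hsplit : Ep.card + (Ed.filter (fun e => ¬ 0 < φ (∑ x ∈ e, x))).card = Ed.card := by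
      rw [hEp]
      convert Finset.card_filter_add_card_filter_not (s := Ed) (fun e => 0 < φ (∑ x ∈ e, x))
    have : Ep.card ≤ (Ed.filter (fun e => ¬ 0 < φ (∑ x ∈ e, x))).card := by
      refine Finset.card_le_card_of_injOn (fun e => e.image (fun v => -v)) ?_
        (fun a _ b _ h => hinj h)
      intro e he
      simp only [hEp, Finset.coe_filter, Set.mem_ofPred_eq] at he
      simp only [Finset.coe_filter, Set.mem_ofPred_eq]
      refine ⟨hEdneg e he.1, ?_⟩
      rw [hsumneg, map_neg]
      linarith [he.2]
    omega
  have hf1 : Ed.card ≤ f1 P := by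
    refine Finset.card_le_card fun e he => ?_
    obtain ⟨hc, τ, hτ, hs⟩ := (hEdm e).1 he
    obtain ⟨q, hq⟩ := (hF τ).1 hτ
    have hsV : e ⊆ P.V := hs.trans hq.1
    rw [edgeFinset, Finset.mem_filter, Finset.mem_powerset]
    refine ⟨hsV, hc, hsV, _, properFace P hcs hq.2.1, fun v hv => ?_⟩
    exact ⟨subset_convexHull ℝ _ (hsV hv), (hq.2.2.1 v (hsV hv)).2 (hs hv)⟩
  have hrank : d * Vp.card ≤ Ep.card + d := by
    refine rank_bound Vp Ep fun c hc => ?_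
    have heven : ∀ v ∈ X.V, evenExt Vp (-v) c = evenExt Vp v c := by
      intro v hv
      by_cases h : v ∈ Vp
      · have h' : -v ∉ Vp := by
          intro h'
          have h1 := (Finset.mem_filter.1 h).2
          have h2 := (Finset.mem_filter.1 h').2
          rw [map_neg] at h2
          linarith
        have h'' : - -v ∈ Vp := by rwa [neg_neg]
        rw [evenExt, evenExt, dif_neg h', dif_pos h'', dif_pos h]
        simp
      · have h' : -v ∈ Vp := by
          refine Finset.mem_filter.2 ⟨hneg v hv, ?_⟩
          have h1 : ¬ 0 < φ v := fun h1 => h (Finset.mem_filter.2 ⟨hv, h1⟩)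
          have := lt_of_le_of_ne (not_lt.1 h1) (hφV v hv)
          rw [map_neg]
          linarith
        rw [evenExt, evenExt, dif_pos h', dif_neg h, dif_pos h']
    have hpair : ∀ v w, v ≠ w → ({v, w} : Finset (Fin d → ℝ)) ∈ Ep →
        (v - w) ⬝ᵥ (evenExt Vp v c - evenExt Vp w c) = 0 := by
      intro v w hvw he
      have h1 := congrFun hc ⟨{v, w}, he⟩
      rw [rigMap, LinearMap.pi_apply, Finset.sum_pair hvw, Finset.sum_pair hvw,
        Finset.sum_pair hvw] at h1
      change (v - v) ⬝ᵥ (evenExt Vp v c - evenExt Vp v c) +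
        (v - w) ⬝ᵥ (evenExt Vp v c - evenExt Vp w c) +
        ((w - v) ⬝ᵥ (evenExt Vp w c - evenExt Vp v c) +
        (w - w) ⬝ᵥ (evenExt Vp w c - evenExt Vp w c)) = 0 at h1
      simp only [sub_self, zero_dotProduct] at h1
      rw [← neg_sub v w, ← neg_sub (evenExt Vp v c), neg_dotProduct_neg] at h1
      linarith
    obtain ⟨t, ht⟩ := X.rigid_even hd hcov hneg (fun v => evenExt Vp v c) heven (by
      intro τ hτ v hv w hw
      by_cases hvw : v = w
      · simp [hvw]
      have hmem : ({v, w} : Finset (Fin d → ℝ)) ∈ Ed := by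
        refine (hEdm _).2 ⟨Finset.card_pair hvw, τ, hτ, ?_⟩
        intro x hx
        rcases Finset.mem_insert.1 hx with rfl | hx
        · exact hv
        · rw [Finset.mem_singleton.1 hx]; exact hw
      by_cases hpos : 0 < φ (∑ x ∈ ({v, w} : Finset (Fin d → ℝ)), x)
      · exact hpair v w hvw (Finset.mem_filter.2 ⟨hmem, hpos⟩)
      · have hlt := lt_of_le_of_ne (not_lt.1 hpos) (hφE _ hmem)
        have himg : ({v, w} : Finset (Fin d → ℝ)).image (fun v => -v) = {-v, -w} := by
          simp [Finset.image_insert]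
        have hm := hEdneg _ hmem
        have hsn := hsumneg {v, w}
        rw [himg] at hm hsn
        have := hpair (-v) (-w) (fun h => hvw (neg_injective h)) (Finset.mem_filter.2 ⟨hm, by
          rw [hsn, map_neg]; linarith⟩)
        rw [heven v (X.sub τ hτ hv), heven w (X.sub τ hτ hw)] at this
        have e : -v - -w = -(v - w) := by abel
        rw [e, neg_dotProduct] at this
        exact neg_eq_zero.1 this)
    refine ⟨t, fun v => ?_⟩
    rw [← ht v (Finset.mem_filter.1 v.2).1]
    have hv : (v : Fin d → ℝ) ∈ Vp := v.2
    simp only [evenExt, dif_pos hv, LinearMap.proj_apply]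
  have hch : (d + 1).choose 2 = d.choose 2 + d := by
    rw [Nat.choose_succ_succ' d 1]; simp [add_comm]
  rw [g2, hch, f0, ← hV]
  have h1 : d * X.V.card ≤ d * (2 * Vp.card) := Nat.mul_le_mul_left d hVcard
  have h2 : d * (2 * Vp.card) = 2 * (d * Vp.card) := by ring
  have h3 : d * X.V.card ≤ f1 P + 2 * d := by omega
  have h4 : (d : ℤ) * X.V.card ≤ f1 P + 2 * d := by exact_mod_cast h3
  push_cast
  linarith
end
end

section
/- Let d ≥ 4 and let P be a simplicial d-polytope in ℝ^d with natural embedding p. Then for every nonempty face τ of ∂P with |τ| ≤ d−3, the framework (st(τ), p) on the graph (1-skeleton) of the star st(τ) is infinitesimally rigid in ℝ^d. -/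
open Finset
open scoped Classical

noncomputable section

section Abstract

set_option linter.unusedSectionVars false

/-- A homogenized simplicial polytope: finitely many vectors such that every supporting
hyperplane contains only linearly independent ones. -/
structure PolySetup {ι W : Type} [AddCommGroup W] [Module ℝ W]
    (V : Finset ι) (p : ι → W) : Prop where
  zero : ∀ f : W →ₗ[ℝ] ℝ, (∀ x ∈ V, f (p x) = 0) → f = 0
  indep : ∀ f : W →ₗ[ℝ] ℝ, f ≠ 0 → (∀ x ∈ V, 0 ≤ f (p x)) →
    LinearIndepOn ℝ p {x | x ∈ V ∧ f (p x) = 0}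

/-- Faces in the homogenized setting. -/
def Fc {ι W : Type} [AddCommGroup W] [Module ℝ W]
    (V : Finset ι) (p : ι → W) (σ : Finset ι) : Prop :=
  σ ⊆ V ∧ ∃ f : W →ₗ[ℝ] ℝ, f ≠ 0 ∧ (∀ x ∈ V, 0 ≤ f (p x)) ∧ ∀ x ∈ σ, f (p x) = 0

variable {ι W : Type} [DecidableEq ι] [AddCommGroup W] [Module ℝ W] [FiniteDimensional ℝ W]
  {V : Finset ι} {p : ι → W}

lemma Fc.mono {σ τ : Finset ι} (h : Fc V p σ) (hs : τ ⊆ σ) : Fc V p τ := by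
  obtain ⟨h1, f, h2, h3, h4⟩ := h
  exact ⟨hs.trans h1, f, h2, h3, fun x hx => h4 x (hs hx)⟩

lemma exists_functional {s : Set ι} (h : LinearIndepOn ℝ p s) (c : ι → ℝ) :
    ∃ f : W →ₗ[ℝ] ℝ, ∀ x ∈ s, f (p x) = c x := by
  have hl := h.linearIndependent
  obtain ⟨g, hg⟩ := LinearMap.exists_extend ((Module.Basis.span hl).constr ℝ (fun x : s => c x))
  refine ⟨g, fun x hx => ?_⟩
  have h1 := LinearMap.congr_fun hg ((Module.Basis.span hl) ⟨x, hx⟩)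
  rw [Module.Basis.constr_basis, Module.Basis.span_apply] at h1
  simpa using h1

lemma PolySetup.linInd (H : PolySetup V p) {σ : Finset ι} (h : Fc V p σ) :
    LinearIndepOn ℝ p (σ : Set ι) := by
  obtain ⟨h1, f, h2, h3, h4⟩ := h
  exact (H.indep f h2 h3).mono fun x hx => ⟨h1 hx, h4 x hx⟩

lemma PolySetup.exact (H : PolySetup V p) {σ : Finset ι} (h : Fc V p σ) :
    ∃ f : W →ₗ[ℝ] ℝ, (∀ x ∈ σ, f (p x) = 0) ∧ (∀ x ∈ V, x ∉ σ → 0 < f (p x)) ∧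
      ∃ x ∈ V, x ∉ σ := by
  obtain ⟨h1, f, h2, h3, h4⟩ := h
  obtain ⟨k, hk⟩ := exists_functional (H.indep f h2 h3) (fun x => if x ∈ σ then 0 else 1)
  have hex : ∃ x ∈ V, x ∉ σ := by
    by_contra hcon
    push Not at hcon
    exact h2 (H.zero f fun x hx => h4 x (hcon x hx))
  have key : ∀ x ∈ V, x ∉ σ → ∀ᶠ ε in nhdsWithin (0:ℝ) (Set.Ioi 0), 0 < f (p x) + ε * k (p x) := by
    intro x hx hxs
    by_cases hz : f (p x) = 0
    · have : k (p x) = 1 := by rw [hk x ⟨hx, hz⟩]; simp [hxs]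
      filter_upwards [self_mem_nhdsWithin] with ε hε
      rw [hz, this]; simpa using hε
    · have hpos : 0 < f (p x) := lt_of_le_of_ne (h3 x hx) (Ne.symm hz)
      apply Filter.Eventually.filter_mono nhdsWithin_le_nhds
      have hc : ContinuousAt (fun ε : ℝ => f (p x) + ε * k (p x)) 0 := by fun_prop
      have := hc.eventually (lt_mem_nhds (a := 0) (b := f (p x) + 0 * k (p x)) (by simpa using hpos))
      exact this
  have key2 : ∀ᶠ ε in nhdsWithin (0:ℝ) (Set.Ioi 0), ∀ x ∈ V, x ∉ σ →
      0 < f (p x) + ε * k (p x) := by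
    rw [Filter.eventually_all_finset]
    intro x hx
    by_cases hxs : x ∈ σ
    · exact Filter.Eventually.of_forall fun _ h => absurd hxs h
    · filter_upwards [key x hx hxs] with ε hε _ using hε
  obtain ⟨ε, hε⟩ := key2.exists
  refine ⟨f + ε • k, fun x hx => ?_, fun x hx hxs => ?_, hex⟩
  · have : k (p x) = 0 := by rw [hk x ⟨h1 hx, h4 x hx⟩]; simp [hx]
    simp [h4 x hx, this]
  · simpa using hε x hx hxs

lemma fc_of_nonneg (f : W →ₗ[ℝ] ℝ) {σ : Finset ι} (hs : σ ⊆ V) (hf : f ≠ 0)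
    (h : ∀ x ∈ V, 0 ≤ f (p x)) (h0 : ∀ x ∈ σ, f (p x) = 0) : Fc V p σ := ⟨hs, f, hf, h, h0⟩

/-- Functionals vanishing on `σ`. -/
def Ann (p : ι → W) (σ : Finset ι) : Submodule ℝ (Module.Dual ℝ W) :=
  (Submodule.span ℝ (Set.range fun x : (σ : Set ι) => p x)).dualAnnihilator

lemma mem_Ann {σ : Finset ι} {f : W →ₗ[ℝ] ℝ} : f ∈ Ann p σ ↔ ∀ x ∈ σ, f (p x) = 0 := by
  unfold Ann
  rw [Submodule.mem_dualAnnihilator]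
  constructor
  · intro h x hx
    exact h _ (Submodule.subset_span ⟨⟨x, hx⟩, rfl⟩)
  · intro h w hw
    have : Submodule.span ℝ (Set.range fun x : (σ : Set ι) => p x) ≤ LinearMap.ker f := by
      rw [Submodule.span_le]
      rintro _ ⟨⟨x, hx⟩, rfl⟩
      exact h x hx
    exact this hw

lemma PolySetup.card_le (H : PolySetup V p) {σ : Finset ι} (h : Fc V p σ) {k : ℕ}
    (F : Fin k → W →ₗ[ℝ] ℝ) (hF : ∀ i, ∀ x ∈ σ, F i (p x) = 0) (hl : LinearIndependent ℝ F) :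
    k + σ.card ≤ Module.finrank ℝ W := by
  have h1 : Module.finrank ℝ (Submodule.span ℝ (Set.range fun x : (σ : Set ι) => p x)) +
      Module.finrank ℝ (Ann p σ) = Module.finrank ℝ W :=
    Subspace.finrank_add_finrank_dualAnnihilator_eq _
  have h2 : Module.finrank ℝ (Submodule.span ℝ (Set.range fun x : (σ : Set ι) => p x)) = σ.card := by
    rw [finrank_span_eq_card (H.linInd h).linearIndependent]; simp
  have h3 : LinearIndependent ℝ (fun i => (⟨F i, mem_Ann.2 (hF i)⟩ : Ann p σ)) := by
    apply LinearIndependent.of_comp (Ann p σ).subtype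
    exact hl
  have h4 := h3.fintype_card_le_finrank
  simp only [Fintype.card_fin] at h4
  omega

lemma exists_not_mul {σ : Finset ι} (h : σ.card + 2 ≤ Module.finrank ℝ W) (ψ0 : W →ₗ[ℝ] ℝ) :
    ∃ ψ : W →ₗ[ℝ] ℝ, (∀ x ∈ σ, ψ (p x) = 0) ∧ ∀ c : ℝ, ψ ≠ c • ψ0 := by
  have h1 := Subspace.finrank_add_finrank_dualAnnihilator_eq
    (Submodule.span ℝ (Set.range fun x : (σ : Set ι) => p x))
  have h2 := finrank_range_le_card (R := ℝ) (fun x : (σ : Set ι) => p x)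
  have h5 : Fintype.card ↑(σ : Set ι) = σ.card := by simp
  unfold Set.finrank at h2
  by_contra hcon
  push Not at hcon
  have h6 : Ann p σ ≤ Submodule.span ℝ {ψ0} := by
    intro f hf
    obtain ⟨c, hc⟩ := hcon f (mem_Ann.1 hf)
    rw [Submodule.mem_span_singleton]
    exact ⟨c, hc.symm⟩
  have h7 := Submodule.finrank_mono h6
  have h8 := finrank_span_le_card (R := ℝ) ({ψ0} : Set (W →ₗ[ℝ] ℝ))
  simp only [Set.toFinset_singleton, Finset.card_singleton] at h8
  unfold Ann at h7
  have h9 := h7.trans h8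
  omega

lemma PolySetup.card_lt (H : PolySetup V p) {σ : Finset ι} (h : Fc V p σ) :
    σ.card + 1 ≤ Module.finrank ℝ W := by
  have h' := h
  obtain ⟨h1, f, h2, h3, h4⟩ := h
  have := H.card_le h' (k := 1) (fun _ => f) (fun _ => h4) (by
    rw [linearIndependent_unique_iff]; exact h2)
  omega

/-- Pivoting. -/
lemma PolySetup.rotate (H : PolySetup V p) {σ : Finset ι} (h : Fc V p σ) {ψ0 ψ : W →ₗ[ℝ] ℝ}
    (h0 : ∀ x ∈ σ, ψ0 (p x) = 0) (hp : ∀ x ∈ V, x ∉ σ → 0 < ψ0 (p x))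
    (hψ : ∀ x ∈ σ, ψ (p x) = 0) (hn : ∀ c : ℝ, ψ ≠ c • ψ0) :
    ∃ y ∈ V, y ∉ σ ∧ Fc V p (insert y σ) ∧
      ∀ x ∈ V, x ∉ σ → ψ (p y) / ψ0 (p y) ≤ ψ (p x) / ψ0 (p x) := by
  obtain ⟨_, _, _, z, hz, hzs⟩ := H.exact h
  obtain ⟨y, hy, hmin⟩ := Finset.exists_min_image (V \ σ) (fun x => ψ (p x) / ψ0 (p x))
    ⟨z, by simp [hz, hzs]⟩
  simp only [Finset.mem_sdiff] at hy hmin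
  refine ⟨y, hy.1, hy.2, ?_, fun x hx hxs => hmin x ⟨hx, hxs⟩⟩
  have hy0 := hp y hy.1 hy.2
  refine fc_of_nonneg (ψ - (ψ (p y) / ψ0 (p y)) • ψ0) ?_ ?_ ?_ ?_
  · intro x hx
    rcases Finset.mem_insert.1 hx with rfl | hx
    · exact hy.1
    · exact h.1 hx
  · intro hc
    exact hn _ (sub_eq_zero.1 hc)
  · intro x hx
    by_cases hxs : x ∈ σ
    · simp [h0 x hxs, hψ x hxs]
    · have := hmin x ⟨hx, hxs⟩
      have h1 := hp x hx hxs
      rw [le_div_iff₀ h1] at this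
      simpa using this
  · intro x hx
    rcases Finset.mem_insert.1 hx with rfl | hx
    · simp only [LinearMap.sub_apply, LinearMap.smul_apply, smul_eq_mul]
      field_simp; ring
    · simp [h0 x hx, hψ x hx]

lemma PolySetup.link_nonempty (H : PolySetup V p) {σ : Finset ι} (h : Fc V p σ)
    (hc : σ.card + 2 ≤ Module.finrank ℝ W) : ∃ y ∈ V, y ∉ σ ∧ Fc V p (insert y σ) := by
  obtain ⟨ψ0, h0, hp, -⟩ := H.exact h
  obtain ⟨ψ, hψ, hn⟩ := exists_not_mul (p := p) hc ψ0
  obtain ⟨y, hy, hys, hf, -⟩ := H.rotate h h0 hp hψ hn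
  exact ⟨y, hy, hys, hf⟩

/-- Local-to-global principle. -/
lemma PolySetup.l2g (H : PolySetup V p) {σ : Finset ι} (h : Fc V p σ)
    (hc : σ.card + 2 ≤ Module.finrank ℝ W) {g : W →ₗ[ℝ] ℝ} (hg : ∀ x ∈ σ, g (p x) = 0)
    (hl : ∀ y ∈ V, y ∉ σ → Fc V p (insert y σ) → 0 ≤ g (p y)) : ∀ x ∈ V, 0 ≤ g (p x) := by
  obtain ⟨ψ0, h0, hp, -⟩ := H.exact h
  intro x hx
  by_cases hxs : x ∈ σ
  · exact (hg x hxs).ge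
  by_cases hn : ∀ c : ℝ, g ≠ c • ψ0
  · obtain ⟨y, hy, hys, hf, hm⟩ := H.rotate h h0 hp hg hn
    have h1 := hl y hy hys hf
    have h2 := hm x hx hxs
    have h3 : 0 ≤ g (p x) / ψ0 (p x) := le_trans (div_nonneg h1 (hp y hy hys).le) h2
    by_contra hneg
    push Not at hneg
    exact absurd h3 (not_le.2 (div_neg_of_neg_of_pos hneg (hp x hx hxs)))
  · push Not at hn
    obtain ⟨c, rfl⟩ := hn
    obtain ⟨y, hy, hys, hf⟩ := H.link_nonempty h hc
    have h1 := hl y hy hys hf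
    simp only [LinearMap.smul_apply, smul_eq_mul] at h1 ⊢
    have := nonneg_of_mul_nonneg_left h1 (hp y hy hys)
    exact mul_nonneg this (hp x hx hxs).le

lemma PolySetup.connected (H : PolySetup V p) {σ : Finset ι} (h : Fc V p σ)
    (hc : σ.card + 3 ≤ Module.finrank ℝ W) (S : ι → Prop)
    (hS : ∃ s ∈ V, s ∉ σ ∧ Fc V p (insert s σ) ∧ S s)
    (hcl : ∀ u ∈ V, ∀ w ∈ V, u ∉ σ → w ∉ σ → u ≠ w → Fc V p (insert u (insert w σ)) → S u → S w) :
    ∀ t ∈ V, t ∉ σ → Fc V p (insert t σ) → S t := by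
  intro t ht hts hft
  obtain ⟨ψ0, h0, hp, -⟩ := H.exact h
  obtain ⟨f, hf0, hfp, -⟩ := H.exact hft
  obtain ⟨s, hs, hss, hsf, hS1⟩ := hS
  obtain ⟨v, hv, hmin⟩ := Finset.exists_min_image
    (V.filter fun s => s ∉ σ ∧ Fc V p (insert s σ) ∧ S s) (fun x => f (p x) / ψ0 (p x))
    ⟨s, by simp [hs, hss, hsf, hS1]⟩
  simp only [Finset.mem_filter] at hv hmin
  obtain ⟨hvV, hvσ, hvF, hvS⟩ := hv
  have hv0 := hp v hvV hvσ
  have hcard : (insert v σ).card + 2 ≤ Module.finrank ℝ W := by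
    rw [Finset.card_insert_of_notMem hvσ]; omega
  have hcl' := H.l2g hvF hcard (g := ψ0 (p v) • f - f (p v) • ψ0) (by
    intro x hx
    rcases Finset.mem_insert.1 hx with rfl | hx
    · simp; ring
    · simp [h0 x hx, hf0 x (Finset.mem_insert_of_mem hx)]) (by
    intro y hy hyn hyF
    have hyσ : y ∉ σ := fun h => hyn (Finset.mem_insert_of_mem h)
    have hyv : y ≠ v := fun h => hyn (by simp [h])
    have h1 : S y := hcl v hvV y hy hvσ hyσ hyv.symm (by rwa [Finset.insert_comm]) hvS
    have h2 := hmin y ⟨hy, hyσ, hyF.mono (Finset.insert_subset_insert _ (Finset.subset_insert _ _)), h1⟩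
    have h3 := hp y hy hyσ
    rw [div_le_div_iff₀ hv0 h3] at h2
    simp only [LinearMap.sub_apply, LinearMap.smul_apply, smul_eq_mul]
    linarith)
  have h1 := hcl' t ht
  simp only [LinearMap.sub_apply, LinearMap.smul_apply, smul_eq_mul,
    hf0 t (Finset.mem_insert_self _ _)] at h1
  have h2 := hp t ht hts
  by_cases hvt : v = t
  · exact hvt ▸ hvS
  · have h3 := hfp v hvV (by simp [hvt, hvσ])
    nlinarith [mul_pos h3 h2]

lemma PolySetup.exists_facet (H : PolySetup V p) {σ : Finset ι} (h : Fc V p σ) :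
    ∃ F, σ ⊆ F ∧ Fc V p F ∧ F.card + 1 = Module.finrank ℝ W := by
  induction hk : Module.finrank ℝ W - σ.card generalizing σ with
  | zero => have := H.card_lt h; omega
  | succ k ih =>
    by_cases hc : σ.card + 2 ≤ Module.finrank ℝ W
    · obtain ⟨y, hy, hys, hf⟩ := H.link_nonempty h hc
      obtain ⟨F, h1, h2, h3⟩ := ih hf (by rw [Finset.card_insert_of_notMem hys]; omega)
      exact ⟨F, (Finset.subset_insert _ _).trans h1, h2, h3⟩
    · have := H.card_lt h
      exact ⟨σ, subset_rfl, h, by omega⟩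

lemma pos_cycle {c0 c1 c2 a01 a02 a10 a12 a20 a21 : ℝ} (h01 : 0 < a01) (h02 : 0 < a02)
    (h10 : 0 < a10) (h12 : 0 < a12) (h20 : 0 < a20) (h21 : 0 < a21)
    (e0 : c1 * a10 + c2 * a20 = 0) (e1 : c0 * a01 + c2 * a21 = 0) (e2 : c0 * a02 + c1 * a12 = 0) :
    c0 = 0 ∧ c1 = 0 ∧ c2 = 0 := by
  have hc2 : c2 = 0 := by
    rcases lt_trichotomy c2 0 with h | h | h
    · have h1 : 0 < c1 := by
        by_contra hh; push Not at hh
        nlinarith [mul_pos (neg_pos.2 h) h20, mul_nonneg (neg_nonneg.2 hh) h10.le]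
      have h2 : 0 < c0 := by
        by_contra hh; push Not at hh
        nlinarith [mul_pos (neg_pos.2 h) h21, mul_nonneg (neg_nonneg.2 hh) h01.le]
      nlinarith [mul_pos h2 h02, mul_pos h1 h12]
    · exact h
    · have h1 : 0 < -c1 := by
        by_contra hh; push Not at hh
        nlinarith [mul_pos h h20, mul_nonneg (neg_nonneg.2 hh) h10.le]
      have h2 : 0 < -c0 := by
        by_contra hh; push Not at hh
        nlinarith [mul_pos h h21, mul_nonneg (neg_nonneg.2 hh) h01.le]
      nlinarith [mul_pos h2 h02, mul_pos h1 h12]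
  subst hc2
  refine ⟨?_, ?_, rfl⟩
  · simpa [h01.ne'] using e1
  · simpa [h10.ne'] using e0

lemma PolySetup.ridge (H : PolySetup V p) {σ : Finset ι} (h : Fc V p σ)
    (hc : σ.card + 2 = Module.finrank ℝ W) :
    (V.filter fun y => y ∉ σ ∧ Fc V p (insert y σ)).card = 2 := by
  apply le_antisymm
  · by_contra hcon
    push Not at hcon
    obtain ⟨a, ha, b, hb, c, hc', hab, hac, hbc⟩ := Finset.two_lt_card.1 hcon
    simp only [Finset.mem_filter] at ha hb hc'
    obtain ⟨haV, haσ, haF⟩ := ha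
    obtain ⟨hbV, hbσ, hbF⟩ := hb
    obtain ⟨hcV, hcσ, hcF⟩ := hc'
    obtain ⟨fa, fa0, fap, -⟩ := H.exact haF
    obtain ⟨fb, fb0, fbp, -⟩ := H.exact hbF
    obtain ⟨fc, fc0, fcp, -⟩ := H.exact hcF
    have := H.card_le h ![fa, fb, fc] (by
      intro i x hx
      fin_cases i
      · exact fa0 x (Finset.mem_insert_of_mem hx)
      · exact fb0 x (Finset.mem_insert_of_mem hx)
      · exact fc0 x (Finset.mem_insert_of_mem hx)) (by
      rw [Fintype.linearIndependent_iff]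
      intro g hg
      simp only [Fin.sum_univ_three, Matrix.cons_val_zero, Matrix.cons_val_one,
        Matrix.cons_val] at hg
      have ea := LinearMap.congr_fun hg (p a)
      have eb := LinearMap.congr_fun hg (p b)
      have ec := LinearMap.congr_fun hg (p c)
      simp only [LinearMap.add_apply, LinearMap.smul_apply, smul_eq_mul, LinearMap.zero_apply,
        fa0 a (Finset.mem_insert_self _ _), fb0 b (Finset.mem_insert_self _ _),
        fc0 c (Finset.mem_insert_self _ _), mul_zero, zero_add, add_zero] at ea eb ec
      have := pos_cycle (fap b hbV (by simp [hab.symm, hbσ])) (fap c hcV (by simp [hac.symm, hcσ]))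
        (fbp a haV (by simp [hab, haσ])) (fbp c hcV (by simp [hbc.symm, hcσ]))
        (fcp a haV (by simp [hac, haσ])) (fcp b hbV (by simp [hbc, hbσ])) ea eb ec
      intro i
      fin_cases i
      · exact this.1
      · exact this.2.1
      · exact this.2.2)
    omega
  · obtain ⟨y, hy, hys, hf⟩ := H.link_nonempty h hc.le
    by_contra hcon
    push Not at hcon
    have honly : ∀ z ∈ V, z ∉ σ → Fc V p (insert z σ) → z = y := by
      intro z hz hzs hzf
      by_contra hzy
      have : ({z, y} : Finset ι) ⊆ V.filter fun y => y ∉ σ ∧ Fc V p (insert y σ) := by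
        intro w hw
        simp only [Finset.mem_insert, Finset.mem_singleton] at hw
        rcases hw with rfl | rfl <;> simp [*]
      have := Finset.card_le_card this
      rw [Finset.card_pair hzy] at this
      omega
    obtain ⟨f, f0, fp, x, hx, hxs⟩ := H.exact hf
    have := H.l2g h hc.le (g := -f) (by
      intro x hx; simp [f0 x (Finset.mem_insert_of_mem hx)]) (by
      intro z hz hzs hzf
      rw [honly z hz hzs hzf]; simp [f0 y (Finset.mem_insert_self _ _)]) x hx
    have h2 := fp x hx hxs
    simp at this
    linarith

/-- Ordered edges of the link of `ρ`. -/
def Ed (V : Finset ι) (p : ι → W) (ρ : Finset ι) (a b : ι) : Prop :=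
  a ∈ V ∧ b ∈ V ∧ a ∉ ρ ∧ b ∉ ρ ∧ a ≠ b ∧ Fc V p (insert a (insert b ρ))

lemma Ed.symm {ρ : Finset ι} {a b : ι} (h : Ed V p ρ a b) : Ed V p ρ b a := by
  obtain ⟨h1, h2, h3, h4, h5, h6⟩ := h
  exact ⟨h2, h1, h4, h3, h5.symm, by rwa [Finset.insert_comm]⟩

lemma Ed.comm {ρ : Finset ι} {a b : ι} : Ed V p ρ a b ↔ Ed V p ρ b a := ⟨Ed.symm, Ed.symm⟩

/-- Vertices of the link of `ρ`. -/
def lk (V : Finset ι) (p : ι → W) (ρ : Finset ι) : Finset ι :=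
  V.filter fun y => y ∉ ρ ∧ Fc V p (insert y ρ)

lemma mem_lk {ρ : Finset ι} {a : ι} : a ∈ lk V p ρ ↔ a ∈ V ∧ a ∉ ρ ∧ Fc V p (insert a ρ) := by
  simp [lk]

lemma Ed.left {ρ : Finset ι} {a b : ι} (h : Ed V p ρ a b) : a ∈ lk V p ρ := by
  obtain ⟨h1, h2, h3, h4, h5, h6⟩ := h
  exact mem_lk.2 ⟨h1, h3, h6.mono (Finset.insert_subset_insert _ (Finset.subset_insert _ _))⟩

lemma Ed.right {ρ : Finset ι} {a b : ι} (h : Ed V p ρ a b) : b ∈ lk V p ρ := h.symm.left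

lemma PolySetup.deg (H : PolySetup V p) {ρ : Finset ι}
    (hc : ρ.card + 3 = Module.finrank ℝ W) {a : ι} (ha : a ∈ lk V p ρ) :
    (V.filter fun b => Ed V p ρ a b).card = 2 := by
  rw [mem_lk] at ha
  obtain ⟨h1, h2, h3⟩ := ha
  rw [← H.ridge h3 (by rw [Finset.card_insert_of_notMem h2]; omega)]
  congr 1
  apply Finset.filter_congr
  intro b hb
  constructor
  · rintro ⟨_, _, _, h4, h5, h6⟩
    exact ⟨by simp [h4, h5.symm], by rwa [Finset.insert_comm]⟩
  · rintro ⟨h4, h5⟩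
    simp only [Finset.mem_insert, not_or] at h4
    exact ⟨h1, hb, h2, h4.2, fun h => h4.1 h.symm, by rwa [Finset.insert_comm]⟩

lemma PolySetup.three (H : PolySetup V p) {ρ : Finset ι} (h : Fc V p ρ)
    (hc : ρ.card + 3 = Module.finrank ℝ W) {g f0 f1 f2 : W →ₗ[ℝ] ℝ} (hg0 : g ≠ 0)
    (hg : ∀ x ∈ ρ, g (p x) = 0) (hf0 : ∀ x ∈ ρ, f0 (p x) = 0) (hf1 : ∀ x ∈ ρ, f1 (p x) = 0)
    (hf2 : ∀ x ∈ ρ, f2 (p x) = 0) (q0 q1 q2 : W) (g0 : g q0 = 0) (g1 : g q1 = 0) (g2 : g q2 = 0)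
    (z0 : f0 q0 = 0) (z1 : f1 q1 = 0) (z2 : f2 q2 = 0)
    (h01 : 0 < f0 q1) (h02 : 0 < f0 q2) (h10 : 0 < f1 q0) (h12 : 0 < f1 q2)
    (h20 : 0 < f2 q0) (h21 : 0 < f2 q1) : False := by
  have := H.card_le h ![f0, f1, f2, g] (by
      intro i x hx
      fin_cases i
      · exact hf0 x hx
      · exact hf1 x hx
      · exact hf2 x hx
      · exact hg x hx) (by
      rw [Fintype.linearIndependent_iff]
      intro c hcc
      simp only [Fin.sum_univ_four, Matrix.cons_val_zero, Matrix.cons_val_one,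
        Matrix.cons_val] at hcc
      have ea := LinearMap.congr_fun hcc q0
      have eb := LinearMap.congr_fun hcc q1
      have ec := LinearMap.congr_fun hcc q2
      simp only [LinearMap.add_apply, LinearMap.smul_apply, smul_eq_mul, LinearMap.zero_apply,
        z0, z1, z2, g0, g1, g2, mul_zero, zero_add, add_zero] at ea eb ec
      obtain ⟨e0, e1, e2⟩ := pos_cycle h01 h02 h10 h12 h20 h21 ea eb ec
      rw [e0, e1, e2] at hcc
      have e3 : c 3 = 0 := by simpa [hg0] using hcc
      intro i
      fin_cases i
      · exact e0
      · exact e1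
      · exact e2
      · exact e3)
  omega

/-- Intersection points of a hyperplane with the link of a codimension three face. -/
def crossItem (V : Finset ι) (p : ι → W) (ρ : Finset ι) (g : W →ₗ[ℝ] ℝ) (x : ι × ι) : Prop :=
  x.1 ∈ V ∧ x.2 ∈ V ∧ x.1 ∉ ρ ∧ x.2 ∉ ρ ∧ Fc V p (insert x.1 (insert x.2 ρ)) ∧
    ((x.1 = x.2 ∧ g (p x.1) = 0) ∨ (g (p x.1) < 0 ∧ 0 < g (p x.2)))

lemma crossItem.data (H : PolySetup V p) {ρ : Finset ι} {g : W →ₗ[ℝ] ℝ} {x : ι × ι}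
    (hx : crossItem V p ρ g x) : ∃ f : W →ₗ[ℝ] ℝ, ∃ α β : ℝ, 0 < α ∧ 0 < β ∧
      (∀ y ∈ ρ, f (p y) = 0) ∧ g (α • p x.1 + β • p x.2) = 0 ∧ f (α • p x.1 + β • p x.2) = 0 ∧
      (∀ y ∈ V, 0 ≤ f (p y)) ∧
      ∀ y ∈ V, y ∉ ρ → y ≠ x.1 → y ≠ x.2 → 0 < f (p y) := by
  obtain ⟨h1, h2, h3, h4, h5, h6⟩ := hx
  obtain ⟨f, f0, fp, -⟩ := H.exact h5
  have hα : ∃ α β : ℝ, 0 < α ∧ 0 < β ∧ g (α • p x.1 + β • p x.2) = 0 := by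
    rcases h6 with ⟨h6, h7⟩ | ⟨h6, h7⟩
    · exact ⟨1, 1, one_pos, one_pos, by rw [← h6]; simp [h7]⟩
    · exact ⟨g (p x.2), -g (p x.1), h7, by linarith, by simp; ring⟩
  obtain ⟨α, β, hα, hβ, hg⟩ := hα
  refine ⟨f, α, β, hα, hβ, fun y hy => f0 y (by simp [hy]), hg, ?_, fun y hy => ?_, ?_⟩
  · simp [f0 x.1 (by simp), f0 x.2 (by simp)]
  · by_cases hyi : y ∈ insert x.1 (insert x.2 ρ)
    · exact (f0 y hyi).ge
    · exact (fp y hy hyi).le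
  · intro y hy hyρ hy1 hy2
    exact fp y hy (by simp [hy1, hy2, hyρ])

lemma crossItem.sep {ρ : Finset ι} {g f : W →ₗ[ℝ] ℝ} {x y : ι × ι}
    (hx : crossItem V p ρ g x) (hy : crossItem V p ρ g y) (hxy : x ≠ y)
    (hf : ∀ y ∈ V, 0 ≤ f (p y))
    (hfp : ∀ y ∈ V, y ∉ ρ → y ≠ x.1 → y ≠ x.2 → 0 < f (p y)) {α β : ℝ} (hα : 0 < α) (hβ : 0 < β) :
    0 < f (α • p y.1 + β • p y.2) := by
  simp only [map_add, map_smul, smul_eq_mul]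
  obtain ⟨h1, h2, h3, h4, -, h6⟩ := hx
  obtain ⟨k1, k2, k3, k4, -, k6⟩ := hy
  have hcase : (y.1 ≠ x.1 ∧ y.1 ≠ x.2) ∨ (y.2 ≠ x.1 ∧ y.2 ≠ x.2) := by
    by_contra hcon
    obtain ⟨x1, x2⟩ := x
    obtain ⟨y1, y2⟩ := y
    simp only [ne_eq, Prod.mk.injEq] at *
    have e1 : y1 = x1 ∨ y1 = x2 := by tauto
    have e2 : y2 = x1 ∨ y2 = x2 := by tauto
    rcases h6 with ⟨h6, h7⟩ | ⟨h6, h7⟩ <;> rcases k6 with ⟨k6, k7⟩ | ⟨k6, k7⟩ <;>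
    rcases e1 with rfl | rfl <;> rcases e2 with rfl | rfl <;> first
      | (subst h6; simp at hxy; done) | (simp at hxy; done) | linarith
  rcases hcase with hh | hh
  · have := mul_pos hα (hfp _ k1 k3 hh.1 hh.2)
    have := mul_nonneg hβ.le (hf _ k2)
    linarith
  · have := mul_nonneg hα.le (hf _ k1)
    have := mul_pos hβ (hfp _ k2 k4 hh.1 hh.2)
    linarith

lemma PolySetup.crossItem_card (H : PolySetup V p) {ρ : Finset ι} (h : Fc V p ρ)
    (hc : ρ.card + 3 = Module.finrank ℝ W) {g : W →ₗ[ℝ] ℝ} (hg0 : g ≠ 0)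
    (hg : ∀ x ∈ ρ, g (p x) = 0) (K : Finset (ι × ι)) (hK : ∀ x ∈ K, crossItem V p ρ g x) :
    K.card ≤ 2 := by
  by_contra hcon
  push Not at hcon
  obtain ⟨x, hx, y, hy, z, hz, hxy, hxz, hyz⟩ := Finset.two_lt_card.1 hcon
  replace hx := hK x hx
  replace hy := hK y hy
  replace hz := hK z hz
  obtain ⟨fx, αx, βx, ax, bx, x1, x2, x3, x4, x5⟩ := hx.data H
  obtain ⟨fy, αy, βy, ay, ÿ, y1, y2, y3, y4, y5⟩ := hy.data H
  obtain ⟨fz, αz, βz, az, bz, z1, z2, z3, z4, z5⟩ := hz.data H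
  exact H.three h hc hg0 hg x1 y1 z1 _ _ _ x2 y2 z2 x3 y3 z3
    (hx.sep hy hxy x4 x5 ay ÿ) (hx.sep hz hxz x4 x5 az bz)
    (hy.sep hx hxy.symm y4 y5 ax bx) (hy.sep hz hyz y4 y5 az bz)
    (hz.sep hx hxz.symm z4 z5 ax bx) (hz.sep hy hyz.symm z4 z5 ay ÿ)

/-- Crossing edges. -/
def crs (V : Finset ι) (p : ι → W) (ρ : Finset ι) (g : W →ₗ[ℝ] ℝ) : Finset (ι × ι) :=
  (V ×ˢ V).filter fun x => Ed V p ρ x.1 x.2 ∧ g (p x.1) < 0 ∧ 0 < g (p x.2)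

lemma mem_crs {ρ : Finset ι} {g : W →ₗ[ℝ] ℝ} {x : ι × ι} :
    x ∈ crs V p ρ g ↔ Ed V p ρ x.1 x.2 ∧ g (p x.1) < 0 ∧ 0 < g (p x.2) := by
  simp only [crs, Finset.mem_filter, Finset.mem_product, and_iff_right_iff_imp]
  rintro ⟨h, -⟩
  exact ⟨h.1, h.2.1⟩

lemma PolySetup.zero_cross (H : PolySetup V p) {ρ : Finset ι} (h : Fc V p ρ)
    (hc : ρ.card + 3 = Module.finrank ℝ W) {g : W →ₗ[ℝ] ℝ} (hg0 : g ≠ 0)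
    (hg : ∀ x ∈ ρ, g (p x) = 0) :
    ((lk V p ρ).filter fun a => g (p a) = 0).card + (crs V p ρ g).card ≤ 2 := by
  have hd : Disjoint (((lk V p ρ).filter fun a => g (p a) = 0).image fun a => (a, a))
      (crs V p ρ g) := by
    rw [Finset.disjoint_left]
    intro x hx hx2
    simp only [Finset.mem_image, Finset.mem_filter] at hx
    obtain ⟨a, ⟨_, ha⟩, rfl⟩ := hx
    have := (mem_crs.1 hx2).2.1
    simp only at this
    linarith
  rw [← Finset.card_image_of_injective _ (show Function.Injective fun a : ι => (a, a) from
    fun a b hab => (Prod.ext_iff.1 hab).1), ← Finset.card_union_of_disjoint hd]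
  apply H.crossItem_card h hc hg0 hg
  intro x hx
  rcases Finset.mem_union.1 hx with hx | hx
  · simp only [Finset.mem_image, Finset.mem_filter] at hx
    obtain ⟨a, ⟨ha, ha0⟩, rfl⟩ := hx
    obtain ⟨h1, h2, h3⟩ := mem_lk.1 ha
    exact ⟨h1, h1, h2, h2, by simpa using h3, Or.inl ⟨rfl, ha0⟩⟩
  · obtain ⟨⟨h1, h2, h3, h4, h5, h6⟩, h7, h8⟩ := mem_crs.1 hx
    exact ⟨h1, h2, h3, h4, h6, Or.inr ⟨h7, h8⟩⟩

/-- Corner weight. -/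
def cw (g : W →ₗ[ℝ] ℝ) (u v : W) : ℕ :=
  (if g u = 0 then 1 else 0) + (if g v = 0 then 1 else 0) +
    ((if g u < 0 ∧ 0 < g v then 2 else 0) + (if g v < 0 ∧ 0 < g u then 2 else 0))

lemma PolySetup.wsum (H : PolySetup V p) {ρ : Finset ι} (h : Fc V p ρ)
    (hc : ρ.card + 3 = Module.finrank ℝ W) {g : W →ₗ[ℝ] ℝ} (hg0 : g ≠ 0)
    (hg : ∀ x ∈ ρ, g (p x) = 0) :
    ∑ a ∈ V, ∑ b ∈ V, (if Ed V p ρ a b then cw g (p a) (p b) else 0) ≤ 8 := by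
  have hz := H.zero_cross h hc hg0 hg
  have e1 : ∑ a ∈ V, ∑ b ∈ V, (if Ed V p ρ a b then (if g (p a) = 0 then 1 else 0) else 0)
      = 2 * ((lk V p ρ).filter fun a => g (p a) = 0).card := by
    rw [Finset.card_filter, Finset.mul_sum, ← Finset.sum_subset (s₁ := lk V p ρ) (s₂ := V)
      (Finset.filter_subset _ _)]
    · apply Finset.sum_congr rfl
      intro a ha
      rw [← H.deg hc ha, Finset.card_filter, Finset.sum_mul]
      apply Finset.sum_congr rfl
      intro b hb
      split_ifs <;> simp
    · intro a ha hna
      apply Finset.sum_eq_zero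
      intro b hb
      rw [if_neg]
      intro h; exact hna h.left
  have e3 : ∑ a ∈ V, ∑ b ∈ V, (if Ed V p ρ a b then (if g (p a) < 0 ∧ 0 < g (p b) then 2 else 0)
      else 0) = 2 * (crs V p ρ g).card := by
    rw [crs, Finset.card_filter, Finset.mul_sum, Finset.sum_product]
    apply Finset.sum_congr rfl
    intro a ha
    apply Finset.sum_congr rfl
    intro b hb
    by_cases h1 : Ed V p ρ a b <;> by_cases h2 : g (p a) < 0 ∧ 0 < g (p b) <;> simp [h1, h2]
  have e2 : ∑ a ∈ V, ∑ b ∈ V, (if Ed V p ρ a b then (if g (p b) = 0 then 1 else 0) else 0)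
      = 2 * ((lk V p ρ).filter fun a => g (p a) = 0).card := by
    rw [← e1, Finset.sum_comm]
    simp only [Ed.comm]
  have e4 : ∑ a ∈ V, ∑ b ∈ V, (if Ed V p ρ a b then (if g (p b) < 0 ∧ 0 < g (p a) then 2 else 0)
      else 0) = 2 * (crs V p ρ g).card := by
    rw [← e3, Finset.sum_comm]
    apply Finset.sum_congr rfl
    intro a ha
    apply Finset.sum_congr rfl
    intro b hb
    rw [Ed.comm]
  have : ∑ a ∈ V, ∑ b ∈ V, (if Ed V p ρ a b then cw g (p a) (p b) else 0) =
      (2 * ((lk V p ρ).filter fun a => g (p a) = 0).card +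
       2 * ((lk V p ρ).filter fun a => g (p a) = 0).card) +
       (2 * (crs V p ρ g).card + 2 * (crs V p ρ g).card) := by
    conv_rhs => lhs; lhs; rw [← e1]
    conv_rhs => lhs; rhs; rw [← e2]
    conv_rhs => rhs; lhs; rw [← e3]
    conv_rhs => rhs; rhs; rw [← e4]
    simp only [← Finset.sum_add_distrib]
    apply Finset.sum_congr rfl
    intro a ha
    apply Finset.sum_congr rfl
    intro b hb
    by_cases h1 : Ed V p ρ a b
    · simp only [h1, if_true, cw]
    · simp [h1]
  omega

lemma even_sym {α : Type} (s : Finset (α × α)) (hs : ∀ x ∈ s, x.swap ∈ s)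
    (hi : ∀ x ∈ s, x.1 ≠ x.2) : Even s.card := by
  have : ∑ x ∈ s, (1 : ZMod 2) = 0 := by
    apply Finset.sum_involution (fun x _ => x.swap)
    · intro x hx; decide
    · intro x hx _ h
      exact hi x hx (Prod.ext_iff.1 h).2
    · intro x hx; exact Prod.swap_swap x
    · exact hs
  rw [Finset.sum_const, nsmul_one] at this
  exact (ZMod.natCast_eq_zero_iff_even).1 this

lemma PolySetup.two_le_crs (H : PolySetup V p) {ρ : Finset ι} (h : Fc V p ρ)
    (hc : ρ.card + 3 = Module.finrank ℝ W) {g : W →ₗ[ℝ] ℝ}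
    (hg : ∀ x ∈ ρ, g (p x) = 0) (hnz : ∀ a ∈ lk V p ρ, g (p a) ≠ 0)
    (hpos : ∃ x ∈ V, 0 < g (p x)) (hneg : ∃ x ∈ V, g (p x) < 0) : 2 ≤ (crs V p ρ g).card := by
  have hneg' : ∃ a ∈ lk V p ρ, g (p a) < 0 := by
    by_contra hcon
    push Not at hcon
    obtain ⟨x, hx, hx0⟩ := hneg
    have := H.l2g h (by omega) hg (fun y hy hys hyf => hcon y (mem_lk.2 ⟨hy, hys, hyf⟩)) x hx
    linarith
  have hpos' : ∃ a ∈ lk V p ρ, 0 < g (p a) := by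
    by_contra hcon
    push Not at hcon
    obtain ⟨x, hx, hx0⟩ := hpos
    have := H.l2g h (by omega) (g := -g) (fun x hx => by simp [hg x hx])
      (fun y hy hys hyf => by simpa using hcon y (mem_lk.2 ⟨hy, hys, hyf⟩)) x hx
    simp at this
    linarith
  have hne : (crs V p ρ g).card ≠ 0 := by
    intro h0
    rw [Finset.card_eq_zero] at h0
    obtain ⟨a, ha, ha0⟩ := hneg'
    obtain ⟨b, hb, hb0⟩ := hpos'
    obtain ⟨a1, a2, a3⟩ := mem_lk.1 ha
    obtain ⟨b1, b2, b3⟩ := mem_lk.1 hb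
    have := H.connected h (by omega) (fun x => g (p x) < 0) ⟨a, a1, a2, a3, ha0⟩ (by
      intro u hu w hw huρ hwρ huw hF hu0
      have hE : Ed V p ρ u w := ⟨hu, hw, huρ, hwρ, huw, hF⟩
      by_contra hw0
      have hw1 : 0 < g (p w) := lt_of_le_of_ne (not_lt.1 hw0) (hnz w hE.right).symm
      have : (u, w) ∈ crs V p ρ g := mem_crs.2 ⟨hE, hu0, hw1⟩
      rw [h0] at this
      simp at this) b b1 b2 b3
    linarith
  have hev : Even (crs V p ρ g).card := by
    have hE : Even (((V ×ˢ V).filter fun x => Ed V p ρ x.1 x.2 ∧ g (p x.1) < 0 ∧ g (p x.2) < 0)).card := by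
      apply even_sym
      · intro x hx
        simp only [Finset.mem_filter, Finset.mem_product, Prod.fst_swap, Prod.snd_swap] at hx ⊢
        exact ⟨hx.1.symm, hx.2.1.symm, hx.2.2.2, hx.2.2.1⟩
      · intro x hx
        simp only [Finset.mem_filter] at hx
        exact hx.2.1.2.2.2.2.1
    have hsum : 2 * ((lk V p ρ).filter fun a => g (p a) < 0).card =
        (((V ×ˢ V).filter fun x => Ed V p ρ x.1 x.2 ∧ g (p x.1) < 0 ∧ g (p x.2) < 0)).card +
        (crs V p ρ g).card := by
      rw [crs, Finset.card_filter, Finset.card_filter, Finset.card_filter, Finset.mul_sum,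
        Finset.sum_product, Finset.sum_product, ← Finset.sum_add_distrib,
        ← Finset.sum_subset (s₁ := lk V p ρ) (s₂ := V) (Finset.filter_subset _ _)]
      · apply Finset.sum_congr rfl
        intro a ha
        rw [← H.deg hc ha, Finset.card_filter, Finset.sum_mul, ← Finset.sum_add_distrib]
        apply Finset.sum_congr rfl
        intro b hb
        by_cases h1 : Ed V p ρ a b
        · have := hnz b h1.right
          rcases lt_or_gt_of_ne this with h2 | h2
          · simp [h1, h2, not_lt.2 h2.le]
          · simp [h1, h2, not_lt.2 h2.le]
        · simp [h1]
      · intro a ha hna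
        rw [← Finset.sum_add_distrib]
        apply Finset.sum_eq_zero
        intro b hb
        have : ¬ Ed V p ρ a b := fun h => hna h.left
        simp [this]
    obtain ⟨r, hr⟩ := hE
    rw [Nat.even_iff]
    omega
  obtain ⟨r, hr⟩ := hev
  omega

/-- Ordered triangles of the link of `τ`. -/
def Tr (V : Finset ι) (p : ι → W) (τ : Finset ι) (v a b : ι) : Prop :=
  v ∈ V ∧ a ∈ V ∧ b ∈ V ∧ v ∉ τ ∧ a ∉ τ ∧ b ∉ τ ∧ v ≠ a ∧ v ≠ b ∧ a ≠ b ∧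
    Fc V p (insert v (insert a (insert b τ)))

lemma Tr.swap12 {τ : Finset ι} {v a b : ι} (h : Tr V p τ v a b) : Tr V p τ a v b := by
  obtain ⟨h1, h2, h3, h4, h5, h6, h7, h8, h9, h10⟩ := h
  exact ⟨h2, h1, h3, h5, h4, h6, h7.symm, h9, h8, by rwa [Finset.insert_comm]⟩

lemma Tr.swap23 {τ : Finset ι} {v a b : ι} (h : Tr V p τ v a b) : Tr V p τ v b a := by
  obtain ⟨h1, h2, h3, h4, h5, h6, h7, h8, h9, h10⟩ := h
  exact ⟨h1, h3, h2, h4, h6, h5, h8, h7, h9.symm, by rwa [Finset.insert_comm b a]⟩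

lemma Tr.ed {τ : Finset ι} {v a b : ι} (h : Tr V p τ v a b) : Ed V p (insert v τ) a b := by
  obtain ⟨h1, h2, h3, h4, h5, h6, h7, h8, h9, h10⟩ := h
  refine ⟨h2, h3, by simp [h7.symm, h5], by simp [h8.symm, h6], h9, ?_⟩
  rwa [Finset.insert_comm b v, Finset.insert_comm a v]

lemma Tr.ed' {τ : Finset ι} {v a b : ι} (h : Tr V p τ v a b) : Ed V p τ v a := by
  obtain ⟨h1, h2, h3, h4, h5, h6, h7, h8, h9, h10⟩ := h
  refine ⟨h1, h2, h4, h5, h7, h10.mono ?_⟩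
  exact Finset.insert_subset_insert _ (Finset.insert_subset_insert _ (Finset.subset_insert _ _))

lemma Tr.lk1 {τ : Finset ι} {v a b : ι} (h : Tr V p τ v a b) : v ∈ lk V p τ := h.ed'.left
lemma Tr.lk2 {τ : Finset ι} {v a b : ι} (h : Tr V p τ v a b) : a ∈ lk V p τ := h.ed'.right
lemma Tr.lk3 {τ : Finset ι} {v a b : ι} (h : Tr V p τ v a b) : b ∈ lk V p τ := h.swap23.lk2

lemma Tr.of {τ : Finset ι} {v a b : ι} (hv : v ∈ lk V p τ) (h : Ed V p (insert v τ) a b) :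
    Tr V p τ v a b := by
  obtain ⟨h1, h2, -⟩ := mem_lk.1 hv
  obtain ⟨k1, k2, k3, k4, k5, k6⟩ := h
  simp only [Finset.mem_insert, not_or] at k3 k4
  refine ⟨h1, k1, k2, h2, k3.2, k4.2, Ne.symm k3.1, Ne.symm k4.1, k5, ?_⟩
  rwa [Finset.insert_comm v a, Finset.insert_comm v b]

lemma tr_iff {τ : Finset ι} {v a b : ι} :
    Tr V p τ v a b ↔ v ∈ lk V p τ ∧ Ed V p (insert v τ) a b :=
  ⟨fun h => ⟨h.lk1, h.ed⟩, fun h => Tr.of h.1 h.2⟩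

lemma PolySetup.exists_boundary (H : PolySetup V p) {τ : Finset ι} (hτ : Fc V p τ)
    (hc : τ.card + 4 = Module.finrank ℝ W) (Z : ι → Prop)
    (hZ : ∃ a b c, Tr V p τ a b c ∧ Z a ∧ Z b ∧ Z c) (hy : ∃ y ∈ lk V p τ, ¬ Z y) :
    ∃ a b c x, Tr V p τ a b c ∧ Tr V p τ a b x ∧ Z a ∧ Z b ∧ Z c ∧ ¬ Z x := by
  by_contra hcon
  push Not at hcon
  have key : ∀ v u u', Tr V p τ v u u' → Z v → Z u → Z u' → ∀ w ∈ lk V p (insert v τ),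
      ∃ w', Tr V p τ v w w' ∧ Z w ∧ Z w' := by
    intro v u u' hT hv hu hu' w hw
    obtain ⟨w1, w2, w3⟩ := mem_lk.1 hw
    have hvl := hT.lk1
    obtain ⟨v1, v2, v3⟩ := mem_lk.1 hvl
    obtain ⟨u1, u2, u3⟩ := mem_lk.1 hT.ed.left
    refine H.connected v3 (by rw [Finset.card_insert_of_notMem v2]; omega)
      (fun w => ∃ w', Tr V p τ v w w' ∧ Z w ∧ Z w') ⟨u, u1, u2, u3, u', hT, hu, hu'⟩ ?_ w w1 w2 w3
    rintro s hs t ht hsv htv hst hF ⟨s', hs', hZs, hZs'⟩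
    have hT2 : Tr V p τ v s t := Tr.of hvl ⟨hs, ht, hsv, htv, hst, hF⟩
    exact ⟨s, hT2.swap23, hcon v s s' t hs' hT2 hv hZs hZs', hZs⟩
  obtain ⟨y, hyl, hyZ⟩ := hy
  obtain ⟨a, b, c, hT, ha, hb, hc'⟩ := hZ
  obtain ⟨y1, y2, y3⟩ := mem_lk.1 hyl
  obtain ⟨a1, a2, a3⟩ := mem_lk.1 hT.lk1
  have := H.connected hτ (by omega) (fun v => ∃ u u', Tr V p τ v u u' ∧ Z v ∧ Z u ∧ Z u')
    ⟨a, a1, a2, a3, b, c, hT, ha, hb, hc'⟩ (by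
    rintro v hv w hw hvτ hwτ hvw hF ⟨u, u', hT, hZv, hZu, hZu'⟩
    obtain ⟨w', hT', hw1, hw2⟩ := key v u u' hT hZv hZu hZu' w (mem_lk.2
      ⟨hw, by simp [hwτ, hvw.symm], by rwa [Finset.insert_comm]⟩)
    exact ⟨v, w', hT'.swap12, hw1, hZv, hw2⟩) y y1 y2 y3
  obtain ⟨u, u', -, h, -⟩ := this
  exact hyZ h

lemma generic_exists {E κ : Type} [AddCommGroup E] [Module ℝ E] (s : Finset κ)
    (L : κ → E →ₗ[ℝ] ℝ) (hL : ∀ i ∈ s, L i ≠ 0) (t : Finset κ)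
    (M : κ → E →ₗ[ℝ] ℝ) (ψ1 : E) (hM : ∀ j ∈ t, 0 < M j ψ1) :
    ∃ ψ : E, (∀ i ∈ s, L i ψ ≠ 0) ∧ ∀ j ∈ t, 0 < M j ψ := by
  induction s using Finset.induction_on with
  | empty => exact ⟨ψ1, by simp, hM⟩
  | insert i s hi ih =>
    obtain ⟨ψ, h1, h2⟩ := ih fun j hj => hL j (Finset.mem_insert_of_mem hj)
    by_cases h0 : L i ψ = 0
    swap
    · refine ⟨ψ, fun j hj => ?_, h2⟩
      rcases Finset.mem_insert.1 hj with rfl | hj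
      · exact h0
      · exact h1 j hj
    have : ∃ φ, L i φ ≠ 0 := by
      by_contra hcon
      push Not at hcon
      exact hL i (Finset.mem_insert_self _ _) (LinearMap.ext hcon)
    obtain ⟨φ, hφ⟩ := this
    have e1 : ∀ᶠ ε in nhdsWithin (0:ℝ) (Set.Ioi 0), ∀ j ∈ s, L j ψ + ε * L j φ ≠ 0 := by
      rw [Filter.eventually_all_finset]
      intro j hj
      apply Filter.Eventually.filter_mono nhdsWithin_le_nhds
      have hc : ContinuousAt (fun ε : ℝ => L j ψ + ε * L j φ) 0 := by fun_prop
      exact hc.eventually_ne (by simpa using h1 j hj)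
    have e2 : ∀ᶠ ε in nhdsWithin (0:ℝ) (Set.Ioi 0), ∀ j ∈ t, 0 < M j ψ + ε * M j φ := by
      rw [Filter.eventually_all_finset]
      intro j hj
      apply Filter.Eventually.filter_mono nhdsWithin_le_nhds
      have hc : ContinuousAt (fun ε : ℝ => M j ψ + ε * M j φ) 0 := by fun_prop
      exact hc.eventually (lt_mem_nhds (a := 0) (b := M j ψ + 0 * M j φ) (by simpa using h2 j hj))
    obtain ⟨ε, hε1, hε2, hε3⟩ := (e1.and (e2.and self_mem_nhdsWithin)).exists
    refine ⟨ψ + ε • φ, fun j hj => ?_, fun j hj => by simpa using hε2 j hj⟩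
    rcases Finset.mem_insert.1 hj with rfl | hj
    · simp only [map_add, map_smul, h0, zero_add, smul_eq_mul]
      exact mul_ne_zero (ne_of_gt hε3) hφ
    · simpa using hε1 j hj

lemma PolySetup.exists_height (H : PolySetup V p) {τ : Finset ι}
    {ψ0 : W →ₗ[ℝ] ℝ} (h0 : ∀ x ∈ τ, ψ0 (p x) = 0) (hp : ∀ x ∈ V, x ∉ τ → 0 < ψ0 (p x))
    {a b c x : ι} (hT : Tr V p τ a b c) (hT2 : Tr V p τ a b x) (hcx : c ≠ x) :
    ∃ ψ : W →ₗ[ℝ] ℝ, (∀ y ∈ τ, ψ (p y) = 0) ∧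
      (∀ u ∈ lk V p τ, ∀ v ∈ lk V p τ, u ≠ v → ψ (p u) / ψ0 (p u) ≠ ψ (p v) / ψ0 (p v)) ∧
      ψ (p b) / ψ0 (p b) < ψ (p a) / ψ0 (p a) ∧ ψ (p a) / ψ0 (p a) < ψ (p c) / ψ0 (p c) ∧
      ψ (p a) / ψ0 (p a) < ψ (p x) / ψ0 (p x) := by
  have hpl : ∀ u ∈ lk V p τ, 0 < ψ0 (p u) := fun u hu => hp u (mem_lk.1 hu).1 (mem_lk.1 hu).2.1
  obtain ⟨fc, fc0, fcp, -⟩ := H.exact hT.2.2.2.2.2.2.2.2.2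
  obtain ⟨fx, fx0, fxp, -⟩ := H.exact hT2.2.2.2.2.2.2.2.2.2
  obtain ⟨fb, fb0, fbp, -⟩ := H.exact (mem_lk.1 hT.lk2).2.2
  obtain ⟨a1, b1, c1, a2, b2, c2, hab, hac, hbc, -⟩ := hT
  obtain ⟨-, -, x1, -, -, x2, -, hax, hbx, -⟩ := hT2
  have pa := hp a a1 a2
  have pb := hp b b1 b2
  have pc := hp c c1 c2
  have px := hp x x1 x2
  have k1 : 0 < fc (p x) := fcp x x1 (by simp [hax.symm, hbx.symm, hcx.symm, x2])
  have k2 : 0 < fx (p c) := fxp c c1 (by simp [hac.symm, hbc.symm, hcx, c2])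
  have k3 : 0 < fb (p a) := fbp a a1 (by simp [hab, a2])
  have k4 : 0 < fb (p c) := fbp c c1 (by simp [hbc.symm, c2])
  have k5 : 0 < fb (p x) := fbp x x1 (by simp [hbx.symm, x2])
  have z1 : fc (p a) = 0 := fc0 a (by simp)
  have z2 : fc (p b) = 0 := fc0 b (by simp)
  have z3 : fc (p c) = 0 := fc0 c (by simp)
  have z4 : fx (p a) = 0 := fx0 a (by simp)
  have z5 : fx (p b) = 0 := fx0 b (by simp)
  have z6 : fx (p x) = 0 := fx0 x (by simp)
  have z7 : fb (p b) = 0 := fb0 b (by simp)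
  -- the unperturbed height
  let ψ1 : W →ₗ[ℝ] ℝ := fb + (fb (p a) * ψ0 (p x) / (fc (p x) * ψ0 (p a))) • fc
    + (fb (p a) * ψ0 (p c) / (fx (p c) * ψ0 (p a))) • fx
  have hψ1 : ∀ y ∈ τ, ψ1 (p y) = 0 := by
    intro y hy
    simp [ψ1, fb0 y (by simp [hy]), fc0 y (by simp [hy]), fx0 y (by simp [hy])]
  let ev : W → (Ann p τ →ₗ[ℝ] ℝ) := fun w => (Module.Dual.eval ℝ W w) ∘ₗ (Ann p τ).subtype
  have hev : ∀ w (f : Ann p τ), ev w f = (f : W →ₗ[ℝ] ℝ) w := fun w f => rfl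
  let L : ι × ι → (Ann p τ →ₗ[ℝ] ℝ) := fun u => ev (ψ0 (p u.2) • p u.1 - ψ0 (p u.1) • p u.2)
  have hLv : ∀ u (f : Ann p τ), L u f =
      ψ0 (p u.2) * (f : W →ₗ[ℝ] ℝ) (p u.1) - ψ0 (p u.1) * (f : W →ₗ[ℝ] ℝ) (p u.2) := by
    intro u f
    simp only [L, hev, map_sub, map_smul, smul_eq_mul]
  have hlt : ∀ u v (f : Ann p τ), 0 < ψ0 (p u) → 0 < ψ0 (p v) → 0 < L (u, v) f →
      (f : W →ₗ[ℝ] ℝ) (p v) / ψ0 (p v) < (f : W →ₗ[ℝ] ℝ) (p u) / ψ0 (p u) := by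
    intro u v f hu hv h
    rw [hLv] at h
    rw [div_lt_div_iff₀ hv hu]
    simp only at h
    linarith
  obtain ⟨ψ, hψ, hψM⟩ := generic_exists
    (((lk V p τ) ×ˢ (lk V p τ)).filter fun u => u.1 ≠ u.2) L (by
      intro u hu hL0
      simp only [Finset.mem_filter, Finset.mem_product] at hu
      obtain ⟨f, f0, fp, -⟩ := H.exact (mem_lk.1 hu.1.2).2.2
      have := LinearMap.congr_fun hL0 (⟨f, mem_Ann.2 fun y hy => f0 y (by simp [hy])⟩ : Ann p τ)
      rw [hLv] at this
      simp only [LinearMap.zero_apply] at this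
      rw [f0 u.2 (by simp)] at this
      have h1 := fp u.1 (mem_lk.1 hu.1.1).1 (by simp [hu.2, (mem_lk.1 hu.1.1).2.1])
      have h2 := hpl _ hu.1.2
      have := mul_pos h2 h1
      linarith)
    {(a, b), (c, a), (x, a)} L (⟨ψ1, mem_Ann.2 hψ1⟩ : Ann p τ) (by
      intro u hu
      rw [hLv]
      simp only [Finset.mem_insert, Finset.mem_singleton] at hu
      rcases hu with rfl | rfl | rfl
      · simp [ψ1, z1, z2, z4, z5, z7, pb, k3]
      · simp only [ψ1, LinearMap.add_apply, LinearMap.smul_apply, smul_eq_mul, z1, z3, z4]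
        have : ψ0 (p a) * (fb (p a) * ψ0 (p c) / (fx (p c) * ψ0 (p a)) * fx (p c))
          = fb (p a) * ψ0 (p c) := by field_simp
        nlinarith [mul_pos pa k4]
      · simp only [ψ1, LinearMap.add_apply, LinearMap.smul_apply, smul_eq_mul, z1, z4, z6]
        have : ψ0 (p a) * (fb (p a) * ψ0 (p x) / (fc (p x) * ψ0 (p a)) * fc (p x))
          = fb (p a) * ψ0 (p x) := by field_simp
        nlinarith [mul_pos pa k5])
  refine ⟨ψ, mem_Ann.1 ψ.2, ?_, ?_, ?_, ?_⟩
  · intro u hu v hv huv heq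
    have := hψ (u, v) (by simp [hu, hv, huv])
    rw [hLv] at this
    rw [div_eq_div_iff (hpl u hu).ne' (hpl v hv).ne'] at heq
    apply this
    simp only
    linarith
  · exact hlt _ _ _ pa pb (hψM _ (by simp))
  · exact hlt _ _ _ pc pa (hψM _ (by simp))
  · exact hlt _ _ _ px pa (hψM _ (by simp))

/-- Sum over ordered triangles. -/
def tsm (V : Finset ι) (p : ι → W) (τ : Finset ι) (φ : ι → ι → ι → ℕ) : ℕ :=
  ∑ v ∈ V, ∑ a ∈ V, ∑ b ∈ V, if Tr V p τ v a b then φ v a b else 0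

lemma tsm_swap12 (τ : Finset ι) (φ : ι → ι → ι → ℕ) :
    tsm V p τ φ = tsm V p τ (fun v a b => φ a v b) := by
  unfold tsm
  rw [Finset.sum_comm]
  refine Finset.sum_congr rfl fun v _ => Finset.sum_congr rfl fun a _ =>
    Finset.sum_congr rfl fun b _ => ?_
  have : Tr V p τ a v b ↔ Tr V p τ v a b := ⟨Tr.swap12, Tr.swap12⟩
  simp only [this]

lemma tsm_swap23 (τ : Finset ι) (φ : ι → ι → ι → ℕ) :
    tsm V p τ φ = tsm V p τ (fun v a b => φ v b a) := by
  unfold tsm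
  refine Finset.sum_congr rfl fun v _ => ?_
  rw [Finset.sum_comm]
  refine Finset.sum_congr rfl fun a _ => Finset.sum_congr rfl fun b _ => ?_
  have : Tr V p τ v b a ↔ Tr V p τ v a b := ⟨Tr.swap23, Tr.swap23⟩
  simp only [this]

lemma tsm_rot (τ : Finset ι) (φ : ι → ι → ι → ℕ) :
    tsm V p τ φ = tsm V p τ (fun v a b => φ a b v) := by
  rw [tsm_swap23, tsm_swap12]

lemma tsm_add (τ : Finset ι) (φ χ : ι → ι → ι → ℕ) :
    tsm V p τ φ + tsm V p τ χ = tsm V p τ (fun v a b => φ v a b + χ v a b) := by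
  unfold tsm
  simp only [← Finset.sum_add_distrib]
  refine Finset.sum_congr rfl fun v _ => Finset.sum_congr rfl fun a _ =>
    Finset.sum_congr rfl fun b _ => ?_
  split_ifs <;> simp

lemma tsm_mono (τ : Finset ι) {φ χ : ι → ι → ι → ℕ}
    (h : ∀ v a b, Tr V p τ v a b → φ v a b ≤ χ v a b) : tsm V p τ φ ≤ tsm V p τ χ := by
  unfold tsm
  refine Finset.sum_le_sum fun v _ => Finset.sum_le_sum fun a _ =>
    Finset.sum_le_sum fun b _ => ?_
  split_ifs with hT
  · exact h v a b hT
  · exact le_rfl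

lemma tsm_sym (τ : Finset ι) (h : ι → ℝ)
    (hinj : ∀ u ∈ lk V p τ, ∀ v ∈ lk V p τ, u ≠ v → h u ≠ h v) (χ : ι → ι → ι → ℕ)
    (s12 : ∀ v a b, χ a v b = χ v a b) (s23 : ∀ v a b, χ v b a = χ v a b) :
    6 * tsm V p τ (fun v a b => if h a < h v ∧ h v < h b then χ v a b else 0) =
      tsm V p τ χ := by
  set φ : ι → ι → ι → ℕ := fun v a b => if h a < h v ∧ h v < h b then χ v a b else 0 with hφ
  have e1 := tsm_rot (V := V) (p := p) τ φ
  have e2 := tsm_rot (V := V) (p := p) τ (fun v a b => φ a b v)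
  have e3 := tsm_swap23 (V := V) (p := p) τ φ
  have e4 := tsm_rot (V := V) (p := p) τ (fun v a b => φ v b a)
  have e5 := tsm_rot (V := V) (p := p) τ (fun v a b => φ a v b)
  have tot : tsm V p τ φ + tsm V p τ (fun v a b => φ a b v) + tsm V p τ (fun v a b => φ b v a)
      + tsm V p τ (fun v a b => φ v b a) + tsm V p τ (fun v a b => φ a v b)
      + tsm V p τ (fun v a b => φ b a v) = tsm V p τ χ := by
    simp only [tsm_add]
    apply le_antisymm
    all_goals
      apply tsm_mono
      intro v a b hT
      have c1 : χ a b v = χ v a b := by rw [s23, s12]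
      have c2 : χ b v a = χ v a b := by rw [s12, s23]
      have c3 : χ b a v = χ v a b := by rw [s12, c1]
      have h1 := hinj v hT.lk1 a hT.lk2 hT.2.2.2.2.2.2.1
      have h2 := hinj v hT.lk1 b hT.lk3 hT.2.2.2.2.2.2.2.1
      have h3 := hinj a hT.lk2 b hT.lk3 hT.2.2.2.2.2.2.2.2.1
      simp only [hφ, c1, c2, c3, s12 v a b, s23 v a b]
      rcases lt_or_gt_of_ne h1 with h1 | h1 <;> rcases lt_or_gt_of_ne h2 with h2 | h2 <;>
      rcases lt_or_gt_of_ne h3 with h3 | h3 <;>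
      first
        | (exfalso; linarith)
        | simp [h1, h2, h3, not_lt.2 h1.le, not_lt.2 h2.le, not_lt.2 h3.le]
  have e6 : tsm V p τ (fun v a b => φ a v b) = tsm V p τ φ := (tsm_swap12 τ φ).symm
  omega

lemma tsm_lk (τ : Finset ι) (φ : ι → ι → ι → ℕ) :
    tsm V p τ φ = ∑ v ∈ lk V p τ, ∑ a ∈ V, ∑ b ∈ V,
      if Ed V p (insert v τ) a b then φ v a b else 0 := by
  unfold tsm
  have hs : lk V p τ ⊆ V := fun x hx => (mem_lk.1 hx).1
  rw [← Finset.sum_subset hs]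
  · refine Finset.sum_congr rfl fun v hv => Finset.sum_congr rfl fun a _ =>
      Finset.sum_congr rfl fun b _ => ?_
    have : Tr V p τ v a b ↔ Ed V p (insert v τ) a b := by
      rw [tr_iff]; exact and_iff_right hv
    simp only [this]
  · intro v _ hv
    refine Finset.sum_eq_zero fun a _ => Finset.sum_eq_zero fun b _ => ?_
    rw [if_neg]
    exact fun h => hv h.lk1

lemma lk_insert {τ : Finset ι} {v a : ι} (h : a ∈ lk V p (insert v τ)) :
    a ∈ lk V p τ ∧ a ≠ v := by
  obtain ⟨h1, h2, h3⟩ := mem_lk.1 h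
  simp only [Finset.mem_insert, not_or] at h2
  exact ⟨mem_lk.2 ⟨h1, h2.2, h3.mono (Finset.insert_subset_insert _ (Finset.subset_insert _ _))⟩,
    h2.1⟩

lemma cw_left {g : W →ₗ[ℝ] ℝ} {u v : W} (h : g u = 0) : 1 ≤ cw g u v := by
  simp only [cw, h, if_true]; omega

lemma cw_right {g : W →ₗ[ℝ] ℝ} {u v : W} (h : g v = 0) : 1 ≤ cw g u v := by
  simp only [cw, h, if_true]; omega

lemma cw_both {g : W →ₗ[ℝ] ℝ} {u v : W} (h : g u = 0) (h' : g v = 0) : 2 ≤ cw g u v := by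
  simp only [cw, h, h', if_true]; omega

lemma cw_cross {g : W →ₗ[ℝ] ℝ} {u v : W} (h : g u * g v < 0) : 2 ≤ cw g u v := by
  rcases mul_neg_iff.1 h with h | h
  · simp only [cw, h, and_self, if_true]; omega
  · simp only [cw, h, and_self, if_true]; omega

lemma tri_weight_aux {gv ga gb : W →ₗ[ℝ] ℝ} {v a b : W} (h1 : gv a = - ga v) (h2 : ga b = - gb a)
    (h3 : gb v = - gv b) (hn : ¬ (gv = 0 ∧ ga = 0 ∧ gb = 0)) (h0 : gv = 0) :
    2 ≤ (if ga = 0 then 0 else cw ga b v) + (if gb = 0 then 0 else cw gb v a) := by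
  have x0 : ga v = 0 := by rw [h0, LinearMap.zero_apply] at h1; linarith
  have z0 : gb v = 0 := by rw [h3, h0, LinearMap.zero_apply, neg_zero]
  by_cases e2 : ga = 0
  · have e3 : gb ≠ 0 := fun e3 => hn ⟨h0, e2, e3⟩
    have y0 : gb a = 0 := by rw [e2, LinearMap.zero_apply] at h2; linarith
    rw [if_neg e3]
    have := cw_both z0 y0
    omega
  · rw [if_neg e2]
    by_cases e3 : gb = 0
    · have y0 : ga b = 0 := by rw [h2, e3, LinearMap.zero_apply, neg_zero]
      have := cw_both y0 x0
      omega
    · rw [if_neg e3]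
      have := cw_right (u := b) x0
      have := cw_left (v := a) z0
      omega

lemma tri_weight {gv ga gb : W →ₗ[ℝ] ℝ} {v a b : W} (h1 : gv a = - ga v) (h2 : ga b = - gb a)
    (h3 : gb v = - gv b) (hn : ¬ (gv = 0 ∧ ga = 0 ∧ gb = 0)) :
    2 ≤ (if gv = 0 then 0 else cw gv a b) + (if ga = 0 then 0 else cw ga b v)
      + (if gb = 0 then 0 else cw gb v a) := by
  by_cases e1 : gv = 0
  · have := tri_weight_aux h1 h2 h3 hn e1
    omega
  by_cases e2 : ga = 0
  · have := tri_weight_aux h2 h3 h1 (by tauto) e2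
    omega
  by_cases e3 : gb = 0
  · have := tri_weight_aux h3 h1 h2 (by tauto) e3
    omega
  rw [if_neg e1, if_neg e2, if_neg e3]
  by_cases x0 : ga v = 0
  · have := cw_right (u := b) x0
    have := cw_left (g := gv) (u := a) (v := b) (by rw [h1, x0, neg_zero])
    omega
  by_cases y0 : gb a = 0
  · have := cw_right (u := v) y0
    have := cw_left (g := ga) (u := b) (v := v) (by rw [h2, y0, neg_zero])
    omega
  by_cases z0 : gv b = 0
  · have := cw_right (u := a) z0
    have := cw_left (g := gb) (u := v) (v := a) (by rw [h3, z0, neg_zero])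
    omega
  by_cases c1 : gv a * gv b < 0
  · have := cw_cross c1; omega
  by_cases c2 : ga b * ga v < 0
  · have := cw_cross c2; omega
  by_cases c3 : gb v * gb a < 0
  · have := cw_cross c3; omega
  exfalso
  rw [h1] at c1
  rw [h2] at c2
  rw [h3] at c3
  have q := mul_nonneg (mul_nonneg (not_lt.1 c1) (not_lt.1 c2)) (not_lt.1 c3)
  have q2 : 0 < (ga v * gb a * gv b) ^ 2 := by positivity
  nlinarith

lemma PolySetup.base (H : PolySetup V p) {τ : Finset ι} (hτ : Fc V p τ)
    (hc : τ.card + 4 = Module.finrank ℝ W) (g : ι → W →ₗ[ℝ] ℝ)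
    (hg0 : ∀ v ∈ lk V p τ, ∀ x ∈ insert v τ, g v (p x) = 0)
    (hanti : ∀ v a, Ed V p τ v a → g v (p a) = - g a (p v))
    (hZ : ∃ a b c, Tr V p τ a b c ∧ g a = 0 ∧ g b = 0 ∧ g c = 0) :
    ∀ v ∈ lk V p τ, g v = 0 := by
  by_contra hcon
  push Not at hcon
  obtain ⟨a, b, c, x, hT, hT2, ha, hb, hc', hx⟩ :=
    H.exists_boundary hτ hc (fun v => g v = 0) hZ hcon
  have hcx : c ≠ x := by rintro rfl; exact hx hc'
  obtain ⟨ψ0, h0, hp, -⟩ := H.exact hτ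
  obtain ⟨ψ, hψ0, hinj, hba, hac, hax⟩ := H.exists_height h0 hp hT hT2 hcx
  have hpl : ∀ u ∈ lk V p τ, 0 < ψ0 (p u) := fun u hu => hp u (mem_lk.1 hu).1 (mem_lk.1 hu).2.1
  have hFv : ∀ v ∈ lk V p τ, Fc V p (insert v τ) := fun v hv => (mem_lk.1 hv).2.2
  have hcv : ∀ v ∈ lk V p τ, (insert v τ).card + 3 = Module.finrank ℝ W := by
    intro v hv
    rw [Finset.card_insert_of_notMem (mem_lk.1 hv).2.1]
    omega
  set h : ι → ℝ := fun u => ψ (p u) / ψ0 (p u) with hh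
  let k : ι → W →ₗ[ℝ] ℝ := fun v => ψ0 (p v) • ψ - ψ (p v) • ψ0
  have hk : ∀ v ∈ lk V p τ, ∀ u ∈ lk V p τ,
      k v (p u) = ψ0 (p v) * ψ0 (p u) * (h u - h v) := by
    intro v hv u hu
    have := (hpl v hv).ne'
    have := (hpl u hu).ne'
    simp only [k, hh, LinearMap.sub_apply, LinearMap.smul_apply, smul_eq_mul]
    field_simp
  have hkz : ∀ v, ∀ y ∈ insert v τ, k v (p y) = 0 := by
    intro v y hy
    rcases Finset.mem_insert.1 hy with rfl | hy
    · simp [k, mul_comm]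
    · simp [k, hψ0 y hy, h0 y hy]
  have hkn : ∀ v ∈ lk V p τ, ∀ u ∈ lk V p τ, (k v (p u) < 0 ↔ h u < h v) := by
    intro v hv u hu
    have := mul_pos (hpl v hv) (hpl u hu)
    rw [hk v hv u hu, mul_neg_iff]
    constructor
    · rintro (⟨_, h⟩ | ⟨h, _⟩) <;> linarith
    · intro h; left; exact ⟨this, by linarith⟩
  have hkp : ∀ v ∈ lk V p τ, ∀ u ∈ lk V p τ, (0 < k v (p u) ↔ h v < h u) := by
    intro v hv u hu
    have := mul_pos (hpl v hv) (hpl u hu)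
    rw [hk v hv u hu, mul_pos_iff]
    constructor
    · rintro (⟨_, h⟩ | ⟨h, _⟩) <;> linarith
    · intro h; left; exact ⟨this, by linarith⟩
  have hcrs : ∀ v ∈ lk V p τ, ∀ u w, ((u, w) ∈ crs V p (insert v τ) (k v) ↔
      Ed V p (insert v τ) u w ∧ h u < h v ∧ h v < h w) := by
    intro v hv u w
    rw [mem_crs]
    constructor
    · rintro ⟨h1, h2, h3⟩
      exact ⟨h1, (hkn v hv u (lk_insert h1.left).1).1 h2, (hkp v hv w (lk_insert h1.right).1).1 h3⟩
    · rintro ⟨h1, h2, h3⟩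
      exact ⟨h1, (hkn v hv u (lk_insert h1.left).1).2 h2, (hkp v hv w (lk_insert h1.right).1).2 h3⟩
  have hcard : ∀ v ∈ lk V p τ, (crs V p (insert v τ) (k v)).card ≤ 2 := by
    intro v hv
    by_cases hk0 : k v = 0
    · rw [hk0]; simp [crs]
    · have := H.zero_cross (hFv v hv) (hcv v hv) hk0 (hkz v)
      omega
  let zs : ι → ι → ι → ℕ := fun v a b => if g v = 0 ∧ g a = 0 ∧ g b = 0 then 1 else 0
  let nz : ι → ι → ι → ℕ := fun v a b => if g v = 0 ∧ g a = 0 ∧ g b = 0 then 0 else 1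
  let Wt : ι → ι → ι → ℕ := fun v a b => if g v = 0 then 0 else cw (g v) (p a) (p b)
  set Zs := (lk V p τ).filter fun v => g v = 0 with hZs
  -- weights
  have E1 : tsm V p τ Wt + 8 * Zs.card ≤ 8 * (lk V p τ).card := by
    rw [tsm_lk, hZs, Finset.card_filter, Finset.mul_sum, ← Finset.sum_add_distrib, mul_comm,
      ← smul_eq_mul, ← Finset.sum_const]
    refine Finset.sum_le_sum fun v hv => ?_
    by_cases hv0 : g v = 0
    · simp [Wt, hv0]
    · simp only [Wt, hv0, if_false]
      have := H.wsum (hFv v hv) (hcv v hv) hv0 (hg0 v hv)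
      simpa using this
  have E2 : 2 * tsm V p τ nz ≤ 3 * tsm V p τ Wt := by
    have r1 := tsm_rot (V := V) (p := p) τ Wt
    have r2 := tsm_rot (V := V) (p := p) τ (fun v a b => Wt a b v)
    have : tsm V p τ nz + tsm V p τ nz ≤ tsm V p τ Wt + tsm V p τ (fun v a b => Wt a b v)
        + tsm V p τ (fun v a b => Wt b v a) := by
      simp only [tsm_add]
      apply tsm_mono
      intro v a b hT
      by_cases hn : g v = 0 ∧ g a = 0 ∧ g b = 0
      · simp [nz, hn]
      · have := tri_weight (hanti v a hT.ed') (hanti a b hT.swap12.swap23.ed')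
          (hanti b v hT.swap23.swap12.ed') hn
        simpa [nz, hn, Wt] using this
    omega
  have E3 := tsm_sym (V := V) (p := p) τ h hinj nz
    (by intro v a b; simp only [nz]; congr 1; ext; tauto)
    (by intro v a b; simp only [nz]; congr 1; ext; tauto)
  have E4 : tsm V p τ (fun v a b => if h a < h v ∧ h v < h b then nz v a b else 0) +
      tsm V p τ (fun v a b => if h a < h v ∧ h v < h b then zs v a b else 0) =
      ∑ v ∈ lk V p τ, (crs V p (insert v τ) (k v)).card := by
    rw [tsm_add, tsm_lk]
    refine Finset.sum_congr rfl fun v hv => ?_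
    rw [← Finset.sum_product', crs, Finset.card_filter]
    refine Finset.sum_congr rfl fun u hu => ?_
    have := hcrs v hv u.1 u.2
    rw [mem_crs] at this
    simp only [this]
    by_cases q1 : Ed V p (insert v τ) u.1 u.2 <;> by_cases q2 : h u.1 < h v ∧ h v < h u.2 <;>
    by_cases q3 : g v = 0 ∧ g u.1 = 0 ∧ g u.2 = 0 <;> simp [q1, q2, q3, nz, zs]
  have hlne : (lk V p τ).Nonempty := ⟨a, hT.lk1⟩
  have E5 : 2 * (lk V p τ).card ≤ ∑ v ∈ lk V p τ, (crs V p (insert v τ) (k v)).card + 4 := by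
    obtain ⟨t, ht, htm⟩ := Finset.exists_max_image _ h hlne
    obtain ⟨s, hs, hsm⟩ := Finset.exists_min_image _ h hlne
    have : ∑ v ∈ lk V p τ, 2 ≤ ∑ v ∈ lk V p τ, ((crs V p (insert v τ) (k v)).card +
        ((if v = t then 2 else 0) + (if v = s then 2 else 0))) := by
      refine Finset.sum_le_sum fun v hv => ?_
      by_cases hvt : v = t
      · simp [hvt]; omega
      by_cases hvs : v = s
      · simp [hvs]; omega
      have l1 : h v < h t := lt_of_le_of_ne (htm v hv) (hinj v hv t ht hvt)
      have l2 : h s < h v := lt_of_le_of_ne (hsm v hv) (hinj s hs v hv (Ne.symm hvs))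
      have := H.two_le_crs (hFv v hv) (hcv v hv) (hkz v) (by
        intro u hu hu0
        obtain ⟨hu1, hu2⟩ := lk_insert hu
        rw [hk v hv u hu1] at hu0
        have q := mul_pos (hpl v hv) (hpl u hu1)
        rcases mul_eq_zero.1 hu0 with e | e
        · exact q.ne' e
        · exact hinj u hu1 v hv hu2 (by linarith))
        ⟨t, (mem_lk.1 ht).1, (hkp v hv t ht).2 l1⟩ ⟨s, (mem_lk.1 hs).1, (hkn v hv s hs).2 l2⟩
      omega
    rw [Finset.sum_add_distrib, Finset.sum_add_distrib, Finset.sum_ite_eq', Finset.sum_ite_eq',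
      if_pos ht, if_pos hs, Finset.sum_const, smul_eq_mul] at this
    omega
  have E6 : tsm V p τ (fun v a b => if h a < h v ∧ h v < h b then zs v a b else 0) + 5
      ≤ 2 * Zs.card := by
    have haZ : a ∈ Zs := Finset.mem_filter.2 ⟨hT.lk1, ha⟩
    have hbZ : b ∈ Zs := Finset.mem_filter.2 ⟨hT.lk2, hb⟩
    have hcZ : c ∈ Zs := Finset.mem_filter.2 ⟨hT.lk3, hc'⟩
    obtain ⟨t, ht, htm⟩ := Finset.exists_max_image _ h ⟨a, haZ⟩
    obtain ⟨s, hs, hsm⟩ := Finset.exists_min_image _ h ⟨a, haZ⟩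
    have hta := htm c hcZ
    have hsa := hsm b hbZ
    have nta : t ≠ a := by rintro rfl; linarith
    have nsa : s ≠ a := by rintro rfl; linarith
    have nts : t ≠ s := by rintro rfl; linarith
    let c0 : ι → Finset (ι × ι) := fun v => (crs V p (insert v τ) (k v)).filter fun u =>
      g v = 0 ∧ g u.1 = 0 ∧ g u.2 = 0
    have e0 : tsm V p τ (fun v a b => if h a < h v ∧ h v < h b then zs v a b else 0) =
        ∑ v ∈ lk V p τ, (c0 v).card := by
      rw [tsm_lk]
      refine Finset.sum_congr rfl fun v hv => ?_
      simp only [c0]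
      rw [← Finset.sum_product', crs, Finset.filter_filter, Finset.card_filter]
      refine Finset.sum_congr rfl fun u hu => ?_
      have := hcrs v hv u.1 u.2
      rw [mem_crs] at this
      simp only [this]
      by_cases q1 : Ed V p (insert v τ) u.1 u.2 <;> by_cases q2 : h u.1 < h v ∧ h v < h u.2 <;>
      by_cases q3 : g v = 0 ∧ g u.1 = 0 ∧ g u.2 = 0 <;> simp [q1, q2, q3, zs]
    have hle : ∀ v ∈ lk V p τ, (c0 v).card ≤ 2 := fun v hv =>
      (Finset.card_le_card (Finset.filter_subset _ _)).trans (hcard v hv)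
    have h1 : ∑ v ∈ lk V p τ, ((c0 v).card +
        ((if v = t then 2 else 0) + ((if v = s then 2 else 0) + (if v = a then 1 else 0)))) ≤
        ∑ v ∈ lk V p τ, 2 * (if g v = 0 then 1 else 0) := by
      refine Finset.sum_le_sum fun v hv => ?_
      by_cases hv0 : g v = 0
      swap
      · have d1 : v ≠ t := by rintro rfl; exact hv0 (Finset.mem_filter.1 ht).2
        have d2 : v ≠ s := by rintro rfl; exact hv0 (Finset.mem_filter.1 hs).2
        have d3 : v ≠ a := by rintro rfl; exact hv0 ha
        simp [c0, hv0, d1, d2, d3]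
      by_cases d1 : v = t
      · have : c0 v = ∅ := by
          rw [Finset.eq_empty_iff_forall_notMem]
          rintro ⟨u, w⟩ hu
          simp only [c0, Finset.mem_filter, hcrs v hv] at hu
          have := htm w (Finset.mem_filter.2 ⟨(lk_insert hu.1.1.right).1, hu.2.2.2⟩)
          rw [← d1] at this
          linarith [hu.1.2.2]
        rw [this]
        subst d1
        simp [hv0, nts, nta]
      by_cases d2 : v = s
      · have : c0 v = ∅ := by
          rw [Finset.eq_empty_iff_forall_notMem]
          rintro ⟨u, w⟩ hu
          simp only [c0, Finset.mem_filter, hcrs v hv] at hu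
          have := hsm u (Finset.mem_filter.2 ⟨(lk_insert hu.1.1.left).1, hu.2.2.1⟩)
          rw [← d2] at this
          linarith [hu.1.2.1]
        rw [this]
        subst d2
        simp [hv0, Ne.symm nts, nsa]
      by_cases d3 : v = a
      · subst d3
        have m1 : (b, x) ∈ crs V p (insert v τ) (k v) := (hcrs v hv b x).2 ⟨hT2.ed, hba, hax⟩
        have m2 : c0 v ⊆ (crs V p (insert v τ) (k v)).erase (b, x) := by
          intro u hu
          simp only [c0, Finset.mem_filter] at hu
          refine Finset.mem_erase.2 ⟨?_, hu.1⟩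
          rintro rfl
          exact hx hu.2.2.2
        have m3 := Finset.card_le_card m2
        rw [Finset.card_erase_of_mem m1] at m3
        have := hcard v hv
        simp [hv0, d1, d2]
        omega
      · have := hle v hv
        simpa [hv0, d1, d2, d3] using this
    rw [Finset.sum_add_distrib, Finset.sum_add_distrib, Finset.sum_add_distrib,
      Finset.sum_ite_eq', Finset.sum_ite_eq', Finset.sum_ite_eq',
      if_pos (Finset.mem_filter.1 ht).1, if_pos (Finset.mem_filter.1 hs).1, if_pos hT.lk1,
      ← Finset.mul_sum, ← Finset.card_filter, ← e0] at h1
    omega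
  omega

theorem PolySetup.rigid (H : PolySetup V p) (g : ι → W →ₗ[ℝ] ℝ)
    (hself : ∀ v ∈ V, g v (p v) = 0) : ∀ (n : ℕ) (τ : Finset ι), Fc V p τ →
    τ.card + 4 + n = Module.finrank ℝ W →
    (∀ u ∈ V, ∀ v ∈ V, Fc V p (insert u (insert v τ)) → g u (p v) = - g v (p u)) →
    ∀ F : Finset ι, τ ⊆ F → Fc V p F → F.card + 1 = Module.finrank ℝ W →
    (∀ v ∈ F, g v = 0) → ∀ v ∈ V, Fc V p (insert v τ) → g v = 0 := by
  intro n
  induction n with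
  | zero =>
    intro τ hτ hc hanti F hτF hF hFc hF0 v hv hvτ
    by_cases hvm : v ∈ τ
    · exact hF0 v (hτF hvm)
    refine H.base hτ (by omega) g ?_ ?_ ?_ v (mem_lk.2 ⟨hv, hvm, hvτ⟩)
    · intro v hv x hx
      obtain ⟨v1, v2, v3⟩ := mem_lk.1 hv
      rcases Finset.mem_insert.1 hx with rfl | hx
      · exact hself _ v1
      · rw [hanti v v1 x (hτ.1 hx) (by rwa [Finset.insert_eq_of_mem hx]), hF0 x (hτF hx)]
        simp
    · intro v a h
      exact hanti v h.1 a h.2.1 h.2.2.2.2.2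
    · have h3 : (F \ τ).card = 3 := by
        rw [Finset.card_sdiff_of_subset hτF]
        omega
      obtain ⟨a, b, c, hab, hac, hbc, he⟩ := Finset.card_eq_three.1 h3
      have ha : a ∈ F \ τ := by rw [he]; simp
      have hb : b ∈ F \ τ := by rw [he]; simp
      have hc : c ∈ F \ τ := by rw [he]; simp
      rw [Finset.mem_sdiff] at ha hb hc
      refine ⟨a, b, c, ⟨hF.1 ha.1, hF.1 hb.1, hF.1 hc.1, ha.2, hb.2, hc.2, hab, hac, hbc,
        hF.mono ?_⟩, hF0 a ha.1, hF0 b hb.1, hF0 c hc.1⟩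
      simp only [Finset.insert_subset_iff]
      exact ⟨ha.1, hb.1, hc.1, hτF⟩
  | succ n ih =>
    intro τ hτ hc hanti F hτF hF hFc hF0 v hv hvτ
    by_cases hvm : v ∈ τ
    · exact hF0 v (hτF hvm)
    have key : ∀ u ∈ V, u ∉ τ → Fc V p (insert u τ) →
        (∃ F, insert u τ ⊆ F ∧ Fc V p F ∧ F.card + 1 = Module.finrank ℝ W ∧ ∀ v ∈ F, g v = 0) →
        ∀ y ∈ V, Fc V p (insert y (insert u τ)) → g y = 0 := by
      rintro u hu huτ hFu ⟨F, h1, h2, h3, h4⟩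
      refine ih (insert u τ) hFu (by rw [Finset.card_insert_of_notMem huτ]; omega) ?_ F h1 h2 h3 h4
      intro a ha b hb hab
      exact hanti a ha b hb (hab.mono (Finset.insert_subset_insert _
        (Finset.insert_subset_insert _ (Finset.subset_insert _ _))))
    have := H.connected hτ (by omega) (fun u => ∃ F, insert u τ ⊆ F ∧ Fc V p F ∧
      F.card + 1 = Module.finrank ℝ W ∧ ∀ v ∈ F, g v = 0) ?_ ?_ v hv hvm hvτ
    · obtain ⟨F, h1, h2, h3, h4⟩ := this
      exact h4 v (h1 (Finset.mem_insert_self _ _))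
    · have h3 : 0 < (F \ τ).card := by
        rw [Finset.card_sdiff_of_subset hτF]
        omega
      obtain ⟨s, hs⟩ := Finset.card_pos.1 h3
      rw [Finset.mem_sdiff] at hs
      have hsF : insert s τ ⊆ F := Finset.insert_subset hs.1 hτF
      exact ⟨s, hF.1 hs.1, hs.2, hF.mono hsF, F, hsF, hF, hFc, hF0⟩
    · intro u hu w hw huτ hwτ huw hFc2 hSu
      obtain ⟨F', h1, h2, h3⟩ := H.exists_facet hFc2
      refine ⟨F', (Finset.subset_insert _ _).trans h1, h2, h3, fun y hy => ?_⟩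
      refine key u hu huτ (hFc2.mono (Finset.insert_subset_insert _ (Finset.subset_insert _ _)))
        hSu y (h2.1 hy) (h2.mono ?_)
      refine Finset.insert_subset hy ?_
      exact (Finset.insert_subset_insert _ (Finset.subset_insert _ _)).trans h1

end Abstract

lemma exists_alt {ι W : Type} [AddCommGroup W] [Module ℝ W] {p : ι → W} {F : Set ι}
    (hli : LinearIndepOn ℝ p F) (g : ι → W →ₗ[ℝ] ℝ)
    (hg : ∀ u ∈ F, ∀ v ∈ F, g u (p v) = - g v (p u)) :
    ∃ T : W →ₗ[ℝ] W →ₗ[ℝ] ℝ, (∀ x y, T x y = - T y x) ∧ ∀ v ∈ F, T (p v) = g v := by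
  let S := Submodule.span ℝ (Set.range fun x : F => p x)
  let bs := Module.Basis.span (R := ℝ) (v := fun x : F => p x) hli
  have hbs : ∀ i : F, ((bs i : S) : W) = p i := fun i => by
    exact congrArg Subtype.val (Module.Basis.span_apply hli i)
  let G : S →ₗ[ℝ] (W →ₗ[ℝ] ℝ) := bs.constr ℝ (fun i : F => g i)
  have hG : ∀ i : F, G (bs i) = g i := fun i => bs.constr_basis ℝ _ i
  obtain ⟨P, hP⟩ := LinearMap.exists_leftInverse_of_injective S.subtype S.ker_subtype
  have hP' : ∀ s : S, P (s : W) = s := fun s => LinearMap.congr_fun hP s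
  have hal : ∀ x y : S, G x (y : W) = - G y (x : W) := by
    intro x y
    let B : S →ₗ[ℝ] S →ₗ[ℝ] ℝ := G.compl₂ S.subtype
    have hB : B = - B.flip := by
      apply bs.ext
      intro i
      apply bs.ext
      intro j
      change G (bs i) ((bs j : S) : W) = - G (bs j) ((bs i : S) : W)
      rw [hG, hG, hbs, hbs]
      exact hg i i.2 j j.2
    exact LinearMap.congr_fun (LinearMap.congr_fun hB x) y
  let B1 : W →ₗ[ℝ] W →ₗ[ℝ] ℝ := G ∘ₗ P
  let B2 : W →ₗ[ℝ] W →ₗ[ℝ] ℝ := B1.compl₂ (S.subtype ∘ₗ P)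
  have h1 : ∀ x y, B1 x y = G (P x) y := fun x y => rfl
  have h2 : ∀ x y, B2 x y = G (P x) (P y : W) := fun x y => rfl
  refine ⟨B1 - B1.flip - B2, ?_, ?_⟩
  · intro x y
    simp only [LinearMap.sub_apply, LinearMap.flip_apply, h1, h2]
    have := hal (P x) (P y)
    linarith
  · intro v hv
    ext y
    simp only [LinearMap.sub_apply, LinearMap.flip_apply, h1, h2]
    have e : P (p v) = bs ⟨v, hv⟩ := by rw [← hP' (bs ⟨v, hv⟩), hbs]
    have := hal (P (p v)) (P y)
    rw [e] at this ⊢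
    rw [hbs] at this
    rw [hG] at this ⊢
    simp only at this ⊢
    linarith

/-- Homogenization. -/
def hom1 {d : ℕ} (x : Fin d → ℝ) : (Fin d → ℝ) × ℝ := (x, 1)

lemma phi_hom {d : ℕ} (φ : ((Fin d → ℝ) × ℝ) →ₗ[ℝ] ℝ) (x : Fin d → ℝ) :
    φ (hom1 x) = φ (x, 0) + φ (0, 1) := by
  rw [← map_add]; simp [hom1]

lemma polytope_zero {d : ℕ} (P : SPolytope d) (φ : ((Fin d → ℝ) × ℝ) →ₗ[ℝ] ℝ)
    (h : ∀ x ∈ P.V, φ (hom1 x) = 0) : φ = 0 := by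
  let α : (Fin d → ℝ) →ᵃ[ℝ] ℝ :=
    (φ ∘ₗ LinearMap.inl ℝ (Fin d → ℝ) ℝ).toAffineMap + AffineMap.const ℝ _ (φ (0, 1))
  have hα : ∀ x, α x = φ (hom1 x) := fun x => by rw [phi_hom]; rfl
  have hz : ∀ x, φ (hom1 x) = 0 := by
    intro x
    have hx : x ∈ affineSpan ℝ (P.V : Set (Fin d → ℝ)) := by rw [P.span_top]; trivial
    rw [← hα]
    refine affineSpan_induction hx (fun x hx => by rw [hα]; exact h x hx) ?_
    intro c u v w hu hv hw
    rw [AffineMap.map_vadd, map_smul, AffineMap.linearMap_vsub]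
    simp [hu, hv, hw]
  have h01 : φ (0, 1) = 0 := hz 0
  refine LinearMap.ext fun w => ?_
  have := hz w.1
  rw [phi_hom, h01] at this
  have e : w = (w.1, 0) + w.2 • (0, 1) := by ext <;> simp
  rw [e, map_add, map_smul, h01]
  simpa using this

lemma hull_nonneg {d : ℕ} (V : Finset (Fin d → ℝ)) (φ : ((Fin d → ℝ) × ℝ) →ₗ[ℝ] ℝ)
    (h : ∀ x ∈ V, 0 ≤ φ (hom1 x)) : ∀ y ∈ polyBody V, 0 ≤ φ (hom1 y) := by
  intro y hy
  have hc : Convex ℝ {y : Fin d → ℝ | 0 ≤ φ (hom1 y)} := by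
    intro u hu v hv a b ha hb hab
    simp only [Set.mem_ofPred_eq] at *
    have : hom1 (a • u + b • v) = a • hom1 u + b • hom1 v := by
      ext <;> simp [hom1, hab]
    rw [this, map_add, map_smul, map_smul, smul_eq_mul, smul_eq_mul]
    positivity
  exact convexHull_min (fun x hx => h x hx) hc hy

lemma proper_face_of {d : ℕ} (P : SPolytope d) (φ : ((Fin d → ℝ) × ℝ) →ₗ[ℝ] ℝ) (h0 : φ ≠ 0)
    (h : ∀ x ∈ P.V, 0 ≤ φ (hom1 x)) :
    IsProperFace P.V {y | y ∈ polyBody P.V ∧ φ (hom1 y) = 0} := by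
  refine ⟨⟨-(φ ∘ₗ LinearMap.inl ℝ (Fin d → ℝ) ℝ), φ (0, 1), ?_, ?_⟩, ?_⟩
  · intro y hy
    have := hull_nonneg P.V φ h y hy
    rw [phi_hom] at this
    simp
    linarith
  · ext y
    simp only [Set.mem_ofPred_eq, phi_hom, LinearMap.neg_apply, LinearMap.comp_apply,
      LinearMap.inl_apply]
    constructor
    · rintro ⟨h1, h2⟩; exact ⟨h1, by linarith⟩
    · rintro ⟨h1, h2⟩; exact ⟨h1, by linarith⟩
  · intro he
    apply h0
    apply polytope_zero P
    intro x hx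
    have : x ∈ polyBody P.V := subset_convexHull ℝ _ hx
    rw [← he] at this
    exact this.2

lemma polytope_setup {d : ℕ} (P : SPolytope d) : PolySetup P.V (hom1 (d := d)) := by
  refine ⟨polytope_zero P, ?_⟩
  intro φ h0 h
  have hs := (P.simplicial _ (proper_face_of P φ h0 h)).1
  rw [affineIndependent_iff] at hs
  rw [LinearIndepOn, linearIndependent_iff']
  intro s c hc i hi
  have hmem : ∀ x : {x | x ∈ P.V ∧ φ (hom1 x) = 0}, (x : Fin d → ℝ) ∈
      (P.V : Set (Fin d → ℝ)) ∩ {y | y ∈ polyBody P.V ∧ φ (hom1 y) = 0} :=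
    fun x => ⟨x.2.1, subset_convexHull ℝ _ x.2.1, x.2.2⟩
  let em : {x | x ∈ P.V ∧ φ (hom1 x) = 0} ↪ {y : Fin d → ℝ // y ∈
      (P.V : Set (Fin d → ℝ)) ∩ {y | y ∈ polyBody P.V ∧ φ (hom1 y) = 0}} :=
    ⟨fun x => ⟨x, hmem x⟩, fun x y hxy => Subtype.ext (by simpa using hxy)⟩
  let c' : {y : Fin d → ℝ // y ∈ (P.V : Set (Fin d → ℝ)) ∩
      {y | y ∈ polyBody P.V ∧ φ (hom1 y) = 0}} → ℝ := fun y => c ⟨y, y.2.1, y.2.2.2⟩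
  have h1 : ∑ x ∈ s, c x • (x : Fin d → ℝ) = 0 := by
    have := congrArg Prod.fst hc
    rw [Prod.fst_sum] at this
    simpa [hom1] using this
  have h2 : ∑ x ∈ s, c x = 0 := by
    have := congrArg Prod.snd hc
    rw [Prod.snd_sum] at this
    simpa [hom1] using this
  exact hs (s.map em) c' (by rw [Finset.sum_map]; exact h2) (by rw [Finset.sum_map]; exact h1)
    (em i) (Finset.mem_map_of_mem _ hi)

lemma bface_iff {d : ℕ} (P : SPolytope d) (s : Finset (Fin d → ℝ)) :
    BFace P s ↔ Fc P.V (hom1 (d := d)) s := by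
  constructor
  · rintro ⟨h1, F, ⟨⟨f, c, hf, rfl⟩, hne⟩, hs⟩
    let φ : ((Fin d → ℝ) × ℝ) →ₗ[ℝ] ℝ :=
      c • LinearMap.snd ℝ (Fin d → ℝ) ℝ - f ∘ₗ LinearMap.fst ℝ (Fin d → ℝ) ℝ
    have hφ : ∀ x, φ (hom1 x) = c - f x := fun x => by simp [φ, hom1]
    refine ⟨h1, φ, ?_, ?_, ?_⟩
    · intro h0
      apply hne
      ext y
      simp only [Set.mem_ofPred_eq, and_iff_left_iff_imp]
      intro _
      have := hφ y
      rw [h0, LinearMap.zero_apply] at this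
      linarith
    · intro x hx
      have := hf x (subset_convexHull ℝ _ hx)
      rw [hφ]; linarith
    · intro x hx
      have := (hs hx).2
      rw [hφ]; linarith
  · rintro ⟨h1, φ, h0, h2, h3⟩
    exact ⟨h1, _, proper_face_of P φ h0 h2, fun x hx =>
      ⟨subset_convexHull ℝ _ (h1 hx), h3 x hx⟩⟩

/-- The functional attached to a velocity. -/
def gmo {d : ℕ} (m : (Fin d → ℝ) → Fin d → ℝ) (v : Fin d → ℝ) :
    ((Fin d → ℝ) × ℝ) →ₗ[ℝ] ℝ where
  toFun w := dotR w.1 (m v) - w.2 * dotR v (m v)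
  map_add' x y := by
    simp only [dotR, Prod.fst_add, Prod.snd_add, Pi.add_apply, add_mul, Finset.sum_add_distrib]
    ring
  map_smul' c x := by
    simp only [dotR, Prod.smul_fst, Prod.smul_snd, Pi.smul_apply, smul_eq_mul, mul_assoc,
      ← Finset.mul_sum, RingHom.id_apply]
    ring

lemma gmo_apply {d : ℕ} (m : (Fin d → ℝ) → Fin d → ℝ) (v : Fin d → ℝ)
    (w : (Fin d → ℝ) × ℝ) : gmo m v w = dotR w.1 (m v) - w.2 * dotR v (m v) := rfl

lemma gmo_anti {d : ℕ} (m : (Fin d → ℝ) → Fin d → ℝ) (u v : Fin d → ℝ)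
    (h : dotR (u - v) (m u - m v) = 0) : gmo m u (hom1 v) = - gmo m v (hom1 u) := by
  simp only [gmo_apply, hom1]
  simp only [dotR, Pi.sub_apply, sub_mul, mul_sub, Finset.sum_sub_distrib] at *
  linarith

/-- For `d ≥ 4`, a simplicial `d`-polytope `P` with its natural embedding,
and every nonempty face `τ` of `∂P` with `|τ| ≤ d - 3`, the framework on the graph of
the star `st(τ)` is infinitesimally rigid in `ℝ^d`. -/
theorem stmt5 {d : ℕ} (hd : 4 ≤ d) (P : SPolytope d) (τ : Finset (Fin d → ℝ))
    (hτ : BFace P τ) (hne : τ.Nonempty) (hcard : τ.card ≤ d - 3) :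
    IsInfRigid d (starGraph P τ) (fun x => x) := by
  intro m hm
  have H := polytope_setup P
  have hτ' := (bface_iff P τ).1 hτ
  have hfr : Module.finrank ℝ ((Fin d → ℝ) × ℝ) = d + 1 := by simp
  obtain ⟨F, hτF, hF, hFc⟩ := H.exists_facet hτ'
  have hdot : ∀ u ∈ P.V, ∀ v ∈ P.V, Fc P.V (hom1 (d := d)) (insert u (insert v τ)) →
      dotR (u - v) (m u - m v) = 0 := by
    intro u hu v hv huv
    by_cases huv' : u = v
    · subst huv'; simp [dotR]
    have he : ({u, v} : Finset (Fin d → ℝ)) ∈ (starGraph P τ).edges := by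
      simp only [starGraph, Finset.mem_filter, Finset.mem_powerset]
      refine ⟨?_, Finset.card_pair huv', ?_⟩
      · intro x hx
        simp only [Finset.mem_insert, Finset.mem_singleton] at hx
        rcases hx with rfl | rfl <;> assumption
      · rw [bface_iff]
        convert huv using 1
        ext x
        simp [or_assoc]
    exact hm _ he u (by simp) v (by simp)
  have hanti : ∀ u ∈ P.V, ∀ v ∈ P.V, Fc P.V (hom1 (d := d)) (insert u (insert v τ)) →
      gmo m u (hom1 v) = - gmo m v (hom1 u) := fun u hu v hv h =>
    gmo_anti m u v (hdot u hu v hv h)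
  obtain ⟨T, hT, hTF⟩ := exists_alt (H.linInd hF) (gmo m) (by
    intro u hu v hv
    exact hanti u (hF.1 hu) v (hF.1 hv) (hF.mono
      (Finset.insert_subset hu (Finset.insert_subset hv hτF))))
  have hz := H.rigid (fun v => gmo m v - T (hom1 v)) (by
      intro v hv
      have h1 := hT (hom1 v) (hom1 v)
      have h2 : gmo m v (hom1 v) = 0 := by simp [gmo_apply, hom1]
      simp only [LinearMap.sub_apply, h2]
      linarith) (d + 1 - 4 - τ.card) τ hτ' (by rw [hfr]; omega) (by
      intro u hu v hv h
      have h1 := hT (hom1 v) (hom1 u)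
      have h2 := hanti u hu v hv h
      simp only [LinearMap.sub_apply]
      linarith) F hτF hF hFc (by
      intro v hv
      simp only [hTF v hv, sub_self])
  refine ⟨Matrix.of fun i j => T (Pi.single j 1, 0) (Pi.single i 1, 0),
    fun i => T (0, 1) (Pi.single i 1, 0), ?_, ?_⟩
  · ext i j
    simp only [Matrix.transpose_apply, Matrix.of_apply, Matrix.neg_apply]
    exact hT _ _
  · intro v hv
    simp only [starGraph, Finset.mem_filter] at hv
    have h0 := hz v hv.1 ((bface_iff P _).1 hv.2)
    have h1 : gmo m v = T (hom1 v) := sub_eq_zero.1 h0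
    funext i
    have h2 := LinearMap.congr_fun h1 (Pi.single i 1, 0)
    have h3 : gmo m v (Pi.single i 1, 0) = m v i := by
      simp [gmo_apply, dotR, Pi.single_apply]
    have h4 : hom1 v = ∑ j, v j • ((Pi.single j 1, 0) : (Fin d → ℝ) × ℝ) + (0, 1) := by
      apply Prod.ext
      · rw [Prod.fst_add, Prod.fst_sum]
        funext k
        simp [hom1, Finset.sum_apply, Pi.single_apply]
      · rw [Prod.snd_add, Prod.snd_sum]
        simp [hom1]
    rw [h3, h4, map_add, map_sum] at h2
    simp only [map_smul] at h2
    rw [h2]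
    simp [Matrix.mulVec, dotProduct, LinearMap.sum_apply, mul_comm]
end
end
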